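/- For every permutation w ∈ S∞ and every flag φ, the φ-flagged Schubert polynomial 𝔖_(w,φ) is a non-negative sum of key polynomials: 𝔖_(w,φ) = Σ_α κ_(α,φ), where α ranges over all weak compositions such that YR_α(w^{-1}) is nonempty (counted with multiplicity equal to |YR_α(w^{-1})|), and each κ_(α,φ) is itself a key polynomial. -/

import Mathlib

noncomputable section
attribute [local instance] Classical.propDecidable

/-! ### Words, permutations, reduced words -/

/-- The adjacent transposition `s_i` exchanging `i` and `i+1`. -/
def sPerm (i : ℕ) : Equiv.Perm ℕ := Equiv.swap i (i + 1)

/-- The permutation `s_{i_1} ⋯ s_{i_n}` represented by the word `i_1 ⋯ i_n`. -/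
def wordPerm (ρ : List ℕ) : Equiv.Perm ℕ := (ρ.map sPerm).prod

/-- A word whose letters are positive integers. -/
def PosWord (ρ : List ℕ) : Prop := ∀ x ∈ ρ, 1 ≤ x

/-- A reduced word: a word of positive integers of minimal length among all words of
positive integers representing the same permutation. -/
def IsReducedWord (ρ : List ℕ) : Prop :=
  PosWord ρ ∧ ∀ σ : List ℕ, PosWord σ → wordPerm σ = wordPerm ρ → ρ.length ≤ σ.length

/-- `ρ` is a reduced word for the permutation `w`. -/
def IsReducedWordFor (w : Equiv.Perm ℕ) (ρ : List ℕ) : Prop :=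
  IsReducedWord ρ ∧ wordPerm ρ = w

/-- A member of `S∞`: a permutation of the positive integers (it fixes `0`)
fixing all but finitely many points. -/
def FinitaryPerm (w : Equiv.Perm ℕ) : Prop := w 0 = 0 ∧ {i : ℕ | w i ≠ i}.Finite

/-- A flag: a weakly increasing function `φ : ℤ_{>0} → ℤ_{>0}` with `φ(n) ≥ n`. -/
def IsFlag (φ : ℕ → ℕ) : Prop :=
  (∀ m n : ℕ, 1 ≤ m → m ≤ n → φ m ≤ φ n) ∧ ∀ n : ℕ, 1 ≤ n → n ≤ φ n

/-- A weak composition, as a function on the positive integers (value `0` at `0`)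
with finitely many nonzero entries. -/
def WeakComp (α : ℕ → ℕ) : Prop := α 0 = 0 ∧ {i : ℕ | α i ≠ 0}.Finite

/-- `φ - e_i`, i.e. `l ↦ φ(l) - δ_{il}`. -/
def subE (φ : ℕ → ℕ) (i : ℕ) : ℕ → ℕ := fun l => if l = i then φ l - 1 else φ l

/-- The right action of `s_i` on weak compositions, swapping entries `i` and `i+1`. -/
def swapC (α : ℕ → ℕ) (i : ℕ) : ℕ → ℕ := fun j => α (sPerm i j)

/-- `α` has length `k`: `k` is minimal with `α i = 0` for all `i > k`. -/
def HasLen (α : ℕ → ℕ) (k : ℕ) : Prop :=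
  (∀ i, k < i → α i = 0) ∧ ∀ m, (∀ i, m < i → α i = 0) → k ≤ m

/-! ### Coxeter–Knuth equivalence -/

/-- One Coxeter–Knuth move. -/
def CKStep (u v : List ℕ) : Prop :=
  (∃ (a b : List ℕ) (x y z : ℕ), y < x ∧ x < z ∧
      u = a ++ [x, y, z] ++ b ∧ v = a ++ [x, z, y] ++ b) ∨
  (∃ (a b : List ℕ) (x y z : ℕ), y < z ∧ z < x ∧
      u = a ++ [x, y, z] ++ b ∧ v = a ++ [y, x, z] ++ b) ∨
  (∃ (a b : List ℕ) (i : ℕ),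
      u = a ++ [i, i + 1, i] ++ b ∧ v = a ++ [i + 1, i, i + 1] ++ b)

/-- Coxeter–Knuth equivalence: the transitive (symmetric, reflexive) closure of `CKStep`. -/
def CKEquiv : List ℕ → List ℕ → Prop := Relation.EqvGen CKStep

/-! ### Run factorizations and weak descent tableaux -/

/-- The run factorization of a word into maximal strictly increasing blocks
(listed from left to right). -/
def runFact : List ℕ → List (List ℕ)
  | [] => []
  | a :: rest =>
    match runFact rest with
    | [] => [[a]]
    | r :: rs => if a < r.headI then (a :: r) :: rs else [a] :: r :: rs

/-- Auxiliary: rows of the remaining blocks, given the row of the previous block. -/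
def wdtRowsAux : ℤ → List (List ℕ) → List ℤ
  | _, [] => []
  | prev, b :: bs =>
      min (prev - 1) (b.headI : ℤ) :: wdtRowsAux (min (prev - 1) (b.headI : ℤ)) bs

/-- The row indices assigned to the blocks of a run factorization (blocks listed
left to right): the leftmost block goes to the row indexed by its first letter, and each
subsequent block goes to the row indexed by its first letter if this is below the previous
block's row, and otherwise directly below the previous block's row. -/
def wdtRows : List (List ℕ) → List ℤ
  | [] => []
  | b :: bs => (b.headI : ℤ) :: wdtRowsAux (b.headI : ℤ) bs

/-- A tableau: rows indexed by `ℤ` (bottom to top), columns indexed by `ℕ` starting at `1`;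
the value `0` means that there is no box, a nonzero value is the (positive) entry. -/
abbrev Tableau := ℤ → ℕ → ℕ

/-- The weak descent tableau of a word. -/
def weakDesTab (ρ : List ℕ) : Tableau := fun r c =>
  if c = 0 then 0
  else
    match ((wdtRows (runFact ρ)).zip (runFact ρ)).find? (fun p => decide (p.1 = r)) with
    | some p => p.2.getD (c - 1) 0
    | none => 0

/-- A word is non-virtual if its weak descent tableau only occupies rows of positive index. -/
def NonVirtual (ρ : List ℕ) : Prop := ∀ r ∈ wdtRows (runFact ρ), 1 ≤ r

/-- The shape of a tableau: the number of boxes in each (positively indexed) row. -/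
def shapeOf (T : Tableau) : ℕ → ℕ := fun i => Set.ncard {c : ℕ | T (i : ℤ) c ≠ 0}

/-- The weak descent composition of a word: the shape of its weak descent tableau. -/
def desComp (ρ : List ℕ) : ℕ → ℕ := shapeOf (weakDesTab ρ)

/-- Partial-sum (dominance) order on weak compositions. -/
def compLE (μ ν : ℕ → ℕ) : Prop :=
  ∀ k : ℕ, ∑ i ∈ Finset.Icc 1 k, μ i ≤ ∑ i ∈ Finset.Icc 1 k, ν i

/-- A Yamanouchi reduced word: a non-virtual reduced word that is minimal in its
Coxeter–Knuth class among non-virtual words, for the order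
`ρ ≤ τ ↔ ρ ~ τ ∧ des ρ ≤ des τ`. -/
def Yamanouchi (ρ : List ℕ) : Prop :=
  IsReducedWord ρ ∧ NonVirtual ρ ∧
    ∀ σ : List ℕ, NonVirtual σ → CKEquiv ρ σ → compLE (desComp ρ) (desComp σ)

/-- The (unique) Yamanouchi reduced word Coxeter–Knuth equivalent to `ρ`. -/
def hatRho (ρ : List ℕ) : List ℕ :=
  if h : ∃ σ, Yamanouchi σ ∧ CKEquiv ρ σ then h.choose else []

/-- The weak Edelman–Greene insertion tableau of a word: the weak descent tableau of the
unique Yamanouchi reduced word Coxeter–Knuth equivalent to it. -/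
def hatP (ρ : List ℕ) : Tableau := weakDesTab (hatRho ρ)

/-! ### Factorizations -/

/-- The factorization `f : ℕ → List ℕ` stores the block `ρ^{(i)}` at index `i ≥ 1`
(blocks indexed from the right); the largest index of a nonempty block. -/
def topIdx (f : ℕ → List ℕ) : ℕ := sSup {i : ℕ | f i ≠ []}

/-- The concatenation `ρ^{(top)} ⋯ ρ^{(i+1)} ρ^{(i)}` of the blocks of `f` with index `≥ i`. -/
def factWordGe (f : ℕ → List ℕ) (i : ℕ) : List ℕ :=
  ((((List.range (topIdx f + 1)).reverse).filter (fun j => decide (i ≤ j))).map f).foldr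
    (· ++ ·) []

/-- The underlying word of a factorization. -/
def factWord (f : ℕ → List ℕ) : List ℕ := factWordGe f 0

/-- The weak Edelman–Greene recording tableau of a factorization: it has the same shape as
the weak EG insertion tableau of the underlying word, and has entry `i` in all boxes of
`P̂(ρ^{(k)}|⋯|ρ^{(i)})` that are not in `P̂(ρ^{(k)}|⋯|ρ^{(i+1)})`. -/
def hatQfact (f : ℕ → List ℕ) : Tableau := fun r c =>
  sSup {i : ℕ | 1 ≤ i ∧ hatP (factWordGe f i) r c ≠ 0 ∧ hatP (factWordGe f (i + 1)) r c = 0}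

/-- Every block is strictly increasing. -/
def IncreasingFact (f : ℕ → List ℕ) : Prop := ∀ i, List.Chain' (· < ·) (f i)

/-- The factorization is `φ`-flagged: every nonempty block `ρ^{(i)}` has first letter
`ρ^{(i)}_1` with `φ(ρ^{(i)}_1) ≥ i`. -/
def FlaggedFact (φ : ℕ → ℕ) (f : ℕ → List ℕ) : Prop :=
  ∀ i, f i ≠ [] → i ≤ φ ((f i).headI)

/-- `RFC(w, φ)`: all `φ`-flagged increasing factorizations of reduced words for `w`. -/
def RFCset (w : Equiv.Perm ℕ) (φ : ℕ → ℕ) : Set (ℕ → List ℕ) :=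
  {f | f 0 = [] ∧ {i : ℕ | f i ≠ []}.Finite ∧ IncreasingFact f ∧ FlaggedFact φ f ∧
       IsReducedWordFor w (factWord f)}

/-- `RF_n(w)`: increasing factorizations of reduced words for `w` with exactly `n` blocks
(indexed `1, …, n`, possibly empty). -/
def RFn (n : ℕ) (w : Equiv.Perm ℕ) : Set (ℕ → List ℕ) :=
  {f | f 0 = [] ∧ (∀ j, n < j → f j = []) ∧ IncreasingFact f ∧
       IsReducedWordFor w (factWord f)}

/-- `RFC_n(w, φ)`: the `φ`-flagged elements of `RF_n(w)`. -/
def RFCn (n : ℕ) (w : Equiv.Perm ℕ) (φ : ℕ → ℕ) : Set (ℕ → List ℕ) :=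
  {f | f ∈ RFn n w ∧ FlaggedFact φ f}

/-! ### Morse–Schilling crystal operators -/

/-- Pairing procedure: first argument is the block `r^{(i)}` in *decreasing* order, second is
the not-yet-paired part of the block `r^{(i+1)}` (in increasing order). Each letter `b` of
`r^{(i)}`, from largest to smallest, is paired with the smallest still unpaired letter of
`r^{(i+1)}` strictly larger than `b`. Returns the unpaired letters of `r^{(i+1)}`. -/
def unpairedUpper : List ℕ → List ℕ → List ℕ
  | [], A => A
  | b :: bs, A =>
    match A.find? (fun a => decide (b < a)) with
    | some a => unpairedUpper bs (A.erase a)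
    | none => unpairedUpper bs A

/-- As in `unpairedUpper`, but returns the unpaired letters of `r^{(i)}`. -/
def unpairedLower : List ℕ → List ℕ → List ℕ
  | [], _ => []
  | b :: bs, A =>
    match A.find? (fun a => decide (b < a)) with
    | some a => unpairedLower bs (A.erase a)
    | none => b :: unpairedLower bs A

/-- Insert a letter into a weakly increasing list, keeping it increasing. -/
def insAsc (x : ℕ) : List ℕ → List ℕ
  | [] => [x]
  | y :: ys => if x ≤ y then x :: y :: ys else y :: insAsc x ys

/-- The Morse–Schilling raising operator `e_i`: if every letter of block `i+1` is paired,
the result is `none` (i.e. `0`); otherwise the largest unpaired letter `a` of block `i+1` is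
removed and `a + s` is added to block `i`, where `s = min {j ≥ 0 | a+j+1 ∉ r^{(i+1)}}`. -/
def msE (i : ℕ) (f : ℕ → List ℕ) : Option (ℕ → List ℕ) :=
  let B := f i
  let A := f (i + 1)
  let L := unpairedUpper B.reverse A
  if L = [] then none
  else
    let a := L.foldr max 0
    let s := sInf {j : ℕ | (a + j + 1) ∉ A}
    some (Function.update (Function.update f (i + 1) (A.erase a)) i (insAsc (a + s) B))

/-- The Morse–Schilling lowering operator `f_i`: if every letter of block `i` is paired,
the result is `none`; otherwise the smallest unpaired letter `b` of block `i` is removed and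
`b - t` is added to block `i+1`, where `t = min {j ≥ 0 | b-j-1 ∉ r^{(i)}}`. -/
def msF (i : ℕ) (f : ℕ → List ℕ) : Option (ℕ → List ℕ) :=
  let B := f i
  let A := f (i + 1)
  let R := unpairedLower B.reverse A
  if R = [] then none
  else
    let b := R.foldr min R.headI
    let t := sInf {j : ℕ | (b - j - 1) ∉ B}
    some (Function.update (Function.update f i (B.erase b)) (i + 1) (insAsc (b - t) A))

/-- Iteration `e_j^k` of the raising operator. -/
def msEIter (j : ℕ) : ℕ → (ℕ → List ℕ) → Option (ℕ → List ℕ)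
  | 0, f => some f
  | k + 1, f => (msE j f).bind (msEIter j k)

/-- The Demazure operator `𝔇_j` on subsets of the crystal `RF_n(w)`:
`𝔇_j X = {b ∈ RF_n(w) | e_j^k(b) ∈ X for some k ≥ 0}`. -/
def demOp (n : ℕ) (w : Equiv.Perm ℕ) (j : ℕ) (X : Set (ℕ → List ℕ)) : Set (ℕ → List ℕ) :=
  {b | b ∈ RFn n w ∧ ∃ (k : ℕ) (c : ℕ → List ℕ), msEIter j k b = some c ∧ c ∈ X}

/-- `𝔇_{i_1} 𝔇_{i_2} ⋯ 𝔇_{i_k} X` for a word `i_1 i_2 ⋯ i_k` (the head is applied last). -/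
def demWord (n : ℕ) (w : Equiv.Perm ℕ) : List ℕ → Set (ℕ → List ℕ) → Set (ℕ → List ℕ)
  | [], X => X
  | j :: rest, X => demOp n w j (demWord n w rest X)

/-- `𝔇_{b↓a} = 𝔇_{b-1} 𝔇_{b-2} ⋯ 𝔇_a` (the identity when `b ≤ a`). -/
def demDown (n : ℕ) (w : Equiv.Perm ℕ) (b a : ℕ) (X : Set (ℕ → List ℕ)) :
    Set (ℕ → List ℕ) :=
  demWord n w ((List.range' a (b - a)).reverse) X

/-! ### Key tableaux -/

/-- A key tableau: a filling of a left-justified diagram in the positively indexed rows,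
with positive entries, weakly decreasing rows, distinct column entries, and the key
condition (c) of Assaf–Schilling. -/
def IsKeyTableau (T : Tableau) : Prop :=
  (∀ (r : ℤ) (c : ℕ), r ≤ 0 → T r c = 0) ∧
  (∀ r : ℤ, T r 0 = 0) ∧
  {p : ℤ × ℕ | T p.1 p.2 ≠ 0}.Finite ∧
  (∀ (r : ℤ) (c : ℕ), 1 ≤ c → T r (c + 1) ≠ 0 → T r c ≠ 0) ∧
  (∀ (r : ℤ) (c : ℕ), 1 ≤ c → T r (c + 1) ≠ 0 → T r (c + 1) ≤ T r c) ∧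
  (∀ (r r' : ℤ) (c : ℕ), r ≠ r' → T r c ≠ 0 → T r' c ≠ 0 → T r c ≠ T r' c) ∧
  (∀ (r r' : ℤ) (c : ℕ), r < r' → T r c ≠ 0 → T r' c ≠ 0 → T r' c < T r c →
      T r (c + 1) ≠ 0 ∧ T r' c < T r (c + 1))

/-- The tableau is `φ`-flagged: every entry in row `i` is at most `φ(i)`. -/
def FlaggedTab (φ : ℕ → ℕ) (T : Tableau) : Prop := ∀ (i c : ℕ), T (i : ℤ) c ≤ φ i

/-- `SSKT(α, φ)`: the `φ`-flagged key tableaux of shape `α`. -/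
def SSKT (α φ : ℕ → ℕ) : Set Tableau :=
  {T | IsKeyTableau T ∧ shapeOf T = α ∧ FlaggedTab φ T}

/-- The weight of a tableau: `wt(T)_v` is the number of entries equal to `v`. -/
def wtTab (T : Tableau) : ℕ → ℕ := fun v =>
  if v = 0 then 0 else Set.ncard {p : ℤ × ℕ | T p.1 p.2 = v}

/-- The weight of a word: the multiplicity of each positive letter. -/
def wtWord (u : List ℕ) : ℕ → ℕ := fun v => if v = 0 then 0 else u.count v

/-- The statistic `m_i(col(T), j)` where position `j` of the reverse column reading word
(entries read down columns, from right to left) is the box in row `r`, column `c`: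
the number of entries `i+1` weakly after this box minus the number of entries `i`. -/
def mi (T : Tableau) (i : ℕ) (r : ℤ) (c : ℕ) : ℤ :=
  (Set.ncard {p : ℤ × ℕ | T p.1 p.2 = i + 1 ∧ (p.2 < c ∨ (p.2 = c ∧ p.1 ≤ r))} : ℤ) -
  (Set.ncard {p : ℤ × ℕ | T p.1 p.2 = i ∧ (p.2 < c ∨ (p.2 = c ∧ p.1 ≤ r))} : ℤ)

/-- The box `(r, c)` maximizes `m_i` among all boxes of `T`. -/
def isMaxBox (T : Tableau) (i : ℕ) (r : ℤ) (c : ℕ) : Prop :=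
  T r c ≠ 0 ∧ ∀ (r' : ℤ) (c' : ℕ), T r' c' ≠ 0 → mi T i r' c' ≤ mi T i r c

/-- The Assaf–Schilling raising operator `e_i` on key tableaux.  If `m_i(col(T)) ≤ 0` the
result is `none` (i.e. `0`); otherwise, with `q` the largest position of the reverse column
reading word achieving the maximum (i.e. the maximizing box with the smallest column index,
and the smallest row index in that column), all entries `i+1` in the row of `q` weakly to its
right are changed to `i`, and all entries `i` in the same columns as these entries are
changed to `i+1`. -/
def keyE (i : ℕ) (T : Tableau) : Option Tableau :=
  if h : ∃ (r : ℤ) (c : ℕ), isMaxBox T i r c ∧ 1 ≤ mi T i r c then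
    let cq := sInf {c : ℕ | ∃ r : ℤ, isMaxBox T i r c}
    let rq : ℤ := ((sInf {m : ℕ | isMaxBox T i ((m : ℕ) : ℤ) cq} : ℕ) : ℤ)
    some (fun r c =>
      if cq ≤ c ∧ T rq c = i + 1 then
        (if T r c = i + 1 then i else if T r c = i then i + 1 else T r c)
      else T r c)
  else none

/-- The Assaf–Schilling lowering operator `f_i`: the (unique) inverse of `e_i`. -/
def keyF (i : ℕ) (T : Tableau) : Option Tableau :=
  if h : ∃ T', keyE i T' = some T then some h.choose else none

/-- Restriction of a partially defined crystal operator to a subset: the operator returns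
`none` (i.e. `0`) whenever it would leave the subset. -/
def restrictOp {β : Type} (S : Set β) (op : β → Option β) (x : β) : Option β :=
  (op x).bind fun y => if y ∈ S then some y else none

/-! ### Polynomials: divided differences and key polynomials -/

/-- The divided difference operator `∂_i f = (f - s_i · f) / (x_i - x_{i+1})`. -/
def divDiff (i : ℕ) (fp : MvPolynomial ℕ ℤ) : MvPolynomial ℕ ℤ :=
  if h : ∃ g : MvPolynomial ℕ ℤ,
      g * (MvPolynomial.X i - MvPolynomial.X (i + 1)) =
        fp - MvPolynomial.rename (fun j => sPerm i j) fp
  then h.choose else 0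

/-- The isobaric divided difference operator `π_i f = ∂_i (x_i f)`. -/
def piOp (i : ℕ) (fp : MvPolynomial ℕ ℤ) : MvPolynomial ℕ ℤ :=
  divDiff i (MvPolynomial.X i * fp)

/-- `π_{i_1} π_{i_2} ⋯ π_{i_k} f` for a word `i_1 i_2 ⋯ i_k` (the head is applied last). -/
def piWord : List ℕ → MvPolynomial ℕ ℤ → MvPolynomial ℕ ℤ
  | [], fp => fp
  | i :: rest, fp => piOp i (piWord rest fp)

/-- `π_{b↓a} = π_{b-1} π_{b-2} ⋯ π_a` (the identity when `b ≤ a`). -/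
def piDown (b a : ℕ) (fp : MvPolynomial ℕ ℤ) : MvPolynomial ℕ ℤ :=
  piWord ((List.range' a (b - a)).reverse) fp

/-- The conjugate of a weak composition: `conjC α t = #{j ≥ 1 | α_j ≥ t}` for `t ≥ 1`. -/
def conjC (α : ℕ → ℕ) (t : ℕ) : ℕ :=
  Set.ncard {j : ℕ | 1 ≤ j ∧ 1 ≤ t ∧ t ≤ α j}

/-- The partition rearrangement of a weak composition (the conjugate of its conjugate). -/
def sortC (α : ℕ → ℕ) : ℕ → ℕ := conjC (conjC α)

/-- The length of a permutation: the common length of its reduced words. -/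
def permLength (w : Equiv.Perm ℕ) : ℕ :=
  sInf {n : ℕ | ∃ ρ : List ℕ, PosWord ρ ∧ wordPerm ρ = w ∧ ρ.length = n}

/-- The monomial `x^β = x_1^{β_1} x_2^{β_2} ⋯`. -/
def xExp (β : ℕ → ℕ) : MvPolynomial ℕ ℤ :=
  ∏ i ∈ Finset.range (sSup {n : ℕ | β n ≠ 0} + 1), MvPolynomial.X i ^ β i

/-- The key polynomial `κ_α = π_w x^λ` where `λ` is the partition rearrangement of `α` and
`w` is the minimal-length permutation of `S∞` with `α · w = λ`. -/
def keyPoly (α : ℕ → ℕ) : MvPolynomial ℕ ℤ :=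
  if h : ∃ (ρ : List ℕ) (w : Equiv.Perm ℕ), IsReducedWordFor w ρ ∧
      (∀ i, α (w i) = sortC α i) ∧
      (∀ v : Equiv.Perm ℕ, (∃ τ, IsReducedWordFor v τ) → (∀ i, α (v i) = sortC α i) →
        permLength w ≤ permLength v)
  then piWord h.choose (xExp (sortC α)) else 0

/-- The `φ`-flagged key polynomial `κ_{(α,φ)} = Σ_{T ∈ SSKT(α,φ)} x^{wt(T)}`. -/
def flaggedKeyPoly (α φ : ℕ → ℕ) : MvPolynomial ℕ ℤ :=
  ∑ᶠ T ∈ SSKT α φ, xExp (wtTab T)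

/-! ### Column insertion, keys, standardization -/

/-- The number of boxes in column `c` of a tableau. -/
def colHeightN (T : Tableau) (c : ℕ) : ℕ := Set.ncard {r : ℤ | T r c ≠ 0}

/-- One pass of column insertion: insert the value `x` starting at column `c`
(`fuel` bounds the number of columns visited). -/
def colInsertAux : ℕ → Tableau → ℕ → ℕ → Tableau
  | 0, T, _, _ => T
  | fuel + 1, T, c, x =>
    if ∀ r : ℤ, T r c ≠ 0 → T r c < x then
      -- x is greater than every entry of column c: place it at the end of the column
      fun r c' => if c' = c ∧ r = (colHeightN T c + 1 : ℤ) then x else T r c'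
    else if ∃ r : ℤ, T r c = x then
      -- column c contains x: move on to the next column with the same value
      colInsertAux fuel T (c + 1) x
    else
      -- bump the smallest entry of column c that is larger than x
      let y := sInf {v : ℕ | x < v ∧ ∃ r : ℤ, T r c = v}
      colInsertAux fuel (fun r c' => if c' = c ∧ T r c' = y then x else T r c') (c + 1) y

/-- Column insertion of `x` into the semistandard Young tableau `T`. -/
def colInsert (T : Tableau) (x : ℕ) : Tableau :=
  colInsertAux (sSup {c : ℕ | ∃ r : ℤ, T r c ≠ 0} + 2) T 1 x

/-- The insertion tableau `P` of `(v → ∅)`: successively column insert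
`v_n, v_{n-1}, …, v_1` into the empty tableau. -/
def insertP (v : List ℕ) : Tableau :=
  v.reverse.foldl colInsert (fun _ _ => 0)

/-- The recording tableau `Q` of `(v → ∅)`: the standard Young tableau whose restriction to
`{1, …, j}` has the same shape as the insertion tableau of the last `j` letters of `v`. -/
def insertQ (v : List ℕ) : Tableau := fun r c =>
  sInf {j : ℕ | insertP (v.drop (v.length - j)) r c ≠ 0}

/-- The key `key(α)`: the unique semistandard Young tableau of weight `α` such that the set
of entries of column `i+1` is a subset of the entries of column `i`; its column `c` consists
of the elements of `{x ≥ 1 | α_x ≥ c}` in increasing order from bottom to top. -/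
def keyTab (α : ℕ → ℕ) : Tableau := fun r c =>
  if c = 0 then 0
  else sInf {x : ℕ | 1 ≤ x ∧ c ≤ α x ∧
    ((Set.ncard {y : ℕ | 1 ≤ y ∧ c ≤ α y ∧ y ≤ x} : ℕ) : ℤ) = r}

/-- The standardization of a semistandard Young tableau: the `1`'s are replaced from left to
right by `1, …, β_1`, the `2`'s by `β_1 + 1, …, β_1 + β_2`, and so on. -/
def stdTab (T : Tableau) : Tableau := fun r c =>
  if T r c = 0 then 0
  else Set.ncard {p : ℤ × ℕ |
    T p.1 p.2 ≠ 0 ∧ (T p.1 p.2 < T r c ∨ (T p.1 p.2 = T r c ∧ p.2 ≤ c))}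

/-! ### Maximal factorizations (Reiner–Shimozono) -/

/-- Every block is weakly increasing. -/
def WeaklyIncrFact (g : ℕ → List ℕ) : Prop := ∀ i, List.Chain' (· ≤ ·) (g i)

/-- Maximality: the nonempty blocks have maximal length, i.e. there is a strict descent
between any two consecutive nonempty blocks (no letter can be moved from the end of a block
to the front of the next one to the right). -/
def MaxFact (g : ℕ → List ℕ) : Prop :=
  ∀ i j : ℕ, 1 ≤ i → i < j → g i ≠ [] → g j ≠ [] → (∀ m, i < m → m < j → g m = []) →
    (g i).headI < (g j).getLastD 0

/-- Reiner–Shimozono's set `𝒲(α, φ)` of `φ`-flagged maximal factorizations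
`u^• = u^n ⋯ u^2 u^1` with `ℓ(u^i) = α_i` and `(u → ∅) = (P, std(key(α)))`. -/
def Wset (α φ : ℕ → ℕ) : Set (ℕ → List ℕ) :=
  {g | g 0 = [] ∧ (∀ i, (g i).length = α i) ∧ (∀ i, ∀ x ∈ g i, 1 ≤ x) ∧
       WeaklyIncrFact g ∧ MaxFact g ∧ (∀ i, ∀ x ∈ g i, x ≤ φ i) ∧
       insertQ (factWord g) = stdTab (keyTab α)}

/-! ### Shifts and highest weight key tableaux -/

/-- `shift_N`: add `N` to every letter of every block. -/
def shiftFact (N : ℕ) (f : ℕ → List ℕ) : ℕ → List ℕ := fun i => (f i).map (· + N)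

/-- The tableau of shape `α` whose column `i` is filled by `1, 2, …, λ^T_i` in increasing
order from bottom to top (where `λ^T` is the conjugate of the partition rearrangement `λ`
of `α`): the box of column `c` in row `m` (where `α_m ≥ c`) contains the number of indices
`m' ≤ m` with `α_{m'} ≥ c`. -/
def highKeyTab (α : ℕ → ℕ) : Tableau := fun r c =>
  if c = 0 then 0
  else if ∃ m : ℕ, (m : ℤ) = r ∧ 1 ≤ m ∧ c ≤ α m then
    Set.ncard {m : ℕ | 1 ≤ m ∧ c ≤ α m ∧ (m : ℤ) ≤ r}
  else 0


/-- A `gl_n`-crystal isomorphism between two sets of key tableaux, both equipped with the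
Assaf–Schilling operators (restricted to the sets): a weight-preserving bijection commuting
with all raising and lowering operators `e_i, f_i` for `1 ≤ i < n`. -/
def SSKTIso (n : ℕ) (S₁ S₂ : Set Tableau) : Prop :=
  ∃ g : Tableau → Tableau, Set.BijOn g S₁ S₂ ∧
    (∀ T ∈ S₁, wtTab T = wtTab (g T)) ∧
    ∀ T ∈ S₁, ∀ i : ℕ, 1 ≤ i → i < n →
      Option.map g (restrictOp S₁ (keyE i) T) = restrictOp S₂ (keyE i) (g T) ∧
      Option.map g (restrictOp S₁ (keyF i) T) = restrictOp S₂ (keyF i) (g T)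

section
open MvPolynomial

/-! ### Isobaric divided differences -/

/-- The action of `s_j` on polynomials. -/
def swapV (j : ℕ) : MvPolynomial ℕ ℤ →ₐ[ℤ] MvPolynomial ℕ ℤ := rename (fun k => sPerm j k)

theorem sPerm_left (j : ℕ) : sPerm j j = j + 1 := by simp [sPerm]
theorem sPerm_right (j : ℕ) : sPerm j (j + 1) = j := by simp [sPerm]
theorem sPerm_of_ne {j k : ℕ} (h1 : k ≠ j) (h2 : k ≠ j + 1) : sPerm j k = k :=
  Equiv.swap_apply_of_ne_of_ne h1 h2
theorem sPerm_sPerm (j k : ℕ) : sPerm j (sPerm j k) = k := Equiv.swap_apply_self _ _ _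

theorem swapV_X (j k : ℕ) : swapV j (X k) = X (sPerm j k) := by simp [swapV]
theorem swapV_X_left (j : ℕ) : swapV j (X j) = X (j + 1) := by rw [swapV_X, sPerm_left]
theorem swapV_X_right (j : ℕ) : swapV j (X (j + 1)) = X j := by rw [swapV_X, sPerm_right]

theorem swapV_swapV (j : ℕ) (f : MvPolynomial ℕ ℤ) : swapV j (swapV j f) = f := by
  unfold swapV
  rw [rename_rename]
  have h : ((fun k => sPerm j k) ∘ fun k => sPerm j k) = id := funext (sPerm_sPerm j)
  rw [h, rename_id_apply]

theorem sPerm_braid (i k : ℕ) :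
    sPerm i (sPerm (i + 1) (sPerm i k)) = sPerm (i + 1) (sPerm i (sPerm (i + 1) k)) := by
  simp only [sPerm, Equiv.swap_apply_def]
  grind

theorem sPerm_comm {i j : ℕ} (h : i + 2 ≤ j) (k : ℕ) :
    sPerm i (sPerm j k) = sPerm j (sPerm i k) := by
  simp only [sPerm, Equiv.swap_apply_def]
  grind

theorem swapV_braid (i : ℕ) (f : MvPolynomial ℕ ℤ) :
    swapV i (swapV (i + 1) (swapV i f)) = swapV (i + 1) (swapV i (swapV (i + 1) f)) := by
  unfold swapV
  simp only [rename_rename]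
  congr 2
  funext k
  exact sPerm_braid i k

theorem swapV_comm {i j : ℕ} (h : i + 2 ≤ j) (f : MvPolynomial ℕ ℤ) :
    swapV i (swapV j f) = swapV j (swapV i f) := by
  unfold swapV
  simp only [rename_rename]
  congr 2
  funext k
  exact sPerm_comm h k

theorem X_sub_X_ne_zero {i j : ℕ} (h : i ≠ j) : (X i - X j : MvPolynomial ℕ ℤ) ≠ 0 := by
  intro h0
  exact h (X_injective (sub_eq_zero.mp h0))

theorem exists_divDiff (j : ℕ) (f : MvPolynomial ℕ ℤ) :
    ∃ g : MvPolynomial ℕ ℤ, g * (X j - X (j + 1)) = f - swapV j f := by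
  induction f using MvPolynomial.induction_on with
  | C a => exact ⟨0, by simp [swapV]⟩
  | add p q hp hq =>
    obtain ⟨a, ha⟩ := hp
    obtain ⟨b, hb⟩ := hq
    exact ⟨a + b, by rw [map_add]; linear_combination ha + hb⟩
  | mul_X p k hp =>
    obtain ⟨a, ha⟩ := hp
    rw [map_mul, swapV_X]
    by_cases h1 : k = j
    · subst h1
      rw [sPerm_left]
      exact ⟨a * X k + swapV k p, by linear_combination X k * ha⟩
    by_cases h2 : k = j + 1
    · subst h2
      rw [sPerm_right]
      exact ⟨a * X (j + 1) - swapV j p, by linear_combination X (j + 1) * ha⟩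
    · rw [sPerm_of_ne h1 h2]
      exact ⟨a * X k, by linear_combination X k * ha⟩

theorem piOp_spec (j : ℕ) (g : MvPolynomial ℕ ℤ) :
    piOp j g * (X j - X (j + 1)) = X j * g - X (j + 1) * swapV j g := by
  have h := exists_divDiff j (X j * g)
  have h' : piOp j g = h.choose := dif_pos h
  rw [h', h.choose_spec, map_mul, swapV_X_left]

theorem eq_piOp {j : ℕ} {f g : MvPolynomial ℕ ℤ}
    (h : f * (X j - X (j + 1)) = X j * g - X (j + 1) * swapV j g) : f = piOp j g := by
  apply mul_right_cancel₀ (X_sub_X_ne_zero (Nat.ne_of_lt (Nat.lt_succ_self j)))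
  rw [h, piOp_spec]

theorem swapV_piOp (j : ℕ) (g : MvPolynomial ℕ ℤ) : swapV j (piOp j g) = piOp j g := by
  apply eq_piOp
  have h := congrArg (swapV j) (piOp_spec j g)
  simp only [map_mul, map_sub, swapV_X_left, swapV_X_right, swapV_swapV] at h
  linear_combination -h

theorem piOp_of_symm {j : ℕ} {g : MvPolynomial ℕ ℤ} (h : swapV j g = g) : piOp j g = g := by
  symm
  apply eq_piOp
  rw [h]; ring

theorem piOp_piOp (j : ℕ) (g : MvPolynomial ℕ ℤ) : piOp j (piOp j g) = piOp j g :=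
  piOp_of_symm (swapV_piOp j g)

theorem piOp_add (j : ℕ) (f g : MvPolynomial ℕ ℤ) : piOp j (f + g) = piOp j f + piOp j g := by
  symm
  apply eq_piOp
  rw [map_add]
  linear_combination piOp_spec j f + piOp_spec j g

theorem piOp_mul_symm {j : ℕ} {e : MvPolynomial ℕ ℤ} (h : swapV j e = e)
    (g : MvPolynomial ℕ ℤ) : piOp j (e * g) = e * piOp j g := by
  symm
  apply eq_piOp
  rw [map_mul, h]
  linear_combination e * piOp_spec j g

theorem piOp_zero (j : ℕ) : piOp j 0 = 0 := piOp_of_symm (map_zero _)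

/-- If `f` is `s_j`-symmetric and so is `x_j (f - g)`, then `f = π_j g`. -/
theorem eq_piOp_of_symm {j : ℕ} {f g : MvPolynomial ℕ ℤ} (hf : swapV j f = f)
    (hd : swapV j (X j * (f - g)) = X j * (f - g)) : f = piOp j g := by
  apply eq_piOp
  rw [map_mul, map_sub, swapV_X_left, hf] at hd
  linear_combination -hd

theorem piOp_comm {i j : ℕ} (h : i + 2 ≤ j) (g : MvPolynomial ℕ ℤ) :
    piOp i (piOp j g) = piOp j (piOp i g) := by
  have e1 := piOp_spec i (piOp j g)
  have e2 := piOp_spec j (piOp i g)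
  have a1 := piOp_spec i g
  have a2 := piOp_spec j g
  have b1 := congrArg (swapV j) a1
  have b2 := congrArg (swapV i) a2
  simp only [map_mul, map_sub, swapV_X] at b1 b2
  rw [sPerm_of_ne (k := i) (by omega) (by omega), sPerm_of_ne (k := i + 1) (by omega) (by omega)]
    at b1
  rw [sPerm_of_ne (k := j) (by omega) (by omega), sPerm_of_ne (k := j + 1) (by omega) (by omega),
    swapV_comm h] at b2
  apply mul_right_cancel₀ (X_sub_X_ne_zero (show i ≠ i + 1 by omega))
  apply mul_right_cancel₀ (X_sub_X_ne_zero (show j ≠ j + 1 by omega))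
  linear_combination (X j - X (j + 1)) * e1 + X i * a2 - X (i + 1) * b2
    - (X i - X (i + 1)) * e2 - X j * a1 + X (j + 1) * b1

theorem piOp_braid (i : ℕ) (g : MvPolynomial ℕ ℤ) :
    piOp i (piOp (i + 1) (piOp i g)) = piOp (i + 1) (piOp i (piOp (i + 1) g)) := by
  have hab : (X i - X (i + 1) : MvPolynomial ℕ ℤ) ≠ 0 := X_sub_X_ne_zero (by omega)
  have hac : (X i - X (i + 2) : MvPolynomial ℕ ℤ) ≠ 0 := X_sub_X_ne_zero (by omega)
  have hbc : (X (i + 1) - X (i + 2) : MvPolynomial ℕ ℤ) ≠ 0 := X_sub_X_ne_zero (by omega)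
  have n1 : sPerm i (i + 2) = i + 2 := sPerm_of_ne (by omega) (by omega)
  have n2 : sPerm (i + 1) i = i := sPerm_of_ne (by omega) (by omega)
  have n3 : sPerm (i + 1) (i + 2) = i + 1 := sPerm_right (i + 1)
  have L : piOp i (piOp (i + 1) (piOp i g)) *
      ((X i - X (i + 1)) * (X i - X (i + 2)) * (X (i + 1) - X (i + 2))) =
      X i ^ 2 * X (i + 1) * g - X i * X (i + 1) ^ 2 * swapV i g
      - X i ^ 2 * X (i + 2) * swapV (i + 1) g
      + X i * X (i + 2) ^ 2 * swapV (i + 1) (swapV i g)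
      + X (i + 1) ^ 2 * X (i + 2) * swapV i (swapV (i + 1) g)
      - X (i + 1) * X (i + 2) ^ 2 * swapV i (swapV (i + 1) (swapV i g)) := by
    have e1 := piOp_spec i g
    have e2 := piOp_spec (i + 1) (piOp i g)
    have e3 := piOp_spec i (piOp (i + 1) (piOp i g))
    have e4 := congrArg (swapV i) e2
    have e6 := congrArg (swapV (i + 1)) e1
    have e7 := congrArg (swapV i) e6
    simp only [map_mul, map_sub, swapV_X, sPerm_left, sPerm_right, n1, n2, swapV_piOp,
      swapV_swapV] at e4 e6 e7
    simp only [show i + 1 + 1 = i + 2 from rfl, n1] at e2 e4 e6 e7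
    linear_combination (X i - X (i + 2)) * (X (i + 1) - X (i + 2)) * e3
      + X i * (X i - X (i + 2)) * e2 - X (i + 1) * (X (i + 1) - X (i + 2)) * e4
      + X i * X (i + 1) * e1 - X i * X (i + 2) * e6 + X (i + 1) * X (i + 2) * e7
  have R : piOp (i + 1) (piOp i (piOp (i + 1) g)) *
      ((X i - X (i + 1)) * (X i - X (i + 2)) * (X (i + 1) - X (i + 2))) =
      X i ^ 2 * X (i + 1) * g - X i * X (i + 1) ^ 2 * swapV i g
      - X i ^ 2 * X (i + 2) * swapV (i + 1) g
      + X i * X (i + 2) ^ 2 * swapV (i + 1) (swapV i g)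
      + X (i + 1) ^ 2 * X (i + 2) * swapV i (swapV (i + 1) g)
      - X (i + 1) * X (i + 2) ^ 2 * swapV i (swapV (i + 1) (swapV i g)) := by
    have e1 := piOp_spec (i + 1) g
    have e2 := piOp_spec i (piOp (i + 1) g)
    have e3 := piOp_spec (i + 1) (piOp i (piOp (i + 1) g))
    have e4 := congrArg (swapV (i + 1)) e2
    have e6 := congrArg (swapV i) e1
    have e7 := congrArg (swapV (i + 1)) e6
    rw [swapV_braid]
    simp only [map_mul, map_sub, swapV_X, sPerm_left, sPerm_right, n1, n2, swapV_piOp,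
      swapV_swapV] at e4 e6 e7
    simp only [show i + 1 + 1 = i + 2 from rfl, n1, n3, sPerm_left, n2, swapV_X] at e1 e2 e3 e4 e6 e7
    linear_combination (X i - X (i + 1)) * (X i - X (i + 2)) * e3
      + X (i + 1) * (X i - X (i + 2)) * e2 - X (i + 2) * (X i - X (i + 1)) * e4
      + X i ^ 2 * e1 - X (i + 1) ^ 2 * e6 + X (i + 2) ^ 2 * e7
  apply mul_right_cancel₀ (mul_ne_zero (mul_ne_zero hab hac) hbc)
  rw [L, R]

/-! ### Monomials -/

theorem xExp_eq {β : ℕ → ℕ} {N : ℕ} (h : ∀ i, N ≤ i → β i = 0) :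
    xExp β = ∏ i ∈ Finset.range N, X i ^ β i := by
  have hb : BddAbove {n : ℕ | β n ≠ 0} :=
    ⟨N, fun n hn => by by_contra hc; exact hn (h n (by omega))⟩
  have key : ∀ M K, M ≤ K → (∀ i, M ≤ i → β i = 0) →
      (∏ i ∈ Finset.range M, (X i : MvPolynomial ℕ ℤ) ^ β i) =
      ∏ i ∈ Finset.range K, X i ^ β i := by
    intro M K hMK hM
    apply Finset.prod_subset
    · intro i hi; simp only [Finset.mem_range] at *; omega
    · intro i _ hi
      rw [hM i (by simpa using hi), pow_zero]
  have h1 : ∀ i, sSup {n : ℕ | β n ≠ 0} + 1 ≤ i → β i = 0 := by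
    intro i hi
    by_contra hc
    have := le_csSup hb (show i ∈ {n : ℕ | β n ≠ 0} from hc)
    omega
  unfold xExp
  rw [key _ _ (le_max_left _ N) h1, key N _ (le_max_right _ N) h]

theorem WeakComp.exists_bound {β : ℕ → ℕ} (h : WeakComp β) : ∃ N, ∀ i, N ≤ i → β i = 0 := by
  obtain ⟨N, hN⟩ := h.2.bddAbove
  refine ⟨N + 1, fun i hi => ?_⟩
  by_contra hc
  have := hN (show i ∈ {n : ℕ | β n ≠ 0} from hc)
  omega

theorem weakComp_of_bound {β : ℕ → ℕ} {N : ℕ} (h0 : β 0 = 0) (h : ∀ i, N ≤ i → β i = 0) :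
    WeakComp β :=
  ⟨h0, (Set.finite_lt_nat N).subset fun i hi => by
    by_contra hc; exact hi (h i (by simpa using hc))⟩

theorem xExp_add {β γ : ℕ → ℕ} {N : ℕ} (h : ∀ i, N ≤ i → β i = 0) (h' : ∀ i, N ≤ i → γ i = 0) :
    xExp (fun i => β i + γ i) = xExp β * xExp γ := by
  rw [xExp_eq h, xExp_eq h', xExp_eq (N := N) (fun i hi => by rw [h i hi, h' i hi]),
    ← Finset.prod_mul_distrib]
  exact Finset.prod_congr rfl fun i _ => pow_add _ _ _

theorem xExp_zero : xExp (fun _ => 0) = 1 := by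
  rw [xExp_eq (N := 0) (fun _ _ => rfl)]; simp

theorem xExp_eq_monomial {β : ℕ → ℕ} {N : ℕ} (h : ∀ i, N ≤ i → β i = 0) :
    xExp β = monomial (∑ i ∈ Finset.range N, Finsupp.single i (β i)) 1 := by
  rw [xExp_eq h, monomial_sum_one]
  exact Finset.prod_congr rfl fun i _ => X_pow_eq_monomial

theorem swapC_apply (β : ℕ → ℕ) (i j : ℕ) : swapC β i j = β (sPerm i j) := rfl

theorem swapC_swapC (β : ℕ → ℕ) (i : ℕ) : swapC (swapC β i) i = β := by
  funext j; simp only [swapC_apply, sPerm_sPerm]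

theorem swapC_of_eq {β : ℕ → ℕ} {i : ℕ} (h : β i = β (i + 1)) : swapC β i = β := by
  funext j
  rw [swapC_apply]
  by_cases h1 : j = i
  · rw [h1, sPerm_left, h]
  by_cases h2 : j = i + 1
  · rw [h2, sPerm_right, h]
  · rw [sPerm_of_ne h1 h2]

theorem swapC_left (β : ℕ → ℕ) (i : ℕ) : swapC β i i = β (i + 1) := by
  rw [swapC_apply, sPerm_left]
theorem swapC_right (β : ℕ → ℕ) (i : ℕ) : swapC β i (i + 1) = β i := by
  rw [swapC_apply, sPerm_right]
theorem swapC_of_ne (β : ℕ → ℕ) {i j : ℕ} (h1 : j ≠ i) (h2 : j ≠ i + 1) : swapC β i j = β j := by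
  rw [swapC_apply, sPerm_of_ne h1 h2]

theorem WeakComp.swapC {β : ℕ → ℕ} (h : WeakComp β) {i : ℕ} (hi : 1 ≤ i) :
    WeakComp (swapC β i) := by
  obtain ⟨N, hN⟩ := h.exists_bound
  refine weakComp_of_bound (N := max N (i + 2)) ?_ ?_
  · rw [swapC_of_ne _ (by omega) (by omega), h.1]
  · intro j hj
    rw [swapC_of_ne _ (by omega) (by omega), hN j (by omega)]

theorem swapV_xExp {β : ℕ → ℕ} (h : WeakComp β) (i : ℕ) :
    swapV i (xExp β) = xExp (swapC β i) := by
  obtain ⟨N, hN⟩ := h.exists_bound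
  have h1 : ∀ j, max N (i + 2) ≤ j → β j = 0 := fun j hj => hN j (by omega)
  have h2 : ∀ j, max N (i + 2) ≤ j → swapC β i j = 0 := fun j hj => by
    rw [swapC_of_ne _ (by omega) (by omega), hN j (by omega)]
  rw [xExp_eq h1, xExp_eq h2, map_prod]
  refine Finset.prod_equiv (sPerm i) ?_ ?_
  · intro j
    simp only [Finset.mem_range]
    by_cases e1 : j = i
    · rw [e1, sPerm_left]; omega
    by_cases e2 : j = i + 1
    · rw [e2, sPerm_right]; omega
    · rw [sPerm_of_ne e1 e2]
  · intro j _
    rw [map_pow, swapV_X, swapC_apply, sPerm_sPerm]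

/-! ### Inversions of weak compositions -/

/-- The set of pairs of positions that are out of weakly decreasing order. -/
def invSet (β : ℕ → ℕ) : Set (ℕ × ℕ) := {p | 1 ≤ p.1 ∧ p.1 < p.2 ∧ β p.1 < β p.2}

def invC (β : ℕ → ℕ) : ℕ := (invSet β).ncard

theorem invSet_finite {β : ℕ → ℕ} (h : WeakComp β) : (invSet β).Finite := by
  obtain ⟨N, hN⟩ := h.exists_bound
  refine ((Set.finite_lt_nat N).prod (Set.finite_lt_nat N)).subset ?_
  rintro ⟨a, b⟩ ⟨_, h2, h3⟩
  have : b < N := by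
    by_contra hc
    rw [hN b (by omega)] at h3; omega
  exact ⟨by simp only at h2; simp; omega, this⟩

theorem invC_diff_le {β : ℕ → ℕ} (h : WeakComp β) {i : ℕ} (hi : 1 ≤ i) :
    (invSet β \ {(i, i + 1)}).ncard ≤ (invSet (swapC β i) \ {(i, i + 1)}).ncard := by
  refine Set.ncard_le_ncard_of_injOn (fun p => (sPerm i p.1, sPerm i p.2)) ?_ ?_
    ((invSet_finite (h.swapC hi)).subset Set.diff_subset)
  · rintro ⟨a, b⟩ ⟨⟨h1, h2, h3⟩, h4⟩
    simp only [Set.mem_singleton_iff, Prod.mk.injEq] at h4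
    simp only at h1 h2 h3
    refine ⟨⟨?_, ?_, ?_⟩, ?_⟩
    · simp only [sPerm, Equiv.swap_apply_def]; grind
    · simp only [sPerm, Equiv.swap_apply_def]; grind
    · simp only [swapC_apply, sPerm_sPerm]; exact h3
    · simp only [Set.mem_singleton_iff, Prod.mk.injEq, sPerm, Equiv.swap_apply_def]; grind
  · rintro ⟨a, b⟩ _ ⟨c, d⟩ _ hh
    simpa using hh

theorem invC_diff_eq {β : ℕ → ℕ} (h : WeakComp β) {i : ℕ} (hi : 1 ≤ i) :
    (invSet β \ {(i, i + 1)}).ncard = (invSet (swapC β i) \ {(i, i + 1)}).ncard := by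
  refine le_antisymm (invC_diff_le h hi) ?_
  have := invC_diff_le (h.swapC hi) hi
  rwa [swapC_swapC] at this

theorem invC_swapC {β : ℕ → ℕ} (h : WeakComp β) {i : ℕ} (hi : 1 ≤ i) (hlt : β i < β (i + 1)) :
    invC (swapC β i) + 1 = invC β := by
  have h1 : (i, i + 1) ∈ invSet β := ⟨hi, Nat.lt_succ_self i, hlt⟩
  have h2 : (i, i + 1) ∉ invSet (swapC β i) := by
    rintro ⟨_, _, h3⟩
    simp only [swapC_left, swapC_right] at h3
    omega
  have e := invC_diff_eq h hi
  rw [Set.diff_singleton_eq_self h2] at e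
  unfold invC
  rw [← e, Set.ncard_diff_singleton_add_one h1 (invSet_finite h)]

theorem invC_le_succ {β : ℕ → ℕ} (h : WeakComp β) {i : ℕ} (hi : 1 ≤ i) :
    invC β ≤ invC (swapC β i) + 1 := by
  rcases lt_trichotomy (β i) (β (i + 1)) with hl | he | hg
  · rw [invC_swapC h hi hl]
  · rw [swapC_of_eq he]; omega
  · have := invC_swapC (h.swapC hi) hi (by rw [swapC_left, swapC_right]; exact hg)
    rw [swapC_swapC] at this
    omega

/-- A weak composition that is weakly decreasing on the positive integers. -/
def AntiC (β : ℕ → ℕ) : Prop := ∀ i, 1 ≤ i → β (i + 1) ≤ β i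

theorem not_antiC {β : ℕ → ℕ} (h : ¬ AntiC β) : ∃ i, 1 ≤ i ∧ β i < β (i + 1) := by
  unfold AntiC at h
  push Not at h
  exact h

theorem AntiC.le {β : ℕ → ℕ} (h : AntiC β) {i j : ℕ} (hi : 1 ≤ i) (hij : i ≤ j) : β j ≤ β i := by
  induction j, hij using Nat.le_induction with
  | base => exact le_rfl
  | succ k hk ih => exact (h k (by omega)).trans ih

theorem invC_of_antiC {β : ℕ → ℕ} (h : AntiC β) : invC β = 0 := by
  have : invSet β = ∅ := by
    ext ⟨a, b⟩
    simp only [invSet, Set.mem_setOf_eq, Set.mem_empty_iff_false, iff_false]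
    rintro ⟨h1, h2, h3⟩
    have := h.le h1 h2.le
    omega
  rw [invC, this, Set.ncard_empty]

/-! ### Key polynomials -/

/-- `IsKey β f` says that `f` is the key polynomial indexed by `β`, by the usual recursion. -/
inductive IsKey : (ℕ → ℕ) → MvPolynomial ℕ ℤ → Prop
  | base (β : ℕ → ℕ) : WeakComp β → AntiC β → IsKey β (xExp β)
  | step (β : ℕ → ℕ) (i : ℕ) (g : MvPolynomial ℕ ℤ) : 1 ≤ i → β i < β (i + 1) →
      IsKey (swapC β i) g → IsKey β (piOp i g)

theorem IsKey.weakComp {β : ℕ → ℕ} {f : MvPolynomial ℕ ℤ} (h : IsKey β f) : WeakComp β := by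
  induction h with
  | base β h _ => exact h
  | step β i g hi _ _ ih =>
    have := ih.swapC hi
    rwa [swapC_swapC] at this

theorem exists_isKey {β : ℕ → ℕ} (h : WeakComp β) : ∃ f, IsKey β f := by
  by_cases ha : AntiC β
  · exact ⟨_, IsKey.base β h ha⟩
  · obtain ⟨i, hi, hlt⟩ := not_antiC ha
    obtain ⟨g, hg⟩ := exists_isKey (h.swapC hi)
    exact ⟨_, IsKey.step β i g hi hlt hg⟩
  termination_by invC β
  decreasing_by have := invC_swapC h hi hlt; omega

theorem swapC_comm (β : ℕ → ℕ) {i j : ℕ} (h : i + 2 ≤ j) :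
    swapC (swapC β i) j = swapC (swapC β j) i := by
  funext k; simp only [swapC_apply, sPerm_comm h]

theorem swapC_braid (β : ℕ → ℕ) (i : ℕ) :
    swapC (swapC (swapC β i) (i + 1)) i = swapC (swapC (swapC β (i + 1)) i) (i + 1) := by
  funext k; simp only [swapC_apply, sPerm_braid]

theorem IsKey.unique_aux (n : ℕ) : ∀ (β : ℕ → ℕ) (f g : MvPolynomial ℕ ℤ), invC β ≤ n →
    IsKey β f → IsKey β g → f = g := by
  induction n with
  | zero =>
    intro β f g hn hf hg
    have hβ := hf.weakComp
    cases hf with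
    | base _ _ _ =>
      cases hg with
      | base _ _ _ => rfl
      | step _ i g hi hlt hg => have := invC_swapC hβ hi hlt; omega
    | step _ i g hi hlt hg => have := invC_swapC hβ hi hlt; omega
  | succ n ih =>
    intro β f g hn hf hg
    have hβ := hf.weakComp
    cases hf with
    | base _ _ ha =>
      cases hg with
      | base _ _ _ => rfl
      | step _ i g hi hlt hg => have := ha i hi; omega
    | step _ i f hi hlt hf =>
      cases hg with
      | base _ _ ha => have := ha i hi; omega
      | step _ j g hj hlt' hg =>
        have wi := invC_swapC hβ hi hlt
        have wj := invC_swapC hβ hj hlt'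
        have far : ∀ (i j : ℕ) (f g : MvPolynomial ℕ ℤ), 1 ≤ i → i + 2 ≤ j → β i < β (i + 1) →
            β j < β (j + 1) → IsKey (swapC β i) f → IsKey (swapC β j) g →
            piOp i f = piOp j g := by
          intro i j f g hi hij hlt hlt' hf hg
          have wi := invC_swapC hβ hi hlt
          have wj := invC_swapC hβ (i := j) (by omega) hlt'
          obtain ⟨h, hh⟩ := exists_isKey ((hβ.swapC hi).swapC (show 1 ≤ j by omega))
          have e1 : f = piOp j h := by
            refine ih _ _ _ (by omega) hf (IsKey.step _ _ _ (by omega) ?_ hh)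
            rw [swapC_of_ne _ (by omega) (by omega), swapC_of_ne _ (by omega) (by omega)]
            exact hlt'
          have e2 : g = piOp i h := by
            rw [swapC_comm β hij] at hh
            refine ih _ _ _ (by omega) hg (IsKey.step _ _ _ (by omega) ?_ hh)
            rw [swapC_of_ne _ (by omega) (by omega), swapC_of_ne _ (by omega) (by omega)]
            exact hlt
          rw [e1, e2, piOp_comm hij]
        have near : ∀ (i : ℕ) (f g : MvPolynomial ℕ ℤ), 1 ≤ i → β i < β (i + 1) →
            β (i + 1) < β (i + 1 + 1) → IsKey (swapC β i) f → IsKey (swapC β (i + 1)) g →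
            piOp i f = piOp (i + 1) g := by
          intro i f g hi hlt hlt' hf hg
          have wi := invC_swapC hβ hi hlt
          have wj := invC_swapC hβ (i := i + 1) (by omega) hlt'
          obtain ⟨h, hh⟩ := exists_isKey
            (((hβ.swapC hi).swapC (show 1 ≤ i + 1 by omega)).swapC hi)
          have n1 : ∀ γ : ℕ → ℕ, swapC γ i (i + 2) = γ (i + 2) :=
            fun γ => swapC_of_ne _ (by omega) (by omega)
          have n2 : ∀ γ : ℕ → ℕ, swapC γ (i + 1) i = γ i :=
            fun γ => swapC_of_ne _ (by omega) (by omega)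
          have n3 : ∀ γ : ℕ → ℕ, swapC γ (i + 1) (i + 2) = γ (i + 1) :=
            fun γ => swapC_right _ _
          have e1 : f = piOp (i + 1) (piOp i h) := by
            refine ih _ _ _ (by omega) hf (IsKey.step _ _ _ (by omega) ?_
              (IsKey.step _ _ _ (by omega) ?_ hh))
            · rw [swapC_right, n1]; exact hlt.trans hlt'
            · rw [n2, swapC_left, swapC_left, n1]; exact hlt'
          have e2 : g = piOp i (piOp (i + 1) h) := by
            rw [swapC_braid] at hh
            refine ih _ _ _ (by omega) hg (IsKey.step _ _ _ (by omega) ?_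
              (IsKey.step _ _ _ (by omega) ?_ hh))
            · rw [n2, swapC_left]; exact hlt.trans hlt'
            · rw [swapC_right, n1, n2, n3]; omega
          rw [e1, e2, piOp_braid]
        rcases lt_trichotomy i j with hij | hij | hij
        · by_cases h1 : j = i + 1
          · subst h1
            exact near i f g hi hlt hlt' hf hg
          · exact far i j f g hi (by omega) hlt hlt' hf hg
        · subst hij
          rw [ih _ _ _ (by omega) hf hg]
        · by_cases h1 : i = j + 1
          · subst h1
            exact (near j g f hj hlt' hlt hg hf).symm
          · exact (far j i g f hj (by omega) hlt' hlt hg hf).symm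

theorem IsKey.unique {β : ℕ → ℕ} {f g : MvPolynomial ℕ ℤ} (hf : IsKey β f) (hg : IsKey β g) :
    f = g := IsKey.unique_aux _ β f g le_rfl hf hg

theorem IsKey.piOp_of_gt {β : ℕ → ℕ} {f : MvPolynomial ℕ ℤ} {i : ℕ} (hf : IsKey β f)
    (hi : 1 ≤ i) (h : β (i + 1) < β i) : IsKey (swapC β i) (piOp i f) := by
  refine IsKey.step _ _ _ hi ?_ ?_
  · rwa [swapC_left, swapC_right]
  · rwa [swapC_swapC]

theorem IsKey.piOp_of_lt {β : ℕ → ℕ} {f : MvPolynomial ℕ ℤ} {i : ℕ} (hf : IsKey β f)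
    (hi : 1 ≤ i) (h : β i < β (i + 1)) : piOp i f = f := by
  obtain ⟨g, hg⟩ := exists_isKey (hf.weakComp.swapC hi)
  rw [hf.unique (IsKey.step β i g hi h hg), piOp_piOp]

theorem IsKey.piOp_of_eq_aux (n : ℕ) : ∀ (β : ℕ → ℕ) (f : MvPolynomial ℕ ℤ) (i : ℕ), invC β ≤ n →
    IsKey β f → 1 ≤ i → β i = β (i + 1) → piOp i f = f := by
  induction n with
  | zero =>
    intro β f i hn hf hi h
    have hβ := hf.weakComp
    cases hf with
    | base _ _ _ => exact piOp_of_symm (by rw [swapV_xExp hβ, swapC_of_eq h])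
    | step _ j g hj hlt hg => have := invC_swapC hβ hj hlt; omega
  | succ n ih =>
    intro β f i hn hf hi h
    have hβ := hf.weakComp
    cases hf with
    | base _ _ _ => exact piOp_of_symm (by rw [swapV_xExp hβ, swapC_of_eq h])
    | step _ j g hj hlt hg =>
      have wj := invC_swapC hβ hj hlt
      have hij : i ≠ j := by rintro rfl; omega
      by_cases h1 : i + 2 ≤ j
      · rw [piOp_comm h1, ih _ _ i (by omega) hg hi]
        rw [swapC_of_ne _ (by omega) (by omega), swapC_of_ne _ (by omega) (by omega), h]
      by_cases h2 : j + 2 ≤ i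
      · rw [← piOp_comm h2, ih _ _ i (by omega) hg hi]
        rw [swapC_of_ne _ (by omega) (by omega), swapC_of_ne _ (by omega) (by omega), h]
      by_cases h3 : j = i + 1
      · subst h3
        obtain ⟨k, hk⟩ := exists_isKey (hg.weakComp.swapC hi)
        have hl : swapC β (i + 1) i < swapC β (i + 1) (i + 1) := by
          rw [swapC_left, swapC_of_ne _ (by omega) (by omega)]; omega
        have wi := invC_swapC hg.weakComp hi hl
        have e := hg.unique (IsKey.step _ i k hi hl hk)
        have e2 := ih _ _ (i + 1) (by omega) hk (by omega) (by
          rw [swapC_right, swapC_of_ne _ (by omega) (by omega), swapC_of_ne _ (by omega) (by omega),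
            show i + 1 + 1 = i + 1 + 1 from rfl, swapC_right, h])
        rw [e, piOp_braid, e2]
      · have h4 : i = j + 1 := by omega
        subst h4
        obtain ⟨k, hk⟩ := exists_isKey (hg.weakComp.swapC (i := j + 1) (by omega))
        have hl : swapC β j (j + 1) < swapC β j (j + 1 + 1) := by
          rw [swapC_right, swapC_of_ne _ (by omega) (by omega)]; omega
        have wi := invC_swapC hg.weakComp (i := j + 1) (by omega) hl
        have e := hg.unique (IsKey.step _ (j + 1) k (by omega) hl hk)
        have e2 := ih _ _ j (by omega) hk (by omega) (by
          rw [swapC_left, swapC_of_ne _ (by omega) (by omega), swapC_left,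
            swapC_of_ne _ (by omega) (by omega), h])
        rw [e, ← piOp_braid, e2]

theorem IsKey.piOp_of_le {β : ℕ → ℕ} {f : MvPolynomial ℕ ℤ} {i : ℕ} (hf : IsKey β f)
    (hi : 1 ≤ i) (h : β i ≤ β (i + 1)) : piOp i f = f := by
  rcases h.lt_or_eq with h | h
  · exact hf.piOp_of_lt hi h
  · exact IsKey.piOp_of_eq_aux _ β f i le_rfl hf hi h

theorem IsKey.exists_piOp {β : ℕ → ℕ} {f : MvPolynomial ℕ ℤ} {i : ℕ} (hf : IsKey β f)
    (hi : 1 ≤ i) : ∃ γ, (γ = β ∨ γ = swapC β i) ∧ IsKey γ (piOp i f) := by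
  by_cases h : β i ≤ β (i + 1)
  · exact ⟨β, Or.inl rfl, by rwa [hf.piOp_of_le hi h]⟩
  · exact ⟨_, Or.inr rfl, hf.piOp_of_gt hi (by omega)⟩

/-- The composition `1_{[1,h]}`. -/
def oneC (h : ℕ) : ℕ → ℕ := fun i => if 1 ≤ i ∧ i ≤ h then 1 else 0

theorem oneC_weakComp (h : ℕ) : WeakComp (oneC h) :=
  weakComp_of_bound (N := h + 1) (by simp [oneC]) (fun i hi => by simp [oneC]; omega)

theorem swapC_oneC {h i : ℕ} (hi : 1 ≤ i) (hh : i + 1 ≤ h) : swapC (oneC h) i = oneC h :=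
  swapC_of_eq (by simp [oneC]; rw [if_pos, if_pos] <;> omega)

theorem IsKey.mul_oneC {δ : ℕ → ℕ} {f : MvPolynomial ℕ ℤ} {h : ℕ} (hf : IsKey δ f)
    (hs : ∀ i, h < i → δ i = 0) : IsKey (fun i => δ i + oneC h i) (xExp (oneC h) * f) := by
  induction hf with
  | base β hβ ha =>
    rw [mul_comm, ← xExp_add (N := h + 1) (fun i hi => hs i (by omega))
      (fun i hi => by simp [oneC]; omega)]
    refine IsKey.base _ (weakComp_of_bound (N := h + 1) ?_ ?_) ?_
    · simp [oneC, hβ.1]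
    · intro i hi
      rw [hs i (by omega)]; simp [oneC]; omega
    · intro i hi
      have := ha i hi
      simp only [oneC]
      split_ifs <;> omega
  | step β i g hi hlt hg ih =>
    have hih : i + 1 ≤ h := by
      by_contra hc
      rw [hs (i + 1) (by omega)] at hlt; omega
    rw [← piOp_mul_symm]
    · refine IsKey.step _ _ _ hi ?_ ?_
      · simp only [oneC]
        rw [if_pos (by omega), if_pos (by omega)]; omega
      · have e : swapC (fun k => β k + oneC h k) i = fun k => swapC β i k + oneC h k := by
          funext k
          have := congrFun (swapC_oneC hi hih) k
          simp only [swapC_apply] at this ⊢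
          rw [this]
        rw [e]
        apply ih
        intro k hk
        rw [swapC_of_ne _ (by omega) (by omega), hs k hk]
    · rw [swapV_xExp (oneC_weakComp h), swapC_oneC hi hih]

theorem wordPerm_cons (i : ℕ) (ρ : List ℕ) : wordPerm (i :: ρ) = sPerm i * wordPerm ρ := by
  simp [wordPerm]

theorem wordPerm_append (ρ σ : List ℕ) : wordPerm (ρ ++ σ) = wordPerm ρ * wordPerm σ := by
  simp [wordPerm]

/-- The word `ρ` acting on a weak composition on the right. -/
def actC (β : ℕ → ℕ) (ρ : List ℕ) : ℕ → ℕ := fun k => β (wordPerm ρ k)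

theorem actC_cons (β : ℕ → ℕ) (i : ℕ) (ρ : List ℕ) :
    actC β (i :: ρ) = actC (swapC β i) ρ := by
  funext k; simp [actC, wordPerm_cons, swapC_apply]

theorem actC_nil (β : ℕ → ℕ) : actC β [] = β := by
  funext k; simp [actC, wordPerm]

theorem PosWord.tail {i : ℕ} {ρ : List ℕ} (h : PosWord (i :: ρ)) : 1 ≤ i ∧ PosWord ρ :=
  ⟨h i (by simp), fun x hx => h x (by simp [hx])⟩

theorem invC_le_length : ∀ (ρ : List ℕ) (β : ℕ → ℕ), PosWord ρ → WeakComp β → AntiC (actC β ρ) →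
    invC β ≤ ρ.length
  | [], β, _, _, ha => by rw [actC_nil] at ha; simp [invC_of_antiC ha]
  | i :: ρ, β, hp, hβ, ha => by
    rw [actC_cons] at ha
    have := invC_le_length ρ _ hp.tail.2 (hβ.swapC hp.tail.1) ha
    have := invC_le_succ hβ hp.tail.1
    simp only [List.length_cons]; omega

theorem exists_sorting_word (β : ℕ → ℕ) (hβ : WeakComp β) :
    ∃ ρ, PosWord ρ ∧ AntiC (actC β ρ) ∧ ρ.length = invC β := by
  by_cases ha : AntiC β
  · exact ⟨[], by simp [PosWord], by rwa [actC_nil], by simp [invC_of_antiC ha]⟩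
  · obtain ⟨i, hi, hlt⟩ := not_antiC ha
    have hw := invC_swapC hβ hi hlt
    obtain ⟨ρ, h1, h2, h3⟩ := exists_sorting_word (swapC β i) (hβ.swapC hi)
    refine ⟨i :: ρ, ?_, by rwa [actC_cons], by simp only [List.length_cons]; omega⟩
    intro x hx
    rcases List.mem_cons.mp hx with rfl | hx
    · exact hi
    · exact h1 x hx
  termination_by invC β

theorem actC_weakComp : ∀ (ρ : List ℕ) (β : ℕ → ℕ), PosWord ρ → WeakComp β → WeakComp (actC β ρ)
  | [], β, _, h => by rwa [actC_nil]
  | i :: ρ, β, hp, h => by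
    rw [actC_cons]; exact actC_weakComp ρ _ hp.tail.2 (h.swapC hp.tail.1)

theorem isKey_piWord : ∀ (ρ : List ℕ) (β : ℕ → ℕ), PosWord ρ → WeakComp β → AntiC (actC β ρ) →
    ρ.length = invC β → IsKey β (piWord ρ (xExp (actC β ρ)))
  | [], β, _, hβ, ha, _ => by rw [actC_nil] at *; exact IsKey.base _ hβ ha
  | i :: ρ, β, hp, hβ, ha, hl => by
    rw [actC_cons] at *
    obtain ⟨hi, hp⟩ := hp.tail
    have h1 := invC_le_length ρ _ hp (hβ.swapC hi) ha
    have h2 := invC_le_succ hβ hi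
    simp only [List.length_cons] at hl
    have hlt : β i < β (i + 1) := by
      rcases lt_trichotomy (β i) (β (i + 1)) with hl | he | hg
      · exact hl
      · rw [swapC_of_eq he] at h1; omega
      · have := invC_swapC (hβ.swapC hi) hi (by rw [swapC_left, swapC_right]; exact hg)
        rw [swapC_swapC] at this; omega
    have h3 := invC_swapC hβ hi hlt
    exact IsKey.step _ _ _ hi hlt (isKey_piWord ρ _ hp (hβ.swapC hi) ha (by omega))

theorem conjC_swapC (β : ℕ → ℕ) {i : ℕ} (hi : 1 ≤ i) : conjC (swapC β i) = conjC β := by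
  funext t
  unfold conjC
  have hpos : ∀ j, 1 ≤ j → 1 ≤ sPerm i j := by
    intro j hj; simp only [sPerm, Equiv.swap_apply_def]; grind
  have : {j : ℕ | 1 ≤ j ∧ 1 ≤ t ∧ t ≤ swapC β i j} =
      (sPerm i) '' {j : ℕ | 1 ≤ j ∧ 1 ≤ t ∧ t ≤ β j} := by
    ext j
    constructor
    · rintro ⟨h1, h2, h3⟩
      exact ⟨sPerm i j, ⟨hpos j h1, h2, h3⟩, sPerm_sPerm i j⟩
    · rintro ⟨k, ⟨h1, h2, h3⟩, rfl⟩
      exact ⟨hpos k h1, h2, by rwa [swapC_apply, sPerm_sPerm]⟩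
  rw [this, Set.ncard_image_of_injective _ (sPerm i).injective]

theorem sortC_actC : ∀ (ρ : List ℕ) (β : ℕ → ℕ), PosWord ρ → sortC (actC β ρ) = sortC β
  | [], β, _ => by rw [actC_nil]
  | i :: ρ, β, hp => by
    rw [actC_cons, sortC_actC ρ _ hp.tail.2]
    unfold sortC
    rw [conjC_swapC β hp.tail.1]

theorem sortC_of_antiC {β : ℕ → ℕ} (hβ : WeakComp β) (ha : AntiC β) : sortC β = β := by
  obtain ⟨N, hN⟩ := hβ.exists_bound
  have key : ∀ t i, 1 ≤ t → 1 ≤ i → (i ≤ conjC β t ↔ t ≤ β i) := by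
    intro t i ht hi
    have hfin : {j : ℕ | 1 ≤ j ∧ 1 ≤ t ∧ t ≤ β j}.Finite := by
      refine (Set.finite_lt_nat N).subset ?_
      rintro j ⟨_, _, h3⟩
      by_contra hc
      rw [hN j (by simpa using hc)] at h3; omega
    constructor
    · intro h
      by_contra hc
      have hsub : {j : ℕ | 1 ≤ j ∧ 1 ≤ t ∧ t ≤ β j} ⊆ ((Finset.Ico 1 i : Finset ℕ) : Set ℕ) := by
        rintro j ⟨h1, _, h3⟩
        simp only [Finset.coe_Ico, Set.mem_Ico]
        refine ⟨h1, ?_⟩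
        by_contra hji
        have := ha.le hi (show i ≤ j by omega)
        omega
      have := Set.ncard_le_ncard hsub (Finset.finite_toSet _)
      rw [Set.ncard_coe_finset, Nat.card_Ico] at this
      unfold conjC at h; omega
    · intro h
      have hsub : ((Finset.Icc 1 i : Finset ℕ) : Set ℕ) ⊆ {j : ℕ | 1 ≤ j ∧ 1 ≤ t ∧ t ≤ β j} := by
        intro j hj
        simp only [Finset.coe_Icc, Set.mem_Icc] at hj
        exact ⟨hj.1, ht, h.trans (ha.le hj.1 hj.2)⟩
      have := Set.ncard_le_ncard hsub hfin
      rw [Set.ncard_coe_finset, Nat.card_Icc] at this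
      unfold conjC; omega
  funext i
  unfold sortC
  by_cases hi : 1 ≤ i
  · rw [conjC]
    have : {j : ℕ | 1 ≤ j ∧ 1 ≤ i ∧ i ≤ conjC β j} = ((Finset.Icc 1 (β i) : Finset ℕ) : Set ℕ) := by
      ext j
      simp only [Set.mem_setOf_eq, Finset.coe_Icc, Set.mem_Icc]
      constructor
      · rintro ⟨h1, _, h3⟩
        exact ⟨h1, (key j i h1 hi).mp h3⟩
      · rintro ⟨h1, h2⟩
        exact ⟨h1, hi, (key j i h1 hi).mpr h2⟩
    rw [this, Set.ncard_coe_finset, Nat.card_Icc]; omega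
  · have h0 : i = 0 := by omega
    subst h0
    rw [hβ.1, conjC]
    simp

theorem permLength_of_reduced {ρ : List ℕ} (h : IsReducedWord ρ) :
    permLength (wordPerm ρ) = ρ.length := by
  unfold permLength
  apply le_antisymm
  · exact Nat.sInf_le ⟨ρ, h.1, rfl, rfl⟩
  · have hne : {n : ℕ | ∃ σ : List ℕ, PosWord σ ∧ wordPerm σ = wordPerm ρ ∧ σ.length = n}.Nonempty :=
      ⟨_, ρ, h.1, rfl, rfl⟩
    obtain ⟨σ, h1, h2, h3⟩ := Nat.sInf_mem hne
    rw [← h3]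
    exact h.2 σ h1 h2

theorem keyPoly_isKey {β : ℕ → ℕ} (hβ : WeakComp β) : IsKey β (keyPoly β) := by
  have srt : ∀ ρ, PosWord ρ → (∀ i, β (wordPerm ρ i) = sortC β i) → AntiC (actC β ρ) := by
    intro ρ hp h
    obtain ⟨σ, s1, s2, _⟩ := exists_sorting_word β hβ
    have e : actC β ρ = actC β σ := by
      funext i
      rw [← sortC_of_antiC (actC_weakComp σ β s1 hβ) s2, sortC_actC σ β s1]
      exact h i
    rwa [e]
  obtain ⟨σ, s1, s2, s3⟩ := exists_sorting_word β hβ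
  have es : ∀ i, β (wordPerm σ i) = sortC β i := by
    intro i
    rw [← sortC_actC σ β s1, sortC_of_antiC (actC_weakComp σ β s1 hβ) s2]
    rfl
  have hred : IsReducedWord σ := by
    refine ⟨s1, fun τ ht he => ?_⟩
    rw [s3]
    refine invC_le_length τ β ht hβ (srt τ ht fun i => ?_)
    rw [he]; exact es i
  have hex : ∃ (ρ : List ℕ) (w : Equiv.Perm ℕ), IsReducedWordFor w ρ ∧
      (∀ i, β (w i) = sortC β i) ∧
      (∀ v : Equiv.Perm ℕ, (∃ τ, IsReducedWordFor v τ) → (∀ i, β (v i) = sortC β i) →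
        permLength w ≤ permLength v) := by
    refine ⟨σ, wordPerm σ, ⟨hred, rfl⟩, es, ?_⟩
    rintro v ⟨τ, ht, rfl⟩ hv
    rw [permLength_of_reduced hred, permLength_of_reduced ht, s3]
    exact invC_le_length τ β ht.1 hβ (srt τ ht.1 hv)
  have e : keyPoly β = piWord hex.choose (xExp (sortC β)) := dif_pos hex
  rw [e]
  obtain ⟨w, ⟨hr, hw⟩, h2, h3⟩ := hex.choose_spec
  generalize hex.choose = ρ at *
  subst hw
  have ha := srt ρ hr.1 h2
  have hl : ρ.length = invC β := by
    apply le_antisymm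
    · rw [← permLength_of_reduced hr, ← s3, ← permLength_of_reduced hred]
      exact h3 _ ⟨σ, hred, rfl⟩ es
    · exact invC_le_length ρ β hr.1 hβ ha
  have : sortC β = actC β ρ := by funext i; exact (h2 i).symm
  rw [this]
  exact isKey_piWord ρ β hr.1 hβ ha hl

/-! ### Induction on flags -/

/-- The number of elements of `A` that are at most `x`. -/
def rankIn (A : Finset ℕ) (x : ℕ) : ℕ := (A.filter (· ≤ x)).card

theorem rankIn_mono (A : Finset ℕ) {x y : ℕ} (h : x ≤ y) : rankIn A x ≤ rankIn A y :=
  Finset.card_le_card fun a ha => by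
    simp only [Finset.mem_filter] at ha ⊢
    exact ⟨ha.1, ha.2.trans h⟩

theorem rankIn_lt {A : Finset ℕ} {x y : ℕ} (hy : y ∈ A) (h : x < y) : rankIn A x < rankIn A y := by
  apply Finset.card_lt_card
  rw [Finset.ssubset_iff_of_subset]
  · exact ⟨y, by simp [hy], by simp [h]⟩
  · intro a ha
    simp only [Finset.mem_filter] at ha ⊢
    exact ⟨ha.1, ha.2.trans h.le⟩

theorem rankIn_pos {A : Finset ℕ} {a : ℕ} (ha : a ∈ A) : 1 ≤ rankIn A a :=
  Finset.card_pos.mpr ⟨a, by simp [ha]⟩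

theorem rankIn_le_card (A : Finset ℕ) (a : ℕ) : rankIn A a ≤ A.card :=
  Finset.card_le_card (Finset.filter_subset _ _)

theorem rankIn_strictMonoOn (A : Finset ℕ) : StrictMonoOn (rankIn A) A :=
  fun _ _ _ hy h => rankIn_lt hy h

theorem rankIn_injOn (A : Finset ℕ) : Set.InjOn (rankIn A) A := (rankIn_strictMonoOn A).injOn

theorem image_rankIn (A : Finset ℕ) : A.image (rankIn A) = Finset.Icc 1 A.card := by
  apply Finset.eq_of_subset_of_card_le
  · intro v hv
    obtain ⟨a, ha, rfl⟩ := Finset.mem_image.mp hv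
    exact Finset.mem_Icc.mpr ⟨rankIn_pos ha, rankIn_le_card A a⟩
  · rw [Nat.card_Icc, Finset.card_image_of_injOn (rankIn_injOn A)]; omega

theorem exists_rankIn_eq {A : Finset ℕ} {v : ℕ} (h1 : 1 ≤ v) (h2 : v ≤ A.card) :
    ∃ a ∈ A, rankIn A a = v := by
  have : v ∈ A.image (rankIn A) := by rw [image_rankIn]; exact Finset.mem_Icc.mpr ⟨h1, h2⟩
  simpa using this

theorem rankIn_le_of_injOn {A : Finset ℕ} {S : ℕ → ℕ} {a v : ℕ} (hS : Set.InjOn S A)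
    (h1 : ∀ x ∈ A, x ≤ a → 1 ≤ S x ∧ S x ≤ v) : rankIn A a ≤ v := by
  have : ((A.filter (· ≤ a)).image S) ⊆ Finset.Icc 1 v := by
    intro y hy
    obtain ⟨x, hx, rfl⟩ := Finset.mem_image.mp hy
    simp only [Finset.mem_filter] at hx
    exact Finset.mem_Icc.mpr (h1 x hx.1 hx.2)
  have h2 := Finset.card_le_card this
  rw [Finset.card_image_of_injOn, Nat.card_Icc] at h2
  · exact h2
  · intro x hx y hy hxy
    simp only [Finset.coe_filter, Set.mem_setOf_eq] at hx hy
    exact hS hx.1 hy.1 hxy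

theorem flag_induction (A : Finset ℕ) (P : (ℕ → ℕ) → Prop)
    (hcongr : ∀ φ ψ : ℕ → ℕ, (∀ a ∈ A, φ a = ψ a) → P φ → P ψ)
    (hsmall : ∀ (φ : ℕ → ℕ) (a : ℕ), MonotoneOn φ A → a ∈ A → φ a < rankIn A a → P φ)
    (hbase : P (rankIn A))
    (hstep : ∀ (φ : ℕ → ℕ) (a j : ℕ), MonotoneOn φ A → a ∈ A → 1 ≤ j → φ a = j + 1 →
      (∀ x ∈ A, x < a → φ x < j) → MonotoneOn (Function.update φ a j) A →
      P (Function.update φ a j) → P φ)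
    (φ : ℕ → ℕ) (hφ : MonotoneOn φ A) : P φ := by
  by_cases h1 : ∃ a ∈ A, φ a < rankIn A a
  · obtain ⟨a, ha, hlt⟩ := h1
    exact hsmall φ a hφ ha hlt
  push Not at h1
  by_cases h2 : ∃ a ∈ A, ∃ j, 1 ≤ j ∧ φ a = j + 1 ∧ ∀ x ∈ A, x < a → φ x < j
  · obtain ⟨a, ha, j, hj, e, hx⟩ := h2
    have hm : MonotoneOn (Function.update φ a j) A := by
      intro x hxA y hyA hxy
      by_cases e1 : x = a
      · subst e1
        by_cases e2 : y = x
        · subst e2; exact le_rfl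
        · have := hφ hxA hyA hxy
          rw [Function.update_self, Function.update_of_ne e2]; omega
      · rw [Function.update_of_ne e1]
        by_cases e2 : y = a
        · subst e2
          rw [Function.update_self]
          exact (hx x hxA (by omega)).le
        · rw [Function.update_of_ne e2]
          exact hφ hxA hyA hxy
    have hdec : ∑ x ∈ A, Function.update φ a j x < ∑ x ∈ A, φ x := by
      apply Finset.sum_lt_sum
      · intro x _
        by_cases e1 : x = a
        · subst e1; rw [Function.update_self]; omega
        · rw [Function.update_of_ne e1]
      · exact ⟨a, ha, by rw [Function.update_self]; omega⟩
    exact hstep φ a j hφ ha hj e hx hm (flag_induction A P hcongr hsmall hbase hstep _ hm)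
  · push Not at h2
    refine hcongr (rankIn A) φ ?_ hbase
    have key : ∀ a, a ∈ A → φ a ≤ rankIn A a := by
      intro a
      induction a using Nat.strong_induction_on with
      | _ a ih =>
        intro ha
        by_cases h3 : φ a ≤ 1
        · exact h3.trans (rankIn_pos ha)
        · obtain ⟨x, hx, hxa, hle⟩ := h2 a ha (φ a - 1) (by omega) (by omega)
          have := ih x hxa hx
          have := rankIn_lt ha hxa
          omega
    intro a ha
    exact le_antisymm (h1 a ha) (key a ha)
  termination_by ∑ x ∈ A, φ x

/-! ### Columns of key tableaux -/

theorem columns_finite (N : ℕ) (A : Finset ℕ) :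
    {S : ℕ → ℕ | (∀ r, S r ≠ 0 ↔ r ∈ A) ∧ (∀ r, S r ≤ N) ∧ Set.InjOn S A}.Finite := by
  refine (Set.finite_range (fun (g : A → Fin (N + 1)) (r : ℕ) =>
    if h : r ∈ A then (g ⟨r, h⟩ : ℕ) else 0)).subset ?_
  rintro S ⟨h1, h2, _⟩
  refine ⟨fun a => ⟨S a, by have := h2 a; omega⟩, ?_⟩
  funext r
  by_cases h : r ∈ A
  · simp [h]
  · simp only [h, dif_neg, not_false_eq_true]
    by_contra hc
    exact h ((h1 r).mp (Ne.symm hc))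

/-- The possible columns, with entries at most `N`, occupying the rows in `A`. -/
def columns (N : ℕ) (A : Finset ℕ) : Finset (ℕ → ℕ) := (columns_finite N A).toFinset

theorem mem_columns {N : ℕ} {A : Finset ℕ} {S : ℕ → ℕ} :
    S ∈ columns N A ↔ (∀ r, S r ≠ 0 ↔ r ∈ A) ∧ (∀ r, S r ≤ N) ∧ Set.InjOn S A := by
  simp [columns]

/-- The condition for `S'` to be the column to the right of `S` in a key tableau. -/
def Compat (S S' : ℕ → ℕ) : Prop :=
  (∀ r, S' r ≤ S r) ∧ ∀ r k, r < k → S k ≠ 0 → S k < S r → S k < S' r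

/-- The monomial of a column. -/
def colMon (A : Finset ℕ) (S : ℕ → ℕ) : MvPolynomial ℕ ℤ := ∏ r ∈ A, X (S r)

/-- Generating function of the key tableaux with first column `S`. -/
def colGen (N : ℕ) : Finset ℕ → List (Finset ℕ) → (ℕ → ℕ) → MvPolynomial ℕ ℤ
  | A, [], S => colMon A S * if Compat S 0 then 1 else 0
  | A, A' :: L, S =>
    colMon A S * ∑ S' ∈ columns N A', if Compat S S' then colGen N A' L S' else 0

/-- Generating function of flagged key tableaux, the shape being given by its columns. -/
def keyGen (N : ℕ) : List (Finset ℕ) → (ℕ → ℕ) → MvPolynomial ℕ ℤ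
  | [], _ => 1
  | A :: L, φ => ∑ S ∈ columns N A, if ∀ a ∈ A, S a ≤ φ a then colGen N A L S else 0

/-- `v` is `j` or `j + 1`. -/
def InJ (j v : ℕ) : Prop := v = j ∨ v = j + 1

theorem InJ.sPerm {j v : ℕ} (h : InJ j v) : InJ j (sPerm j v) := by
  rcases h with rfl | rfl
  · right; exact sPerm_left _
  · left; exact sPerm_right _

theorem sPerm_of_not_inJ {j v : ℕ} (h : ¬ InJ j v) : sPerm j v = v := by
  unfold InJ at h
  push Not at h
  exact sPerm_of_ne h.1 h.2

theorem inJ_sPerm {j v : ℕ} : InJ j (sPerm j v) ↔ InJ j v :=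
  ⟨fun h => by have := h.sPerm; rwa [sPerm_sPerm] at this, fun h => h.sPerm⟩

/-- Two columns that agree up to exchanging entries `j` and `j + 1`. -/
def JRel (j : ℕ) (S R : ℕ → ℕ) : Prop := ∀ r, R r = S r ∨ (InJ j (S r) ∧ InJ j (R r))

theorem JRel.refl (j : ℕ) (S : ℕ → ℕ) : JRel j S S := fun _ => Or.inl rfl

/-- The column with the entries `j` and `j + 1` exchanged. -/
def colSwap (j : ℕ) (S : ℕ → ℕ) : ℕ → ℕ := fun r => sPerm j (S r)

theorem colSwap_colSwap (j : ℕ) (S : ℕ → ℕ) : colSwap j (colSwap j S) = S := by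
  funext r; simp [colSwap, sPerm_sPerm]

theorem rel_colSwap (j : ℕ) (S : ℕ → ℕ) : JRel j S (colSwap j S) := by
  intro r
  by_cases h : InJ j (S r)
  · exact Or.inr ⟨h, h.sPerm⟩
  · exact Or.inl (sPerm_of_not_inJ h)

theorem rel_colSwap' (j : ℕ) (S : ℕ → ℕ) : JRel j (colSwap j S) S := by
  have := rel_colSwap j (colSwap j S)
  rwa [colSwap_colSwap] at this

theorem Compat.transfer {j : ℕ} (hj : 1 ≤ j) {S S' R R' : ℕ → ℕ} (hS : JRel j S R)
    (hS' : JRel j S' R')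
    (c1 : ∀ r, InJ j (R r) → InJ j (R' r) → R' r ≤ R r)
    (c2 : ∀ r k, r < k → InJ j (R k) → InJ j (R' r) → R k < R r → R k < R' r)
    (c3 : ∀ r k, r < k → InJ j (R k) → InJ j (R r) → R k < R r → R k < R' r)
    (h : Compat S S') : Compat R R' := by
  unfold InJ JRel at *
  unfold InJ at *
  refine ⟨fun r => ?_, fun r k hrk h0 hlt => ?_⟩
  · have := h.1 r
    have := hS r
    have := hS' r
    have := c1 r
    omega
  · have a1 := hS r
    have a2 := hS' r
    have a3 := hS k
    have a4 := h.2 r k hrk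
    have a5 := c2 r k hrk
    have a6 := c3 r k hrk
    omega

/-- No entry of the column is `j` or `j + 1`. -/
def NoJ (j : ℕ) (S : ℕ → ℕ) : Prop := ∀ r, ¬ InJ j (S r)

/-- The lowest entry of the column among `j` and `j + 1` is an entry `j`, in row `p`. -/
def LowJ (j : ℕ) (S : ℕ → ℕ) (p : ℕ) : Prop := S p = j ∧ ∀ r, r < p → ¬ InJ j (S r)

/-- The only entry of the column among `j` and `j + 1` is an entry `j`, in row `p`. -/
def SingleJ (j : ℕ) (S : ℕ → ℕ) (p : ℕ) : Prop := S p = j ∧ ∀ r, r ≠ p → ¬ InJ j (S r)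

/-- The column has an entry `j` in row `p` and `j + 1` in a higher row `q`. -/
def PairJ (j : ℕ) (S : ℕ → ℕ) (p q : ℕ) : Prop :=
  p < q ∧ S p = j ∧ S q = j + 1 ∧ ∀ r, r ≠ p → r ≠ q → ¬ InJ j (S r)

theorem InJ.succ (j : ℕ) : InJ j (j + 1) := Or.inr rfl

theorem inJ_colSwap {j : ℕ} {S : ℕ → ℕ} {r : ℕ} : InJ j (colSwap j S r) ↔ InJ j (S r) := inJ_sPerm

theorem colSwap_of_noJ {j : ℕ} {S : ℕ → ℕ} (h : NoJ j S) : colSwap j S = S :=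
  funext fun r => sPerm_of_not_inJ (h r)

theorem compat_colSwap_right {j : ℕ} (hj : 1 ≤ j) {S S' : ℕ → ℕ} (h : NoJ j S) :
    Compat S S' ↔ Compat S (colSwap j S') := by
  constructor
  · exact Compat.transfer hj (JRel.refl j S) (rel_colSwap j S') (fun r hr => absurd hr (h r))
      (fun r k _ hr => absurd hr (h k)) (fun r k _ hr => absurd hr (h k))
  · exact Compat.transfer hj (JRel.refl j S) (rel_colSwap' j S') (fun r hr => absurd hr (h r))
      (fun r k _ hr => absurd hr (h k)) (fun r k _ hr => absurd hr (h k))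

/-- With a single entry in `{j, j + 1}`, the value of this entry only matters for compatibility
with columns having such entries in the same row or below. -/
theorem SingleJ.transfer {j p : ℕ} (hj : 1 ≤ j) {S S' R R' : ℕ → ℕ} (hS : JRel j S R)
    (hS' : JRel j S' R') (hR : ∀ r, r ≠ p → ¬ InJ j (R r)) (h1 : ∀ r, r < p → ¬ InJ j (R' r))
    (h2 : InJ j (R' p) → R' p ≤ R p) (h : Compat S S') : Compat R R' := by
  refine Compat.transfer hj hS hS' ?_ ?_ ?_ h
  · intro r a b
    by_cases e : r = p
    · subst e; exact h2 b
    · exact absurd a (hR r e)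
  · intro r k hrk a b _
    by_cases e : k = p
    · subst e; exact absurd b (h1 r hrk)
    · exact absurd a (hR k e)
  · intro r k hrk a b _
    by_cases e : k = p
    · exact absurd b (hR r (by omega))
    · exact absurd a (hR k e)

theorem SingleJ.not_inJ_colSwap {j p : ℕ} {S : ℕ → ℕ} (h : SingleJ j S p) :
    ∀ r, r ≠ p → ¬ InJ j (colSwap j S r) := fun r hr => by
  rw [inJ_colSwap]; exact h.2 r hr

theorem SingleJ.compat_noJ {j p : ℕ} (hj : 1 ≤ j) {S S' : ℕ → ℕ} (h : SingleJ j S p)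
    (h' : NoJ j S') : Compat S S' ↔ Compat (colSwap j S) S' := by
  constructor
  · exact SingleJ.transfer (p := p) hj (rel_colSwap j S) (JRel.refl j S') h.not_inJ_colSwap
      (fun r _ => h' r) (fun a => absurd a (h' p))
  · exact SingleJ.transfer (p := p) hj (rel_colSwap' j S) (JRel.refl j S') h.2
      (fun r _ => h' r) (fun a => absurd a (h' p))

theorem SingleJ.compat_lowJ {j p p' : ℕ} (hj : 1 ≤ j) {S S' : ℕ → ℕ} (h : SingleJ j S p)
    (h' : LowJ j S' p') :
    ((Compat S S' ↔ Compat (colSwap j S) S') ∧ (Compat S (colSwap j S') ↔ Compat S S') ∧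
      (Compat (colSwap j S) (colSwap j S') ↔ Compat S S')) ∨
    (Compat S S' ∧ ¬ Compat S (colSwap j S') ∧ Compat (colSwap j S) S' ∧
      Compat (colSwap j S) (colSwap j S')) ∨
    (¬ Compat S S' ∧ Compat S (colSwap j S') ∧ ¬ Compat (colSwap j S) S' ∧
      ¬ Compat (colSwap j S) (colSwap j S')) := by
  have hsp : colSwap j S p = j + 1 := by simp [colSwap, h.1, sPerm_left]
  have hsp' : colSwap j S' p' = j + 1 := by simp [colSwap, h'.1, sPerm_left]
  have hs : ∀ r, r ≠ p → colSwap j S r = S r := fun r hr => sPerm_of_not_inJ (h.2 r hr)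
  have hh := h.not_inJ_colSwap
  have low' : ∀ r, r < p' → ¬ InJ j (colSwap j S' r) := fun r hr => by
    rw [inJ_colSwap]; exact h'.2 r hr
  rcases lt_trichotomy p' p with hlt | he | hgt
  · have n11 : ¬ Compat S S' := by
      intro hc
      have h1 := hc.1 p'
      have h2 := h.2 p' (by omega)
      have h3 := hc.2 p' p hlt
      have h4 := h.1
      have h5 := h'.1
      unfold InJ at h2; omega
    have n2 : ∀ R', InJ j (R' p') → ¬ Compat (colSwap j S) R' := by
      intro R' hR hc
      have h1 := hc.1 p'
      have h2 := h.2 p' (by omega)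
      have h3 := hc.2 p' p hlt
      have h4 := hs p' (by omega)
      unfold InJ at h2 hR; omega
    have n21 := n2 S' (Or.inl h'.1)
    have n22 := n2 (colSwap j S') (Or.inr hsp')
    tauto
  · subst he
    have n12 : ¬ Compat S (colSwap j S') := by
      intro hc
      have h1 := hc.1 p'
      have h2 := h.1
      omega
    have up : ∀ R' : ℕ → ℕ, colSwap j S p' = j + 1 → InJ j (R' p') → R' p' ≤ colSwap j S p' := by
      intro R' h1 h2
      unfold InJ at h2; omega
    have t1 : Compat S S' → Compat (colSwap j S) S' :=
      SingleJ.transfer hj (rel_colSwap j S) (JRel.refl j S') hh h'.2 (up S' hsp)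
    have t2 : Compat (colSwap j S) S' → Compat (colSwap j S) (colSwap j S') :=
      SingleJ.transfer hj (JRel.refl j _) (rel_colSwap j S') hh low' (up _ hsp)
    have t3 : Compat (colSwap j S) (colSwap j S') → Compat S S' :=
      SingleJ.transfer hj (rel_colSwap' j S) (rel_colSwap' j S') h.2 h'.2
        (fun _ => by rw [h'.1, h.1])
    tauto
  · left
    have z : ¬ InJ j (S' p) := h'.2 p hgt
    have z' : ¬ InJ j (colSwap j S' p) := low' p hgt
    have l1 : ∀ r, r < p → ¬ InJ j (S' r) := fun r hr => h'.2 r (by omega)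
    have l2 : ∀ r, r < p → ¬ InJ j (colSwap j S' r) := fun r hr => low' r (by omega)
    refine ⟨⟨?_, ?_⟩, ⟨?_, ?_⟩, ⟨?_, ?_⟩⟩
    · exact SingleJ.transfer hj (rel_colSwap j S) (JRel.refl j S') hh l1 (fun a => absurd a z)
    · exact SingleJ.transfer hj (rel_colSwap' j S) (JRel.refl j S') h.2 l1 (fun a => absurd a z)
    · exact SingleJ.transfer hj (JRel.refl j S) (rel_colSwap' j S') h.2 l1 (fun a => absurd a z)
    · exact SingleJ.transfer hj (JRel.refl j S) (rel_colSwap j S') h.2 l2 (fun a => absurd a z')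
    · exact SingleJ.transfer hj (rel_colSwap' j S) (rel_colSwap' j S') h.2 l1
        (fun a => absurd a z)
    · exact SingleJ.transfer hj (rel_colSwap j S) (rel_colSwap j S') hh l2 (fun a => absurd a z')

theorem PairJ.not_compat {j p q : ℕ} (hj : 1 ≤ j) {S S' : ℕ → ℕ} (h : PairJ j S p q)
    (h' : ¬ InJ j (S' p)) : ¬ Compat (colSwap j S) S' := by
  obtain ⟨hpq, hp, hq, _⟩ := h
  intro hc
  have h1 := hc.1 p
  have h2 := hc.2 p q hpq
  have e1 : colSwap j S p = j + 1 := by simp [colSwap, hp, sPerm_left]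
  have e2 : colSwap j S q = j := by simp [colSwap, hq, sPerm_right]
  unfold InJ at h'; omega

theorem PairJ.compat_colSwap {j p q : ℕ} (hj : 1 ≤ j) {S S' R' : ℕ → ℕ} (h : PairJ j S p q)
    (hR : JRel j S' R') (h' : ¬ InJ j (S' p)) (hc : Compat S S') : Compat S R' := by
  obtain ⟨hpq, hp, hq, hr⟩ := h
  unfold JRel InJ at *
  refine Compat.transfer hj (JRel.refl j S) hR ?_ ?_ ?_ hc
  · intro r a b
    unfold InJ at *
    have := hr r
    have := hR r
    by_cases e : r = p
    · subst e; omega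
    · by_cases e' : r = q
      · subst e'; omega
      · omega
  · intro r k hrk a b hlt
    unfold InJ at *
    have h1 := hr r
    have h2 := hr k
    have h3 := hR r
    have h4 := hc.1 r
    have h5 := hc.2 r q
    by_cases e : r = p
    · subst e; omega
    · by_cases e' : k = p
      · subst e'; omega
      · by_cases e'' : k = q
        · subst e''; omega
        · omega
  · intro r k hrk a b hlt
    unfold InJ at *
    have h1 := hr r
    have h2 := hr k
    by_cases e : r = p
    · subst e; omega
    · by_cases e' : r = q
      · subst e'
        by_cases e'' : k = p
        · subst e''; omega
        · omega
      · omega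

theorem PairJ.compat_lowJ {j p q p' : ℕ} (hj : 1 ≤ j) {S S' : ℕ → ℕ} (h : PairJ j S p q)
    (h' : LowJ j S' p') (inj : ∀ r s, S' r = S' s → InJ j (S' r) → r = s) :
    (¬ Compat S (colSwap j S') ∧ ¬ Compat (colSwap j S) S' ∧
      (Compat (colSwap j S) (colSwap j S') ↔ Compat S S')) ∨
    ((Compat S (colSwap j S') ↔ Compat S S') ∧ ¬ Compat (colSwap j S) S' ∧
      ¬ Compat (colSwap j S) (colSwap j S')) := by
  by_cases hp' : InJ j (S' p)
  · left
    obtain ⟨hpq, hp, hq, hr⟩ := h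
    have e1 : colSwap j S p = j + 1 := by simp [colSwap, hp, sPerm_left]
    have e2 : colSwap j S q = j := by simp [colSwap, hq, sPerm_right]
    have hs : ∀ r, r ≠ p → r ≠ q → colSwap j S r = S r :=
      fun r h1 h2 => sPerm_of_not_inJ (hr r h1 h2)
    have hval : ∀ r, S' r = j ∧ colSwap j S' r = j + 1 ∨ S' r = j + 1 ∧ colSwap j S' r = j ∨
        ¬ InJ j (S' r) ∧ colSwap j S' r = S' r := by
      intro r
      by_cases hh : InJ j (S' r)
      · rcases hh with hh | hh
        · left; exact ⟨hh, by simp [colSwap, hh, sPerm_left]⟩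
        · right; left; exact ⟨hh, by simp [colSwap, hh, sPerm_right]⟩
      · right; right; exact ⟨hh, sPerm_of_not_inJ hh⟩
    have hS'p' : S' p' = j := h'.1
    have hle : p' ≤ p := by
      by_contra hc
      exact h'.2 p (by omega) hp'
    rcases Nat.lt_or_eq_of_le hle with hlt | he
    · have hcS : colSwap j S' p' = j + 1 := by simp [colSwap, hS'p', sPerm_left]
      have a1 := hr p' (by omega) (by omega)
      have a2 := hs p' (by omega) (by omega)
      have n11 : ¬ Compat S S' := fun hc => by
        have b1 := hc.1 p'
        have b2 := hc.2 p' p hlt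
        unfold InJ at a1; omega
      have n12 : ¬ Compat S (colSwap j S') := fun hc => by
        have b1 := hc.1 p'
        have b2 := hc.2 p' q (by omega)
        unfold InJ at a1; omega
      have n21 : ¬ Compat (colSwap j S) S' := fun hc => by
        have b1 := hc.1 p'
        have b2 := hc.2 p' q (by omega)
        unfold InJ at a1; omega
      have n22 : ¬ Compat (colSwap j S) (colSwap j S') := fun hc => by
        have b1 := hc.1 p'
        have b2 := hc.2 p' p hlt
        unfold InJ at a1; omega
      tauto
    · subst he
      have hcS : colSwap j S' p' = j + 1 := by simp [colSwap, hS'p', sPerm_left]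
      refine ⟨fun hc => ?_, fun hc => ?_, fun hc => ?_, fun hc => ?_⟩
      · have := hc.1 p'; omega
      · have := hc.2 p' q hpq; omega
      · have hq' : S' q ≠ j := fun e => by
          have := inj q p' (by omega) (Or.inl e); omega
        refine Compat.transfer hj (rel_colSwap' j S) (rel_colSwap' j S') ?_ ?_ ?_ hc
        · intro r a b
          have := hval r
          have := hr r
          by_cases e : r = p'
          · subst e; omega
          · by_cases e' : r = q
            · subst e'; unfold InJ at b; omega
            · tauto
        · intro r k hrk a b hlt
          have v1 := hval r
          have h2 := hr k
          by_cases e : r = p'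
          · subst e; unfold InJ at *; omega
          have hne : S' r ≠ j := fun e' => e (inj r p' (by omega) (Or.inl e'))
          by_cases e' : k = q
          · subst e'
            by_cases e2 : r = k
            · omega
            · have h1 := hs r e e2
              have h3 := hc.2 r k hrk (by omega)
              unfold InJ at *; omega
          · by_cases e2 : k = p'
            · exfalso; subst e2; exact h'.2 r hrk b
            · exact absurd a (h2 e2 e')
        · intro r k hrk a b hlt
          have h1 := hr r
          have h2 := hr k
          unfold InJ at *
          by_cases e : r = p'
          · subst e; omega
          · by_cases e' : r = q
            · subst e'
              by_cases e'' : k = p'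
              · subst e''; omega
              · omega
            · omega
      · refine Compat.transfer hj (rel_colSwap j S) (rel_colSwap j S') ?_ ?_ ?_ hc
        · intro r a b
          rw [inJ_colSwap] at a b
          have := hval r
          have := hr r
          by_cases e : r = p'
          · subst e; omega
          · by_cases e' : r = q
            · subst e'
              have : S' r ≠ j := fun e3 => by
                have := inj r p' (by omega) (Or.inl e3); omega
              unfold InJ at *; omega
            · exact absurd a (hr r e e')
        · intro r k hrk a b hlt
          rw [inJ_colSwap] at a b
          have v1 := hval r
          have h2 := hr k
          by_cases e : r = p'
          · subst e
            by_cases e' : k = q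
            · subst e'; omega
            · exact absurd a (h2 (by omega) e')
          have hne : S' r ≠ j := fun e' => e (inj r p' (by omega) (Or.inl e'))
          by_cases e' : k = q
          · subst e'
            have h1 := hs r e (by omega)
            have h3 := hc.2 r k hrk (by omega)
            have h4 := hr r e (by omega)
            have h5 := hc.1 r
            unfold InJ at *; omega
          · by_cases e2 : k = p'
            · exfalso; subst e2; exact h'.2 r hrk b
            · exact absurd a (h2 e2 e')
        · intro r k hrk a b hlt
          rw [inJ_colSwap] at a b
          by_cases e : r = p'
          · subst e
            by_cases e' : k = q
            · subst e'; omega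
            · exact absurd a (hr k (by omega) e')
          · by_cases e' : r = q
            · subst e'
              by_cases e'' : k = p'
              · subst e''; omega
              · exact absurd a (hr k e'' (by omega))
            · exact absurd b (hr r e e')
  · right
    have hp2 : ¬ InJ j (colSwap j S' p) := by rwa [inJ_colSwap]
    refine ⟨⟨?_, ?_⟩, h.not_compat hj hp', h.not_compat hj hp2⟩
    · exact h.compat_colSwap hj (rel_colSwap' j S') hp2
    · exact h.compat_colSwap hj (rel_colSwap j S') hp'

/-! ### Pairs of polynomials related by `π_j` -/

/-- `a + b = π_j a`. -/
def PiPair (j : ℕ) (a b : MvPolynomial ℕ ℤ) : Prop := a + b = piOp j a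

theorem piPair_iff {j : ℕ} {a b : MvPolynomial ℕ ℤ} : PiPair j a b ↔
    (a + b) * (X j - X (j + 1)) = X j * a - X (j + 1) * swapV j a :=
  ⟨fun h => by rw [h, piOp_spec], fun h => eq_piOp h⟩

theorem PiPair.symm_add {j : ℕ} {a b : MvPolynomial ℕ ℤ} (h : PiPair j a b) :
    swapV j (a + b) = a + b := by rw [h, swapV_piOp]

theorem PiPair.zero (j : ℕ) : PiPair j 0 0 := by simp [PiPair, piOp_zero]

theorem PiPair.add {j : ℕ} {a b c d : MvPolynomial ℕ ℤ} (h : PiPair j a b) (h' : PiPair j c d) :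
    PiPair j (a + c) (b + d) := by
  unfold PiPair at *
  rw [piOp_add, ← h, ← h']; ring

theorem PiPair.sum {ι : Type*} {j : ℕ} {s : Finset ι} {a b : ι → MvPolynomial ℕ ℤ}
    (h : ∀ i ∈ s, PiPair j (a i) (b i)) : PiPair j (∑ i ∈ s, a i) (∑ i ∈ s, b i) := by
  induction s using Finset.induction_on with
  | empty => exact PiPair.zero j
  | insert x s hx ih =>
    rw [Finset.sum_insert hx, Finset.sum_insert hx]
    exact (h x (Finset.mem_insert_self _ _)).add
      (ih fun i hi => h i (Finset.mem_insert_of_mem hi))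

theorem PiPair.mul {j : ℕ} {a b e : MvPolynomial ℕ ℤ} (he : swapV j e = e) (h : PiPair j a b) :
    PiPair j (e * a) (e * b) := by
  unfold PiPair at *
  rw [piOp_mul_symm he, ← h]; ring

theorem PiPair.of_symm {j : ℕ} {c : MvPolynomial ℕ ℤ} (h : swapV j c = c) : PiPair j c 0 := by
  unfold PiPair; rw [add_zero, piOp_of_symm h]

theorem piPair_X_mul {j : ℕ} {c : MvPolynomial ℕ ℤ} (h : swapV j c = c) :
    PiPair j (X j * c) (X (j + 1) * c) := by
  rw [piPair_iff, map_mul, swapV_X_left, h]; ring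

theorem PiPair.X_mul_left {j : ℕ} {u v : MvPolynomial ℕ ℤ} (h : PiPair j u v) :
    PiPair j (X j * u) (X (j + 1) * (u + v)) := by
  rw [piPair_iff] at *
  rw [map_mul, swapV_X_left]
  linear_combination X (j + 1) * h

theorem PiPair.X_mul_right {j : ℕ} {u v : MvPolynomial ℕ ℤ} (h : PiPair j u v) :
    PiPair j (X j * v) 0 := by
  apply PiPair.of_symm
  have h1 := h.symm_add
  rw [piPair_iff] at h
  rw [map_mul, swapV_X_left]
  rw [map_add] at h1
  apply mul_right_cancel₀ (X_sub_X_ne_zero (Nat.ne_of_lt (Nat.lt_succ_self j)))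
  linear_combination (X (j + 1) - X j) * h + (X (j + 1) ) * (X j - X (j + 1)) * h1

/-! ### Applying `π_j` to generating functions of key tableaux -/

theorem piOp_sum {ι : Type*} (j : ℕ) (s : Finset ι) (f : ι → MvPolynomial ℕ ℤ) :
    piOp j (∑ i ∈ s, f i) = ∑ i ∈ s, piOp j (f i) := by
  induction s using Finset.induction_on with
  | empty => simp [piOp_zero]
  | insert x s hx ih => rw [Finset.sum_insert hx, Finset.sum_insert hx, piOp_add, ih]

theorem sPerm_eq_zero_iff {j v : ℕ} (hj : 1 ≤ j) : sPerm j v = 0 ↔ v = 0 := by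
  have h0 : sPerm j 0 = 0 := sPerm_of_ne (by omega) (by omega)
  constructor
  · intro h
    have := sPerm_sPerm j v
    rw [h, h0] at this
    exact this.symm
  · rintro rfl; exact h0

theorem colSwap_mem {N j : ℕ} (hj : 1 ≤ j) (hN : j + 1 ≤ N) {A : Finset ℕ} {S : ℕ → ℕ}
    (h : S ∈ columns N A) : colSwap j S ∈ columns N A := by
  rw [mem_columns] at *
  refine ⟨fun r => ?_, fun r => ?_, fun x hx y hy hxy => ?_⟩
  · rw [← h.1 r]; exact not_congr (sPerm_eq_zero_iff hj)
  · have h1 := h.2.1 r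
    rcases rel_colSwap j S r with e | ⟨_, e⟩
    · omega
    · unfold InJ at e; omega
  · exact h.2.2 hx hy ((sPerm j).injective hxy)

theorem columns_inj {N j : ℕ} (hj : 1 ≤ j) {A : Finset ℕ} {S : ℕ → ℕ} (h : S ∈ columns N A) :
    ∀ r s, S r = S s → InJ j (S r) → r = s := by
  rw [mem_columns] at h
  intro r s e hr
  have h0 : S r ≠ 0 := by unfold InJ at hr; omega
  exact h.2.2 ((h.1 r).mp h0) ((h.1 s).mp (e ▸ h0)) e

theorem LowJ.not_noJ {j p : ℕ} {S : ℕ → ℕ} (h : LowJ j S p) : ¬ NoJ j S :=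
  fun h' => h' p (Or.inl h.1)

theorem LowJ.colSwap_val {j p : ℕ} {S : ℕ → ℕ} (h : LowJ j S p) : colSwap j S p = j + 1 := by
  simp [colSwap, h.1, sPerm_left]

theorem LowJ.not_colSwap {j p q : ℕ} {S : ℕ → ℕ} (h : LowJ j S p) : ¬ LowJ j (colSwap j S) q := by
  intro h'
  have h1 := h.colSwap_val
  have h2 := h'.colSwap_val
  rw [colSwap_colSwap] at h2
  rcases lt_trichotomy p q with e | e | e
  · exact h'.2 p e (by rw [h1]; exact InJ.succ j)
  · subst e; have := h.1; omega
  · exact h.2 q e (by rw [h2]; exact InJ.succ j)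

theorem lowJ_cases (j : ℕ) (S : ℕ → ℕ) :
    NoJ j S ∨ (∃ p, LowJ j S p) ∨ ∃ p, LowJ j (colSwap j S) p := by
  by_cases h : NoJ j S
  · exact Or.inl h
  right
  unfold NoJ at h
  push Not at h
  have h1 := Nat.find_spec h
  have h2 : ∀ r, r < Nat.find h → ¬ InJ j (S r) := fun r hr => Nat.find_min h hr
  rcases h1 with e | e
  · exact Or.inl ⟨_, e, h2⟩
  · refine Or.inr ⟨Nat.find h, ?_, fun r hr => ?_⟩
    · simp only [colSwap]; rw [e, sPerm_right]
    · rw [inJ_colSwap]; exact h2 r hr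

theorem sum_columns_split {M : Type*} [AddCommMonoid M] {N j : ℕ} (hj : 1 ≤ j) (hN : j + 1 ≤ N)
    (A : Finset ℕ) (f : (ℕ → ℕ) → M) :
    ∑ S ∈ columns N A, f S = ∑ S ∈ (columns N A).filter (NoJ j), f S +
      ∑ S ∈ (columns N A).filter (fun S => ∃ p, LowJ j S p), (f S + f (colSwap j S)) := by
  rw [Finset.sum_add_distrib, ← Finset.sum_filter_add_sum_filter_not (columns N A) (NoJ j)]
  congr 1
  rw [← Finset.sum_filter_add_sum_filter_not _ (fun S => ∃ p, LowJ j S p)]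
  congr 1
  · apply Finset.sum_congr _ fun _ _ => rfl
    ext S
    simp only [Finset.mem_filter]
    constructor
    · rintro ⟨⟨h1, _⟩, h3⟩; exact ⟨h1, h3⟩
    · rintro ⟨h1, p, h3⟩; exact ⟨⟨h1, h3.not_noJ⟩, p, h3⟩
  · refine Finset.sum_nbij' (colSwap j) (colSwap j) ?_ ?_ ?_ ?_ ?_
    · intro S hS
      simp only [Finset.mem_filter] at hS ⊢
      obtain ⟨⟨h1, h2⟩, h3⟩ := hS
      exact ⟨colSwap_mem hj hN h1, by
        rcases lowJ_cases j S with h | h | h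
        · exact absurd h h2
        · exact absurd h h3
        · exact h⟩
    · intro S hS
      simp only [Finset.mem_filter] at hS ⊢
      obtain ⟨h1, p, h2⟩ := hS
      refine ⟨⟨colSwap_mem hj hN h1, fun h => h2.not_noJ fun r => ?_⟩, ?_⟩
      · have := h r; rwa [inJ_colSwap] at this
      · rintro ⟨q, hq⟩; exact h2.not_colSwap hq
    · intro S _; exact colSwap_colSwap j S
    · intro S _; exact colSwap_colSwap j S
    · intro S _; rw [colSwap_colSwap]

theorem LowJ.single_or_pair {j p N : ℕ} (hj : 1 ≤ j) {A : Finset ℕ} {S : ℕ → ℕ}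
    (hS : S ∈ columns N A) (h : LowJ j S p) : SingleJ j S p ∨ ∃ q, PairJ j S p q := by
  by_cases h1 : ∃ q, q ≠ p ∧ InJ j (S q)
  · right
    obtain ⟨q, hq, h2⟩ := h1
    have hinj := columns_inj hj hS
    have h3 : S q = j + 1 := by
      rcases h2 with e | e
      · exact absurd (hinj q p (by rw [e, h.1]) (Or.inl e)) hq
      · exact e
    refine ⟨q, ?_, h.1, h3, fun r hr hr' h4 => ?_⟩
    · by_contra hc
      exact h.2 q (by omega) (Or.inr h3)
    · rcases h4 with e | e
      · exact hr (hinj r p (by rw [e, h.1]) (Or.inl e))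
      · exact hr' (hinj r q (by rw [e, h3]) (Or.inr e))
  · left
    push Not at h1
    exact ⟨h.1, h1⟩

theorem swapV_colMon (j : ℕ) (A : Finset ℕ) (S : ℕ → ℕ) :
    swapV j (colMon A S) = colMon A (colSwap j S) := by
  unfold colMon
  rw [map_prod]
  exact Finset.prod_congr rfl fun r _ => swapV_X j (S r)

theorem SingleJ.colMon_eq {j p : ℕ} {A : Finset ℕ} {S : ℕ → ℕ} (h : SingleJ j S p) (hp : p ∈ A) :
    ∃ m, swapV j m = m ∧ colMon A S = m * X j ∧ colMon A (colSwap j S) = m * X (j + 1) := by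
  have hm : swapV j (∏ r ∈ A.erase p, X (S r)) = ∏ r ∈ A.erase p, X (S r) := by
    rw [map_prod]
    refine Finset.prod_congr rfl fun r hr => ?_
    rw [swapV_X, sPerm_of_not_inJ (h.2 r (Finset.ne_of_mem_erase hr))]
  have e : colMon A S = (∏ r ∈ A.erase p, X (S r)) * X j := by
    unfold colMon
    rw [← Finset.mul_prod_erase A _ hp, h.1, mul_comm]
  exact ⟨_, hm, e, by rw [← swapV_colMon, e, map_mul, hm, swapV_X_left]⟩

theorem PairJ.colMon_eq {j p q : ℕ} {A : Finset ℕ} {S : ℕ → ℕ} (h : PairJ j S p q) (hp : p ∈ A)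
    (hq : q ∈ A) : colMon A (colSwap j S) = colMon A S := by
  obtain ⟨hpq, h1, h2, h3⟩ := h
  have hq' : q ∈ A.erase p := Finset.mem_erase.mpr ⟨by omega, hq⟩
  have e : colMon A S = X j * (X (j + 1) * ∏ r ∈ (A.erase p).erase q, X (S r)) := by
    unfold colMon
    rw [← Finset.mul_prod_erase A _ hp, ← Finset.mul_prod_erase _ _ hq', h1, h2]
  have hm : swapV j (∏ r ∈ (A.erase p).erase q, X (S r)) = ∏ r ∈ (A.erase p).erase q, X (S r) := by
    rw [map_prod]
    refine Finset.prod_congr rfl fun r hr => ?_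
    simp only [Finset.mem_erase] at hr
    rw [swapV_X, sPerm_of_not_inJ (h3 r hr.2.1 hr.1)]
  rw [← swapV_colMon, e, map_mul, map_mul, hm, swapV_X_left, swapV_X_right]
  ring

theorem ite_zero_symm {j : ℕ} {P : Prop} {c : MvPolynomial ℕ ℤ} (h : swapV j c = c) :
    swapV j (if P then c else 0) = if P then c else 0 := by
  split_ifs
  · exact h
  · exact map_zero _

/-- The tails of the generating functions of key tableaux with a given first column. -/
def colTail (N : ℕ) : List (Finset ℕ) → (ℕ → ℕ) → MvPolynomial ℕ ℤ
  | [], S => if Compat S 0 then 1 else 0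
  | A' :: L, S => ∑ S' ∈ columns N A', if Compat S S' then colGen N A' L S' else 0

theorem colGen_eq (N : ℕ) (A : Finset ℕ) (L : List (Finset ℕ)) (S : ℕ → ℕ) :
    colGen N A L S = colMon A S * colTail N L S := by
  cases L <;> rfl

theorem noJ_zero {j : ℕ} (hj : 1 ≤ j) : NoJ j 0 := fun r h => by
  unfold InJ at h; simp only [Pi.zero_apply] at h; omega

/-- The behaviour of the tails under exchanging `j` and `j + 1` in the first column. -/
def TailInv (N j : ℕ) (L : List (Finset ℕ)) : Prop := ∀ A : Finset ℕ, ∀ S ∈ columns N A,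
  (NoJ j S → swapV j (colTail N L S) = colTail N L S) ∧
  (∀ p, SingleJ j S p → PiPair j (X j * colTail N L S) (X (j + 1) * colTail N L (colSwap j S))) ∧
  ∀ p q, PairJ j S p q → PiPair j (colTail N L S) (colTail N L (colSwap j S))

theorem TailInv.colGen_symm {N j : ℕ} {L : List (Finset ℕ)} (h : TailInv N j L)
    {A : Finset ℕ} {S : ℕ → ℕ} (hS : S ∈ columns N A) (hn : NoJ j S) :
    swapV j (colGen N A L S) = colGen N A L S := by
  rw [colGen_eq, map_mul, swapV_colMon, colSwap_of_noJ hn, (h A S hS).1 hn]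

theorem TailInv.colGen_pair {N j : ℕ} (hj : 1 ≤ j) {L : List (Finset ℕ)} (h : TailInv N j L)
    {A : Finset ℕ} {S : ℕ → ℕ} (hS : S ∈ columns N A) {p : ℕ} (hn : LowJ j S p) :
    PiPair j (colGen N A L S) (colGen N A L (colSwap j S)) := by
  have hmem : ∀ r, InJ j (S r) → r ∈ A := fun r hr => by
    rw [mem_columns] at hS
    rw [← hS.1 r]; unfold InJ at hr; omega
  rw [colGen_eq, colGen_eq]
  rcases hn.single_or_pair hj hS with h1 | ⟨q, h1⟩
  · obtain ⟨m, hm, e1, e2⟩ := h1.colMon_eq (hmem p (Or.inl hn.1))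
    rw [e1, e2, mul_assoc, mul_assoc]
    exact ((h A S hS).2.1 p h1).mul hm
  · have e := h1.colMon_eq (hmem p (Or.inl hn.1)) (hmem q (Or.inr h1.2.2.1))
    rw [e]
    refine ((h A S hS).2.2 p q h1).mul ?_
    rw [swapV_colMon, e]

theorem tailInv (N j : ℕ) (hj : 1 ≤ j) (hN : j + 1 ≤ N) (L : List (Finset ℕ)) : TailInv N j L := by
  induction L with
  | nil =>
    intro A S hS
    have h1 : swapV j (1 : MvPolynomial ℕ ℤ) = 1 := map_one _
    refine ⟨fun _ => ite_zero_symm h1, fun p hp => ?_, fun p q hp => ?_⟩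
    · simp only [colTail, ← hp.compat_noJ hj (noJ_zero hj)]
      exact piPair_X_mul (ite_zero_symm h1)
    · simp only [colTail, hp.not_compat hj (noJ_zero hj p), if_false]
      exact PiPair.of_symm (ite_zero_symm h1)
  | cons A' L ih =>
    intro A S hS
    refine ⟨fun hn => ?_, fun p hp => ?_, fun p q hp => ?_⟩
    · simp only [colTail]
      rw [sum_columns_split hj hN, map_add, map_sum, map_sum]
      congr 1
      · refine Finset.sum_congr rfl fun S' hS' => ?_
        rw [Finset.mem_filter] at hS'
        exact ite_zero_symm (ih.colGen_symm hS'.1 hS'.2)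
      · refine Finset.sum_congr rfl fun S' hS' => ?_
        rw [Finset.mem_filter] at hS'
        obtain ⟨h1, p, h2⟩ := hS'
        simp only [← compat_colSwap_right hj hn]
        have := (ih.colGen_pair hj h1 h2).symm_add
        split_ifs
        · exact this
        · simp
    · simp only [colTail]
      rw [sum_columns_split hj hN, sum_columns_split hj hN A'
        (fun S' => if Compat (colSwap j S) S' then colGen N A' L S' else 0), mul_add, mul_add,
        Finset.mul_sum, Finset.mul_sum, Finset.mul_sum, Finset.mul_sum]
      refine PiPair.add (PiPair.sum fun S' hS' => ?_) (PiPair.sum fun S' hS' => ?_)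
      · rw [Finset.mem_filter] at hS'
        simp only [← hp.compat_noJ hj hS'.2]
        exact piPair_X_mul (ite_zero_symm (ih.colGen_symm hS'.1 hS'.2))
      · rw [Finset.mem_filter] at hS'
        obtain ⟨h1, p', h2⟩ := hS'
        have hpair := ih.colGen_pair hj h1 h2
        rcases hp.compat_lowJ hj h2 with ⟨a1, a2, a3⟩ | ⟨a1, a2, a3, a4⟩ | ⟨a1, a2, a3, a4⟩
        · simp only [← a1, a2, a3]
          by_cases hc : Compat S S'
          · simp only [hc, if_true]
            exact piPair_X_mul hpair.symm_add
          · simp only [hc, if_false, add_zero, mul_zero]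
            exact PiPair.zero j
        · simp only [a1, a2, a3, a4, if_true, if_false, add_zero]
          exact hpair.X_mul_left
        · simp only [a1, a2, a3, a4, if_true, if_false, add_zero, zero_add, mul_zero]
          exact hpair.X_mul_right
    · simp only [colTail]
      rw [sum_columns_split hj hN, sum_columns_split hj hN A'
        (fun S' => if Compat (colSwap j S) S' then colGen N A' L S' else 0)]
      refine PiPair.add (PiPair.sum fun S' hS' => ?_) (PiPair.sum fun S' hS' => ?_)
      · rw [Finset.mem_filter] at hS'
        simp only [hp.not_compat hj (hS'.2 p), if_false]
        exact PiPair.of_symm (ite_zero_symm (ih.colGen_symm hS'.1 hS'.2))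
      · rw [Finset.mem_filter] at hS'
        obtain ⟨h1, p', h2⟩ := hS'
        have hpair := ih.colGen_pair hj h1 h2
        rcases hp.compat_lowJ hj h2 (columns_inj hj h1) with ⟨a1, a2, a3⟩ | ⟨a1, a2, a3⟩
        · simp only [a1, a2, a3, if_false, add_zero, zero_add]
          by_cases hc : Compat S S'
          · simp only [hc, if_true]; exact hpair
          · simp only [hc, if_false]; exact PiPair.zero j
        · simp only [a1, a2, a3, if_false, add_zero]
          apply PiPair.of_symm
          by_cases hc : Compat S S'
          · simp only [hc, if_true]; exact hpair.symm_add
          · simp only [hc, if_false, add_zero, map_zero]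

theorem keyGen_step {N j i : ℕ} (hj : 1 ≤ j) (hN : j + 1 ≤ N) {A : Finset ℕ} (L : List (Finset ℕ))
    {φ : ℕ → ℕ} (hφ : MonotoneOn φ A) (hi : i ∈ A) (hφi : φ i = j + 1)
    (hlow : ∀ x ∈ A, x < i → φ x < j) :
    keyGen N (A :: L) φ = piOp j (keyGen N (A :: L) (Function.update φ i j)) := by
  have hT := tailInv N j hj hN L
  have hflag : ∀ S : ℕ → ℕ, (∀ a ∈ A, S a ≤ Function.update φ i j a) ↔
      (∀ a ∈ A, S a ≤ φ a) ∧ S i ≠ j + 1 := by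
    intro S
    constructor
    · intro h
      refine ⟨fun a ha => ?_, ?_⟩
      · have := h a ha
        by_cases e : a = i
        · subst e; rw [Function.update_self] at this; omega
        · rwa [Function.update_of_ne e] at this
      · have := h i hi; rw [Function.update_self] at this; omega
    · rintro ⟨h1, h2⟩ a ha
      have := h1 a ha
      by_cases e : a = i
      · subst e; rw [Function.update_self]; omega
      · rwa [Function.update_of_ne e]
  simp only [keyGen, hflag]
  rw [sum_columns_split hj hN, sum_columns_split hj hN A
    (fun S => if (∀ a ∈ A, S a ≤ φ a) ∧ S i ≠ j + 1 then colGen N A L S else 0), piOp_add,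
    piOp_sum, piOp_sum]
  congr 1
  · refine Finset.sum_congr rfl fun S hS => ?_
    rw [Finset.mem_filter] at hS
    have h1 : S i ≠ j + 1 := fun e => hS.2 i (Or.inr e)
    simp only [h1, ne_eq, not_false_eq_true, and_true]
    split_ifs
    · rw [piOp_of_symm (hT.colGen_symm hS.1 hS.2)]
    · rw [piOp_zero]
  · refine Finset.sum_congr rfl fun S hS => ?_
    rw [Finset.mem_filter] at hS
    obtain ⟨h1, p, h2⟩ := hS
    have hpair := hT.colGen_pair hj h1 h2
    have hpA : p ∈ A := by
      rw [mem_columns] at h1; rw [← h1.1 p, h2.1]; omega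
    rcases lt_trichotomy p i with hlt | he | hgt
    · have n1 : ¬ ∀ a ∈ A, S a ≤ φ a := fun h => by
        have := h p hpA; have := hlow p hpA hlt; have := h2.1; omega
      have n2 : ¬ ∀ a ∈ A, colSwap j S a ≤ φ a := fun h => by
        have := h p hpA; have := hlow p hpA hlt; have := h2.colSwap_val; omega
      simp only [n1, n2, false_and, if_false, add_zero, piOp_zero]
    all_goals
      have hiff : (∀ a ∈ A, colSwap j S a ≤ φ a) ↔ ∀ a ∈ A, S a ≤ φ a := by
        refine forall₂_congr fun a ha => ?_
        rcases rel_colSwap j S a with e | ⟨e1, e2⟩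
        · rw [e]
        · have hpa : p ≤ a := by
            by_contra hc; exact h2.2 a (by omega) e1
          have := hφ hi ha (by omega)
          unfold InJ at e1 e2
          constructor <;> intro <;> omega
    · subst he
      have e1 : S p ≠ j + 1 := by rw [h2.1]; omega
      have e2 := h2.colSwap_val
      simp only [e1, e2, hiff, ne_eq, not_true, not_false_eq_true, and_true, and_false, if_false,
        add_zero]
      split_ifs
      · exact hpair
      · rw [piOp_zero, add_zero]
    · have e1 : ¬ InJ j (S i) := h2.2 i hgt
      have e2 : ¬ InJ j (colSwap j S i) := by rwa [inJ_colSwap]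
      have e3 : S i ≠ j + 1 := fun h => e1 (Or.inr h)
      have e4 : colSwap j S i ≠ j + 1 := fun h => e2 (Or.inr h)
      simp only [e3, e4, hiff, ne_eq, not_false_eq_true, and_true]
      split_ifs
      · rw [piOp_of_symm hpair.symm_add]
      · rw [add_zero, piOp_zero]

/-! ### Flagged generating functions are key polynomials -/

theorem keyGen_congr {N : ℕ} {A : Finset ℕ} {L : List (Finset ℕ)} {φ ψ : ℕ → ℕ}
    (h : ∀ a ∈ A, φ a = ψ a) : keyGen N (A :: L) φ = keyGen N (A :: L) ψ := by
  simp only [keyGen]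
  refine Finset.sum_congr rfl fun S _ => ?_
  have : (∀ a ∈ A, S a ≤ φ a) ↔ ∀ a ∈ A, S a ≤ ψ a :=
    forall₂_congr fun a ha => by rw [h a ha]
  simp only [this]

theorem rankIn_le_of_column {N : ℕ} {A : Finset ℕ} {S φ : ℕ → ℕ} (hS : S ∈ columns N A)
    (hφ : MonotoneOn φ A) (h : ∀ a ∈ A, S a ≤ φ a) {a : ℕ} (ha : a ∈ A) : rankIn A a ≤ φ a := by
  rw [mem_columns] at hS
  refine rankIn_le_of_injOn hS.2.2 fun x hx hxa => ⟨?_, (h x hx).trans (hφ hx ha hxa)⟩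
  have := (hS.1 x).mpr hx
  omega

theorem keyGen_small {N : ℕ} {A : Finset ℕ} {L : List (Finset ℕ)} {φ : ℕ → ℕ}
    (hφ : MonotoneOn φ A) {a : ℕ} (ha : a ∈ A) (h : φ a < rankIn A a) :
    keyGen N (A :: L) φ = 0 := by
  simp only [keyGen]
  refine Finset.sum_eq_zero fun S hS => if_neg fun h' => ?_
  have := rankIn_le_of_column hS hφ h' ha
  omega

/-- The column with entries `1, 2, …`. -/
def rankCol (A : Finset ℕ) : ℕ → ℕ := fun r => if r ∈ A then rankIn A r else 0

theorem rankCol_of_mem {A : Finset ℕ} {r : ℕ} (h : r ∈ A) : rankCol A r = rankIn A r := if_pos h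

theorem rankCol_of_not_mem {A : Finset ℕ} {r : ℕ} (h : r ∉ A) : rankCol A r = 0 := if_neg h

theorem rankCol_mem {N : ℕ} {A : Finset ℕ} (hN : A.card ≤ N) : rankCol A ∈ columns N A := by
  rw [mem_columns]
  refine ⟨fun r => ?_, fun r => ?_, fun x hx y hy h => ?_⟩
  · by_cases h : r ∈ A
    · have := rankIn_pos h
      simp only [rankCol_of_mem h, h, iff_true]; omega
    · simp [rankCol_of_not_mem h, h]
  · unfold rankCol
    split_ifs
    · exact (rankIn_le_card A r).trans hN
    · exact Nat.zero_le _
  · rw [rankCol_of_mem (Finset.mem_coe.mp hx), rankCol_of_mem (Finset.mem_coe.mp hy)] at h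
    exact rankIn_injOn A hx hy h

theorem eq_rankCol {N : ℕ} {A : Finset ℕ} {S : ℕ → ℕ} (hS : S ∈ columns N A)
    (h : ∀ a ∈ A, S a ≤ rankIn A a) : S = rankCol A := by
  rw [mem_columns] at hS
  have key : ∀ a, a ∈ A → S a = rankIn A a := by
    intro a
    induction a using Nat.strong_induction_on with
    | _ a ih =>
      intro ha
      refine le_antisymm (h a ha) ?_
      by_contra hc
      have h0 := (hS.1 a).mpr ha
      obtain ⟨b, hb, e⟩ := exists_rankIn_eq (A := A) (v := S a) (by omega)
        (by have := rankIn_le_card A a; omega)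
      have hba : b < a := by
        by_contra h1
        have := rankIn_mono A (x := a) (y := b) (by omega)
        omega
      have := hS.2.2 (Finset.mem_coe.mpr hb) (Finset.mem_coe.mpr ha) ((ih b hba hb).trans e)
      omega
  funext r
  by_cases hr : r ∈ A
  · rw [rankCol_of_mem hr, key r hr]
  · rw [rankCol_of_not_mem hr]
    by_contra h0
    exact hr ((hS.1 r).mp h0)

theorem colMon_rankCol (A : Finset ℕ) : colMon A (rankCol A) = xExp (oneC A.card) := by
  rw [xExp_eq (N := A.card + 1) (fun i hi => by simp [oneC]; omega)]
  have e : colMon A (rankCol A) = ∏ v ∈ Finset.Icc 1 A.card, X v := by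
    rw [← image_rankIn, Finset.prod_image (fun x hx y hy => rankIn_injOn A hx hy)]
    exact Finset.prod_congr rfl fun r hr => by rw [rankCol_of_mem hr]
  rw [e, Finset.prod_range_succ']
  have h0 : oneC A.card 0 = 0 := by simp [oneC]
  rw [h0, pow_zero, mul_one, ← Finset.prod_image (s := Finset.range A.card) (g := fun i => i + 1)
    (f := fun i => (X i : MvPolynomial ℕ ℤ) ^ oneC A.card i) (fun x _ y _ h => by simpa using h)]
  refine Finset.prod_congr ?_ fun i hi => ?_
  · ext v
    simp only [Finset.mem_Icc, Finset.mem_image, Finset.mem_range]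
    constructor
    · intro h; exact ⟨v - 1, by omega, by omega⟩
    · rintro ⟨w, h1, h2⟩; omega
  · simp only [Finset.mem_image, Finset.mem_range] at hi
    obtain ⟨w, h1, h2⟩ := hi
    rw [oneC, if_pos (by omega), pow_one]

theorem compat_rankCol {N : ℕ} {A A' : Finset ℕ} (hA : A' ⊆ A) {S : ℕ → ℕ}
    (hS : S ∈ columns N A') : Compat (rankCol A) S ↔ ∀ a ∈ A', S a ≤ rankIn A a := by
  rw [mem_columns] at hS
  constructor
  · intro h a ha
    have := h.1 a
    rwa [rankCol_of_mem (hA ha)] at this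
  · intro h
    refine ⟨fun r => ?_, fun r k hrk h0 hlt => ?_⟩
    · by_cases hr : r ∈ A'
      · rw [rankCol_of_mem (hA hr)]; exact h r hr
      · have : S r = 0 := by by_contra h0; exact hr ((hS.1 r).mp h0)
        omega
    · exfalso
      have hk : k ∈ A := by by_contra hk; exact h0 (rankCol_of_not_mem hk)
      have hr : r ∈ A := by
        by_contra hr; rw [rankCol_of_not_mem hr] at hlt; omega
      rw [rankCol_of_mem hk, rankCol_of_mem hr] at hlt
      have := rankIn_lt hk hrk
      omega

theorem keyGen_rankIn {N : ℕ} {A : Finset ℕ} {L : List (Finset ℕ)} (hN : A.card ≤ N)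
    (hL : ∀ B ∈ L, B ⊆ A) :
    keyGen N (A :: L) (rankIn A) = xExp (oneC A.card) * keyGen N L (rankIn A) := by
  simp only [keyGen]
  rw [Finset.sum_eq_single (rankCol A)]
  · rw [if_pos (fun a ha => (rankCol_of_mem ha).le), colGen_eq, colMon_rankCol]
    congr 1
    cases L with
    | nil =>
      simp only [colTail, keyGen]
      refine if_pos ⟨fun r => Nat.zero_le _, fun r k hrk h0 hlt => ?_⟩
      exfalso
      have hk : k ∈ A := by by_contra hk; exact h0 (rankCol_of_not_mem hk)
      have hr : r ∈ A := by
        by_contra hr; rw [rankCol_of_not_mem hr] at hlt; omega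
      rw [rankCol_of_mem hk, rankCol_of_mem hr] at hlt
      have := rankIn_lt hk hrk
      omega
    | cons A' L =>
      simp only [colTail, keyGen]
      refine Finset.sum_congr rfl fun S hS => ?_
      simp only [compat_rankCol (hL A' (by simp)) hS]
  · intro S hS hne
    exact if_neg fun h => hne (eq_rankCol hS h)
  · intro h; exact absurd (rankCol_mem hN) h

theorem card_le_of_rankIn_le {A : Finset ℕ} {n : ℕ} (h : ∀ a ∈ A, rankIn A a ≤ n) :
    A.card ≤ n := by
  by_contra hc
  obtain ⟨a, ha, e⟩ := exists_rankIn_eq (A := A) (v := A.card) (by omega) le_rfl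
  have := h a ha
  omega

theorem keyGen_isKey {N : ℕ} : ∀ (L : List (Finset ℕ)) (φ : ℕ → ℕ) (n : ℕ) (A : Finset ℕ),
    L.Pairwise (fun A B => B ⊆ A) → (∀ B ∈ L, B ⊆ A) → MonotoneOn φ A → (∀ a ∈ A, φ a ≤ n) →
    n ≤ N → keyGen N L φ = 0 ∨ ∃ δ, (∀ i, n < i → δ i = 0) ∧ IsKey δ (keyGen N L φ)
  | [], φ, n, A, _, _, _, _, _ => by
    right
    refine ⟨fun _ => 0, fun _ _ => rfl, ?_⟩
    simp only [keyGen]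
    rw [← xExp_zero]
    exact IsKey.base _ (weakComp_of_bound (N := 0) rfl fun _ _ => rfl) fun _ _ => le_rfl
  | A :: L, φ, n, A0, hP, h0, hφ, hn, hN => by
    have hsub := h0 A (by simp)
    rw [List.pairwise_cons] at hP
    refine flag_induction A (fun φ => (∀ a ∈ A, φ a ≤ n) → keyGen N (A :: L) φ = 0 ∨
      ∃ δ, (∀ i, n < i → δ i = 0) ∧ IsKey δ (keyGen N (A :: L) φ)) ?_ ?_ ?_ ?_ φ
      (hφ.mono (Finset.coe_subset.mpr hsub)) (fun a ha => hn a (hsub ha))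
    · intro φ ψ h hφ hψ
      rw [← keyGen_congr h]
      exact hφ fun a ha => (h a ha).le.trans (hψ a ha)
    · intro φ a hφ ha h _
      exact Or.inl (keyGen_small hφ ha h)
    · intro hle
      have hcard := card_le_of_rankIn_le hle
      rw [keyGen_rankIn (hcard.trans hN) hP.1]
      rcases keyGen_isKey L (rankIn A) A.card A hP.2 hP.1 (rankIn_strictMonoOn A).monotoneOn
        (fun a _ => rankIn_le_card A a) (hcard.trans hN) with h | ⟨δ, h1, h2⟩
      · left; rw [h, mul_zero]
      · right
        refine ⟨_, fun i hi => ?_, h2.mul_oneC h1⟩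
        rw [h1 i (by omega), oneC, if_neg (by omega)]
    · intro φ i j hφ hi hj e hlow _ ih hle
      have hjn : j + 1 ≤ n := e ▸ hle i hi
      have := ih fun a ha => by
        by_cases e1 : a = i
        · subst e1; rw [Function.update_self]; omega
        · rw [Function.update_of_ne e1]; exact hle a ha
      rw [keyGen_step hj (hjn.trans hN) L hφ hi e hlow]
      rcases this with h | ⟨δ, h1, h2⟩
      · left; rw [h, piOp_zero]
      · right
        obtain ⟨γ, h3, h4⟩ := h2.exists_piOp hj
        refine ⟨γ, fun k hk => ?_, h4⟩
        rcases h3 with rfl | rfl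
        · exact h1 k hk
        · rw [swapC_of_ne _ (by omega) (by omega)]; exact h1 k hk

/-- The composition obtained by sending row `a` of the diagram to row `φ a`. -/
def pushC (φ : ℕ → ℕ) (L : List (Finset ℕ)) : ℕ → ℕ :=
  fun v => (L.map fun A => if ∃ a ∈ A, φ a = v then 1 else 0).sum

theorem pushC_cons (φ : ℕ → ℕ) (A : Finset ℕ) (L : List (Finset ℕ)) (v : ℕ) :
    pushC φ (A :: L) v = (if ∃ a ∈ A, φ a = v then 1 else 0) + pushC φ L v := by
  simp [pushC]

theorem pushC_eq_zero {φ : ℕ → ℕ} {L : List (Finset ℕ)} {v : ℕ}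
    (h : ∀ A ∈ L, ∀ a ∈ A, φ a ≠ v) : pushC φ L v = 0 := by
  unfold pushC
  apply List.sum_eq_zero
  intro x hx
  obtain ⟨A, hA, rfl⟩ := List.mem_map.mp hx
  exact if_neg fun ⟨a, ha, e⟩ => h A hA a ha e

theorem pushC_congr {φ ψ : ℕ → ℕ} {L : List (Finset ℕ)} {v w : ℕ}
    (h : ∀ A ∈ L, ∀ a ∈ A, (φ a = v ↔ ψ a = w)) : pushC φ L v = pushC ψ L w := by
  unfold pushC
  congr 1
  refine List.map_congr_left fun A hA => ?_
  have : (∃ a ∈ A, φ a = v) ↔ ∃ a ∈ A, ψ a = w :=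
    exists_congr fun a => and_congr_right fun ha => h A hA a ha
  simp only [this]

theorem keyGen_isKey_pushC {N : ℕ} : ∀ (L : List (Finset ℕ)) (φ : ℕ → ℕ) (A : Finset ℕ),
    L.Pairwise (fun A B => B ⊆ A) → (∀ B ∈ L, B ⊆ A) → StrictMonoOn φ A →
    (∀ a ∈ A, 1 ≤ φ a ∧ φ a ≤ N) → IsKey (pushC φ L) (keyGen N L φ)
  | [], φ, A, _, _, _, _ => by
    simp only [keyGen]
    rw [← xExp_zero]
    exact IsKey.base _ (weakComp_of_bound (N := 0) rfl fun _ _ => rfl) fun _ _ => le_rfl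
  | A :: L, φ, A0, hP, h0, hφ, hn => by
    have hsub := h0 A (by simp)
    rw [List.pairwise_cons] at hP
    have hall : ∀ B ∈ A :: L, B ⊆ A := by
      intro B hB
      rcases List.mem_cons.mp hB with rfl | hB
      · exact Finset.Subset.refl _
      · exact hP.1 B hB
    refine flag_induction A (fun φ => StrictMonoOn φ A → (∀ a ∈ A, 1 ≤ φ a ∧ φ a ≤ N) →
      IsKey (pushC φ (A :: L)) (keyGen N (A :: L) φ)) ?_ ?_ ?_ ?_ φ
      (hφ.monotoneOn.mono (Finset.coe_subset.mpr hsub)) (hφ.mono (Finset.coe_subset.mpr hsub))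
      (fun a ha => hn a (hsub ha))
    · intro φ ψ h hφ hψ hψ'
      have e : pushC ψ (A :: L) = pushC φ (A :: L) :=
        funext fun v => pushC_congr fun B hB a ha => by rw [h a (hall B hB ha)]
      rw [← keyGen_congr h, e]
      refine hφ (fun x hx y hy hxy => ?_) fun a ha => by rw [h a ha]; exact hψ' a ha
      rw [h x hx, h y hy]; exact hψ hx hy hxy
    · intro φ a hφ ha h hs h1
      exfalso
      have := rankIn_le_of_injOn (A := A) (a := a) (v := φ a) hs.injOn fun x hx hxa =>
        ⟨(h1 x hx).1, hφ hx ha hxa⟩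
      omega
    · intro hs hle
      have hcard := card_le_of_rankIn_le fun a ha => (hle a ha).2
      rw [keyGen_rankIn hcard hP.1]
      have ih := keyGen_isKey_pushC L (rankIn A) A hP.2 hP.1 hs hle
      have e : pushC (rankIn A) (A :: L) = fun i => pushC (rankIn A) L i + oneC A.card i := by
        funext v
        rw [pushC_cons, add_comm]
        congr 1
        unfold oneC
        have : (∃ a ∈ A, rankIn A a = v) ↔ 1 ≤ v ∧ v ≤ A.card := by
          constructor
          · rintro ⟨a, ha, rfl⟩; exact ⟨rankIn_pos ha, rankIn_le_card A a⟩
          · rintro ⟨h1, h2⟩; exact exists_rankIn_eq h1 h2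
        simp only [this]
      rw [e]
      refine ih.mul_oneC fun i hi => pushC_eq_zero fun B hB a ha e => ?_
      have := rankIn_le_card A a
      omega
    · intro φ i j hφ hi hj e hlow _ ih hs hle
      have hhigh : ∀ x ∈ A, i < x → j + 1 < φ x := fun x hx hix => e ▸ hs hi hx hix
      have hlow' : ∀ x ∈ A, x ≠ i → φ x < j ∨ j + 1 < φ x := fun x hx hne => by
        rcases Nat.lt_or_gt_of_ne hne with h | h
        · exact Or.inl (hlow x hx h)
        · exact Or.inr (hhigh x hx h)
      set ψ := Function.update φ i j with hψ
      have hψi : ψ i = j := Function.update_self ..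
      have hψne : ∀ x, x ≠ i → ψ x = φ x := fun x hx => Function.update_of_ne hx ..
      have hsψ : StrictMonoOn ψ A := by
        intro x hx y hy hxy
        by_cases e1 : x = i
        · subst e1
          rw [hψi, hψne y (by omega)]
          have := hhigh y hy hxy; omega
        · rw [hψne x e1]
          by_cases e2 : y = i
          · subst e2; rw [hψi]; exact hlow x hx hxy
          · rw [hψne y e2]; exact hs hx hy hxy
      have hkey := ih hsψ fun a ha => by
        by_cases e1 : a = i
        · subst e1; rw [hψi]; have := hle a ha; omega
        · rw [hψne a e1]; exact hle a ha
      rw [keyGen_step hj (e ▸ (hle i hi).2) L hφ hi e hlow]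
      have e1 : pushC φ (A :: L) = swapC (pushC ψ (A :: L)) j := by
        funext v
        rw [swapC_apply]
        refine pushC_congr fun B hB a ha => ?_
        have ha := hall B hB ha
        rw [← (sPerm j).injective.eq_iff (a := φ a)]
        have : sPerm j (φ a) = ψ a := by
          by_cases e1 : a = i
          · subst e1; rw [hψi, e, sPerm_right]
          · have := hlow' a ha e1
            rw [hψne a e1, sPerm_of_ne (by omega) (by omega)]
        rw [this]
      rw [e1]
      refine hkey.piOp_of_gt hj ?_
      have z : pushC ψ (A :: L) (j + 1) = 0 := pushC_eq_zero fun B hB a ha e2 => by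
        have ha := hall B hB ha
        by_cases e1 : a = i
        · subst e1; omega
        · rw [hψne a e1] at e2; have := hlow' a ha e1; omega
      rw [z, pushC_cons, if_pos ⟨i, hi, hψi⟩]
      omega

/-! ### Flagged key polynomials as generating functions of column sequences -/

theorem prod_X_eq_xExp {ι : Type*} (P : Finset ι) (t : ι → ℕ) (ht : ∀ p ∈ P, t p ≠ 0) :
    (∏ p ∈ P, X (t p) : MvPolynomial ℕ ℤ) =
      xExp (fun v => if v = 0 then 0 else (P.filter (fun p => t p = v)).card) := by
  set B := P.sup t + 1 with hB
  have hlt : ∀ p ∈ P, t p < B := fun p hp => Nat.lt_succ_of_le (Finset.le_sup hp)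
  rw [xExp_eq (N := B)]
  · rw [← Finset.prod_fiberwise_of_maps_to (s := P) (t := Finset.range B) (g := t)
      (fun p hp => Finset.mem_range.mpr (hlt p hp))]
    refine Finset.prod_congr rfl fun v _ => ?_
    rw [Finset.prod_congr rfl (g := fun _ => (X v : MvPolynomial ℕ ℤ))
      (fun p hp => by rw [(Finset.mem_filter.mp hp).2]), Finset.prod_const]
    by_cases hv : v = 0
    · have : P.filter (fun p => t p = v) = ∅ := by
        rw [Finset.filter_eq_empty_iff]; intro p hp; rw [hv]; exact ht p hp
      rw [if_pos hv, this, Finset.card_empty]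
    · rw [if_neg hv]
  · intro v hv
    split_ifs
    · rfl
    · rw [Finset.card_eq_zero, Finset.filter_eq_empty_iff]
      intro p hp
      have := hlt p hp
      omega

/-- Prepend a column to a sequence of columns. -/
def consSeq (S : ℕ → ℕ) (U : ℕ → ℕ → ℕ) : ℕ → ℕ → ℕ
  | 0 => S
  | c + 1 => U c

theorem consSeq_injective (S : ℕ → ℕ) : Function.Injective (consSeq S) := by
  intro U V h
  funext c
  exact congrFun h (c + 1)

/-- The sequences of columns that can follow the column `S` in a key tableau. -/
def tabSeq (N : ℕ) : List (Finset ℕ) → (ℕ → ℕ) → Finset (ℕ → ℕ → ℕ)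
  | [], S => if Compat S 0 then {0} else ∅
  | A :: L, S => ((columns N A).filter (Compat S)).biUnion fun S' =>
      (tabSeq N L S').image (consSeq S')

theorem mem_columns_empty {N : ℕ} {S : ℕ → ℕ} : S ∈ columns N ∅ ↔ S = 0 := by
  rw [mem_columns]
  constructor
  · rintro ⟨h, _⟩
    funext r
    by_contra h0
    simpa using (h r).mp h0
  · rintro rfl
    simp

theorem mem_tabSeq {N : ℕ} : ∀ {L : List (Finset ℕ)} {S : ℕ → ℕ} {U : ℕ → ℕ → ℕ},
    U ∈ tabSeq N L S ↔ Compat S (U 0) ∧ (∀ c, U c ∈ columns N (L.getD c ∅)) ∧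
      ∀ c, Compat (U c) (U (c + 1))
  | [], S, U => by
    simp only [tabSeq, List.getD_nil, mem_columns_empty]
    constructor
    · intro h
      split_ifs at h with hc
      · rw [Finset.mem_singleton] at h
        subst h
        exact ⟨hc, fun _ => rfl, fun _ => ⟨fun _ => le_rfl, fun _ _ _ h => absurd rfl h⟩⟩
      · simp at h
    · rintro ⟨h1, h2, _⟩
      have : U = 0 := funext h2
      subst this
      have h1 : Compat S 0 := h1
      simp [h1]
  | A :: L, S, U => by
    simp only [tabSeq, Finset.mem_biUnion, Finset.mem_filter, Finset.mem_image]
    constructor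
    · rintro ⟨S', ⟨h1, h2⟩, V, hV, rfl⟩
      rw [mem_tabSeq] at hV
      obtain ⟨a, b, d⟩ := hV
      refine ⟨h2, fun c => ?_, fun c => ?_⟩
      · cases c with
        | zero => exact h1
        | succ c => exact b c
      · cases c with
        | zero => exact a
        | succ c => exact d c
    · rintro ⟨a, b, d⟩
      refine ⟨U 0, ⟨b 0, a⟩, fun c => U (c + 1), ?_, ?_⟩
      · rw [mem_tabSeq]
        exact ⟨d 0, fun c => b (c + 1), fun c => d (c + 1)⟩
      · funext c
        cases c <;> rfl

/-- The monomial of a sequence of columns. -/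
def seqMon : List (Finset ℕ) → (ℕ → ℕ → ℕ) → MvPolynomial ℕ ℤ
  | [], _ => 1
  | A :: L, U => colMon A (U 0) * seqMon L (fun c => U (c + 1))

theorem sum_image_consSeq {s : Finset (ℕ → ℕ)} {t : (ℕ → ℕ) → Finset (ℕ → ℕ → ℕ)}
    (f : (ℕ → ℕ → ℕ) → MvPolynomial ℕ ℤ) :
    ∑ U ∈ s.biUnion (fun S => (t S).image (consSeq S)), f U =
      ∑ S ∈ s, ∑ U ∈ t S, f (consSeq S U) := by
  rw [Finset.sum_biUnion]
  · exact Finset.sum_congr rfl fun S _ =>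
      Finset.sum_image fun U _ V _ h => consSeq_injective S h
  · intro S _ S' _ hne
    rw [Function.onFun, Finset.disjoint_left]
    intro U h1 h2
    obtain ⟨V, _, rfl⟩ := Finset.mem_image.mp h1
    obtain ⟨V', _, e⟩ := Finset.mem_image.mp h2
    exact hne (congrFun e 0).symm

theorem colTail_eq_sum {N : ℕ} : ∀ (L : List (Finset ℕ)) (S : ℕ → ℕ),
    colTail N L S = ∑ U ∈ tabSeq N L S, seqMon L U
  | [], S => by
    simp only [colTail, tabSeq]
    split_ifs <;> simp [seqMon]
  | A :: L, S => by
    simp only [colTail, tabSeq]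
    rw [sum_image_consSeq, Finset.sum_filter]
    refine Finset.sum_congr rfl fun S' _ => ?_
    rw [colGen_eq, colTail_eq_sum L S', Finset.mul_sum]
    rfl

/-- The column sequences of flagged key tableaux. -/
def fullSeq (N : ℕ) (A : Finset ℕ) (L : List (Finset ℕ)) (φ : ℕ → ℕ) : Finset (ℕ → ℕ → ℕ) :=
  ((columns N A).filter (fun S => ∀ a ∈ A, S a ≤ φ a)).biUnion fun S =>
    (tabSeq N L S).image (consSeq S)

theorem mem_fullSeq {N : ℕ} {A : Finset ℕ} {L : List (Finset ℕ)} {φ : ℕ → ℕ} {U : ℕ → ℕ → ℕ} :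
    U ∈ fullSeq N A L φ ↔ (∀ a ∈ A, U 0 a ≤ φ a) ∧
      (∀ c, U c ∈ columns N ((A :: L).getD c ∅)) ∧ ∀ c, Compat (U c) (U (c + 1)) := by
  simp only [fullSeq, Finset.mem_biUnion, Finset.mem_filter, Finset.mem_image]
  constructor
  · rintro ⟨S, ⟨h1, h2⟩, V, hV, rfl⟩
    rw [mem_tabSeq] at hV
    obtain ⟨a, b, d⟩ := hV
    refine ⟨h2, fun c => ?_, fun c => ?_⟩
    · cases c with
      | zero => exact h1
      | succ c => exact b c
    · cases c with
      | zero => exact a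
      | succ c => exact d c
  · rintro ⟨a, b, d⟩
    refine ⟨U 0, ⟨b 0, a⟩, fun c => U (c + 1), ?_, ?_⟩
    · rw [mem_tabSeq]
      exact ⟨d 0, fun c => b (c + 1), fun c => d (c + 1)⟩
    · funext c
      cases c <;> rfl

theorem keyGen_eq_sum (N : ℕ) (A : Finset ℕ) (L : List (Finset ℕ)) (φ : ℕ → ℕ) :
    keyGen N (A :: L) φ = ∑ U ∈ fullSeq N A L φ, seqMon (A :: L) U := by
  simp only [keyGen, fullSeq]
  rw [sum_image_consSeq, Finset.sum_filter]
  refine Finset.sum_congr rfl fun S' _ => ?_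
  rw [colGen_eq, colTail_eq_sum, Finset.mul_sum]
  rfl

theorem seqMon_eq_prod : ∀ (L : List (Finset ℕ)) (U : ℕ → ℕ → ℕ),
    seqMon L U = ∏ c ∈ Finset.range L.length, colMon (L.getD c ∅) (U c)
  | [], U => by simp [seqMon]
  | A :: L, U => by
    rw [List.length_cons, Finset.prod_range_succ', seqMon, seqMon_eq_prod L, mul_comm]
    rfl

/-- The rows of the boxes in the columns of a diagram, with rows below `B` and at most `M`
columns. -/
def levels (B M : ℕ) (β : ℕ → ℕ) : List (Finset ℕ) :=
  (List.range M).map fun c => (Finset.range B).filter fun r => c + 1 ≤ β r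

theorem length_levels (B M : ℕ) (β : ℕ → ℕ) : (levels B M β).length = M := by simp [levels]

theorem mem_levels_getD {B M : ℕ} {β : ℕ → ℕ} (hB : ∀ r, B ≤ r → β r = 0) (hM : ∀ r, β r ≤ M)
    {c r : ℕ} : r ∈ (levels B M β).getD c ∅ ↔ c + 1 ≤ β r := by
  unfold levels
  by_cases hc : c < M
  · have : ((List.range M).map fun c => (Finset.range B).filter fun r => c + 1 ≤ β r).getD c ∅ =
        (Finset.range B).filter fun r => c + 1 ≤ β r := by
      simp [List.getD, hc]
    rw [this, Finset.mem_filter, Finset.mem_range]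
    constructor
    · exact fun h => h.2
    · intro h
      refine ⟨?_, h⟩
      by_contra h1
      have := hB r (by omega); omega
  · have : ((List.range M).map fun c => (Finset.range B).filter fun r => c + 1 ≤ β r).getD c ∅ =
        ∅ := by
      simp [List.getD, hc]
    rw [this]
    have := hM r
    simp; omega

theorem levels_pairwise (B M : ℕ) (β : ℕ → ℕ) :
    (levels B M β).Pairwise (fun A A' => A' ⊆ A) := by
  unfold levels
  rw [List.pairwise_map]
  refine List.pairwise_lt_range.imp fun {c c'} h r hr => ?_
  rw [Finset.mem_filter] at hr ⊢
  exact ⟨hr.1, by omega⟩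

theorem levels_cons (B M : ℕ) (β : ℕ → ℕ) : ∃ A L, levels B (M + 1) β = A :: L := by
  rcases h : levels B (M + 1) β with _ | ⟨A, L⟩
  · have := length_levels B (M + 1) β
    rw [h] at this
    simp at this
  · exact ⟨A, L, rfl⟩

/-- In a tableau of shape `α`, the row `i` has its boxes in the columns `1, …, α i`. -/
theorem tableau_ne_zero_iff {T : Tableau} (hT : IsKeyTableau T) (i c : ℕ) :
    T (i : ℤ) (c + 1) ≠ 0 ↔ c + 1 ≤ shapeOf T i := by
  obtain ⟨_, h0, hfin, hleft, _⟩ := hT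
  have hf : {c : ℕ | T (i : ℤ) c ≠ 0}.Finite := by
    have := hfin.preimage (f := fun c : ℕ => ((i : ℤ), c)) (fun x _ y _ h => by simpa using h)
    exact this
  have hdown : ∀ d c, 1 ≤ c → T (i : ℤ) (c + d) ≠ 0 → T (i : ℤ) c ≠ 0 := by
    intro d
    induction d with
    | zero => intro c _ h; exact h
    | succ d ih => intro c hc h; exact ih c hc (hleft _ _ (by omega) h)
  unfold shapeOf
  constructor
  · intro h
    have : Set.Icc 1 (c + 1) ⊆ {c : ℕ | T (i : ℤ) c ≠ 0} := by
      intro d hd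
      rw [Set.mem_Icc] at hd
      obtain ⟨e, he⟩ := Nat.exists_eq_add_of_le hd.2
      exact hdown e d hd.1 (by rwa [← he])
    have h2 := Set.ncard_le_ncard this hf
    rw [← Finset.coe_Icc, Set.ncard_coe_finset, Nat.card_Icc] at h2
    omega
  · intro h hc
    have : {c : ℕ | T (i : ℤ) c ≠ 0} ⊆ Set.Icc 1 c := by
      intro d hd
      have hd : T (i : ℤ) d ≠ 0 := hd
      rw [Set.mem_Icc]
      constructor
      · by_contra h1
        have : d = 0 := by omega
        subst this
        exact hd (h0 _)
      · by_contra h1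
        obtain ⟨e, he⟩ := Nat.exists_eq_add_of_le (show c + 1 ≤ d by omega)
        exact hdown e (c + 1) (by omega) (he ▸ hd) hc
    have h2 := Set.ncard_le_ncard this (Set.finite_Icc 1 c)
    rw [← Finset.coe_Icc, Set.ncard_coe_finset, Nat.card_Icc] at h2
    omega

/-- The columns of a tableau. -/
def tabCols (T : Tableau) : ℕ → ℕ → ℕ := fun c r => T (r : ℤ) (c + 1)

/-- The tableau with given columns. -/
def colsTab (U : ℕ → ℕ → ℕ) : Tableau := fun r c =>
  if r ≤ 0 ∨ c = 0 then 0 else U (c - 1) r.toNat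

theorem colsTab_succ (U : ℕ → ℕ → ℕ) {i : ℕ} (hi : 1 ≤ i) (c : ℕ) :
    colsTab U (i : ℤ) (c + 1) = U c i := by
  have : ¬ ((i : ℤ) ≤ 0 ∨ c + 1 = 0) := by omega
  simp [colsTab, this]
  omega

theorem tableau_row_le {T : Tableau} (hT : IsKeyTableau T) (r : ℤ) (c : ℕ) :
    T r (c + 1 + 1) ≤ T r (c + 1) := by
  by_cases h : T r (c + 1 + 1) = 0
  · omega
  · exact hT.2.2.2.2.1 r (c + 1) (by omega) h

theorem flaggedKeyPoly_eq {β φ : ℕ → ℕ} {B M N : ℕ} (h0 : β 0 = 0) (hB : ∀ r, B ≤ r → β r = 0)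
    (hM : ∀ r, β r ≤ M) (hN : ∀ r, β r ≠ 0 → φ r ≤ N) :
    flaggedKeyPoly β φ = keyGen N (levels B (M + 1) β) φ := by
  obtain ⟨A, L, hAL⟩ := levels_cons B M β
  have hlev : ∀ c r, r ∈ (A :: L).getD c ∅ ↔ c + 1 ≤ β r := fun c r => by
    rw [← hAL, mem_levels_getD hB (fun r => (hM r).trans (Nat.le_succ M))]
  have hlen : (A :: L).length = M + 1 := by rw [← hAL, length_levels]
  have hA : ∀ r, r ∈ A ↔ 1 ≤ β r := fun r => hlev 0 r
  rw [hAL, keyGen_eq_sum, flaggedKeyPoly, ← finsum_mem_coe_finset]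
  have hcols : ∀ T ∈ SSKT β φ, ∀ c r, (tabCols T c r ≠ 0 ↔ r ∈ (A :: L).getD c ∅) := by
    rintro T ⟨hT, hs, _⟩ c r
    rw [hlev, ← hs]
    exact tableau_ne_zero_iff hT r c
  refine finsum_mem_eq_of_bijOn tabCols ⟨?_, ?_, ?_⟩ ?_
  · intro T hTT
    have hc := hcols T hTT
    obtain ⟨hT, hs, hf⟩ := hTT
    rw [Finset.mem_coe, mem_fullSeq]
    have hle : ∀ c r, tabCols T c r ≤ N := by
      intro c r
      by_cases h : tabCols T c r = 0
      · omega
      · have h1 := (hlev c r).mp ((hc c r).mp h)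
        exact (hf r (c + 1)).trans (hN r (by omega))
    refine ⟨fun a _ => hf a 1, fun c => ?_, fun c => ⟨fun r => tableau_row_le hT r c,
      fun r k hrk hk hlt => ?_⟩⟩
    · rw [mem_columns]
      refine ⟨hc c, hle c, fun x hx y hy hxy => ?_⟩
      have h1 := (hc c x).mpr hx
      have h2 := (hc c y).mpr hy
      by_contra hne
      exact hT.2.2.2.2.2.1 x y (c + 1) (by exact_mod_cast hne) h1 h2 hxy
    · have hr : tabCols T c r ≠ 0 := by omega
      exact (hT.2.2.2.2.2.2 r k (c + 1) (by exact_mod_cast hrk) hr hk hlt).2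
  · intro T hT T' hT' h
    obtain ⟨hT, _⟩ := hT
    obtain ⟨hT', _⟩ := hT'
    funext r c
    by_cases hr : r ≤ 0
    · rw [hT.1 r c hr, hT'.1 r c hr]
    · cases c with
      | zero => rw [hT.2.1 r, hT'.2.1 r]
      | succ c =>
        have := congrFun (congrFun h c) r.toNat
        unfold tabCols at this
        rwa [Int.toNat_of_nonneg (by omega)] at this
  · intro U hU
    rw [Finset.mem_coe, mem_fullSeq] at hU
    obtain ⟨hfl, hcol, hcomp⟩ := hU
    simp only [mem_columns, hlev] at hcol
    have hzero : ∀ c, U c 0 = 0 := fun c => by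
      by_contra h
      have := ((hcol c).1 0).mp h
      omega
    have hval : ∀ i c : ℕ, colsTab U (i : ℤ) (c + 1) = U c i := by
      intro i c
      rcases Nat.eq_zero_or_pos i with rfl | hi
      · rw [hzero]; simp [colsTab]
      · exact colsTab_succ U hi c
    have hneg : ∀ (r : ℤ) (c : ℕ), r ≤ 0 → colsTab U r c = 0 := fun r c h => by
      simp [colsTab, h]
    have hc0 : ∀ r : ℤ, colsTab U r 0 = 0 := fun r => by simp [colsTab]
    have hex : ∀ (r : ℤ) (c : ℕ), colsTab U r c ≠ 0 →
        ∃ i d : ℕ, (i : ℤ) = r ∧ d + 1 = c ∧ d + 1 ≤ β i := by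
      intro r c h
      have h1 : ¬ r ≤ 0 := fun h1 => h (hneg r c h1)
      have h2 : c ≠ 0 := fun h2 => h (h2 ▸ hc0 r)
      refine ⟨r.toNat, c - 1, by omega, by omega, ?_⟩
      rw [← (hcol (c - 1)).1, ← hval, Int.toNat_of_nonneg (by omega), Nat.sub_add_cancel (by omega)]
      exact h
    have hkey : IsKeyTableau (colsTab U) := by
      refine ⟨hneg, hc0, ?_, ?_, ?_, ?_, ?_⟩
      · refine (((Finset.range B) ×ˢ (Finset.range (M + 1))).image
          (fun p : ℕ × ℕ => ((p.1 : ℤ), p.2))).finite_toSet.subset ?_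
        rintro ⟨r, c⟩ h
        obtain ⟨i, d, rfl, rfl, hd⟩ := hex r c h
        simp only [Finset.coe_image, Set.mem_image, Finset.mem_coe, Finset.mem_product,
          Finset.mem_range]
        refine ⟨(i, d + 1), ⟨?_, ?_⟩, rfl⟩
        · by_contra hb
          have := hB i (by simpa using hb); omega
        · have := hM i
          simp only; omega
      · intro r c hc h
        obtain ⟨i, d, rfl, hd, _⟩ := hex r (c + 1) h
        obtain ⟨c', rfl⟩ := Nat.exists_eq_add_of_le' hc
        rw [hval] at h ⊢
        have := (hcomp c').1 i
        omega
      · intro r c hc h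
        obtain ⟨i, d, rfl, hd, _⟩ := hex r (c + 1) h
        obtain ⟨c', rfl⟩ := Nat.exists_eq_add_of_le' hc
        rw [hval, hval]
        exact (hcomp c').1 i
      · intro r r' c hne h h' he
        obtain ⟨i, d, rfl, rfl, h1⟩ := hex r c h
        obtain ⟨i', d', rfl, hd', h2⟩ := hex r' (d + 1) h'
        have : d' = d := by omega
        subst this
        rw [hval, hval] at he
        exact hne (by exact_mod_cast (hcol d').2.2 ((hlev _ _).mpr h1) ((hlev _ _).mpr h2) he)
      · intro r r' c hlt h h' hv
        obtain ⟨i, d, rfl, rfl, h1⟩ := hex r c h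
        obtain ⟨i', d', rfl, hd', h2⟩ := hex r' (d + 1) h'
        have : d' = d := by omega
        subst this
        rw [hval] at h' 
        rw [hval, hval] at hv
        rw [hval, hval]
        have := (hcomp d').2 i i' (by exact_mod_cast hlt) h' hv
        omega
    refine ⟨colsTab U, ⟨hkey, ?_, ?_⟩, ?_⟩
    · funext i
      have key : ∀ c : ℕ, c + 1 ≤ shapeOf (colsTab U) i ↔ c + 1 ≤ β i := fun c => by
        rw [← tableau_ne_zero_iff hkey, hval]; exact (hcol c).1 i
      have k1 := key (shapeOf (colsTab U) i - 1)
      have k2 := key (β i - 1)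
      omega
    · intro i c
      cases c with
      | zero => rw [hc0]; exact Nat.zero_le _
      | succ c =>
        rw [hval]
        have hdec : U c i ≤ U 0 i := by
          induction c with
          | zero => exact le_rfl
          | succ c ih => exact ((hcomp c).1 i).trans ih
        by_cases h : U 0 i = 0
        · omega
        · have := ((hcol 0).1 i).mp h
          exact hdec.trans (hfl i ((hA i).mpr (by omega)))
    · funext c i
      exact hval i c
  · intro T hTT
    have hc := hcols T hTT
    obtain ⟨hT, hs, _⟩ := hTT
    rw [seqMon_eq_prod, hlen]
    unfold colMon
    rw [Finset.prod_sigma', prod_X_eq_xExp]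
    · congr 1
      funext v
      unfold wtTab
      by_cases hv : v = 0
      · rw [if_pos hv, if_pos hv]
      rw [if_neg hv, if_neg hv, ← Set.ncard_coe_finset]
      symm
      refine Set.ncard_congr (fun p _ => ((p.2 : ℤ), p.1 + 1)) ?_ ?_ ?_
      · rintro ⟨c, r⟩ h
        simp only [Finset.coe_filter, Set.mem_setOf_eq] at h
        exact h.2
      · rintro ⟨c, r⟩ ⟨c', r'⟩ _ _ h
        simp only [Prod.mk.injEq, Nat.cast_inj, add_left_inj] at h
        obtain ⟨rfl, rfl⟩ := h
        rfl
      · rintro ⟨r, c⟩ h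
        have h : T r c = v := h
        have hr : ¬ r ≤ 0 := fun hr => hv (by rw [← h, hT.1 r c hr])
        have hc1 : c ≠ 0 := by rintro rfl; exact hv (by rw [← h, hT.2.1 r])
        have e : tabCols T (c - 1) r.toNat = v := by
          unfold tabCols
          rw [Int.toNat_of_nonneg (by omega), Nat.sub_add_cancel (by omega), h]
        have hm := (hc (c - 1) r.toNat).mp (by rw [e]; exact hv)
        refine ⟨⟨c - 1, r.toNat⟩, ?_, ?_⟩
        · simp only [Finset.coe_filter, Set.mem_setOf_eq, Finset.mem_sigma, Finset.mem_range]
          refine ⟨⟨?_, hm⟩, e⟩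
          rw [hlev] at hm
          have := hM r.toNat
          omega
        · simp only [Prod.mk.injEq]
          omega
    · rintro ⟨c, r⟩ h
      simp only [Finset.mem_sigma] at h
      exact (hc c r).mpr h.2

/-! ### Properties of flagged key polynomials -/

theorem xExp_eq_monomial_of_coe {β : ℕ → ℕ} (h : WeakComp β) {d : ℕ →₀ ℕ} (hd : ∀ i, d i = β i) :
    xExp β = monomial d 1 := by
  obtain ⟨N, hN⟩ := h.exists_bound
  rw [xExp_eq_monomial hN]
  congr 2
  ext i
  rw [hd, Finsupp.finset_sum_apply]
  simp only [Finsupp.single_apply]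
  by_cases hi : i < N
  · simp [hi]
  · rw [hN i (by omega)]
    refine Finset.sum_eq_zero fun x hx => ?_
    have := Finset.mem_range.mp hx
    rw [if_neg (by omega)]

/-- Data presenting a flagged key polynomial as a generating function of column sequences. -/
theorem flaggedKeyPoly_levels {β : ℕ → ℕ} (hβ : WeakComp β) (K : ℕ) :
    ∃ (N : ℕ) (A : Finset ℕ) (L : List (Finset ℕ)), K ≤ N ∧
      (∀ c r, r ∈ (A :: L).getD c ∅ ↔ c + 1 ≤ β r) ∧
      (A :: L).Pairwise (fun A B => B ⊆ A) ∧ (∀ r, β r ≤ (A :: L).length) ∧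
      ∀ φ : ℕ → ℕ, (∀ a ∈ A, φ a ≤ K) → flaggedKeyPoly β φ = keyGen N (A :: L) φ := by
  obtain ⟨B, hB⟩ := hβ.exists_bound
  obtain ⟨M, hM⟩ : ∃ M, ∀ r, β r ≤ M := by
    refine ⟨∑ i ∈ Finset.range B, β i, fun r => ?_⟩
    by_cases h : r < B
    · exact Finset.single_le_sum (f := β) (fun _ _ => Nat.zero_le _) (Finset.mem_range.mpr h)
    · rw [hB r (by omega)]; exact Nat.zero_le _
  obtain ⟨A, L, hAL⟩ := levels_cons B M β
  have hlev : ∀ c r, r ∈ (A :: L).getD c ∅ ↔ c + 1 ≤ β r := fun c r => by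
    rw [← hAL, mem_levels_getD hB (fun r => (hM r).trans (Nat.le_succ M))]
  refine ⟨K, A, L, le_rfl, hlev, hAL ▸ levels_pairwise B (M + 1) β, fun r => ?_, fun φ hφ => ?_⟩
  · rw [← hAL, length_levels]; exact (hM r).trans (Nat.le_succ M)
  · rw [flaggedKeyPoly_eq hβ.1 hB hM (fun r hr => hφ r ((hlev 0 r).mpr (by omega))), hAL]

theorem exists_bound_on (A : Finset ℕ) (φ : ℕ → ℕ) : ∃ K, ∀ a ∈ A, φ a ≤ K :=
  ⟨∑ a ∈ A, φ a, fun _ ha => Finset.single_le_sum (f := φ) (fun _ _ => Nat.zero_le _) ha⟩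

/-- The finite set of rows of a weak composition. -/
def rowsOf (β : ℕ → ℕ) (A : Finset ℕ) : Prop := ∀ r, r ∈ A ↔ 1 ≤ β r

theorem rowsOf.bound {β : ℕ → ℕ} {A A' : Finset ℕ} (h : rowsOf β A)
    {L : List (Finset ℕ)} (h' : ∀ c r, r ∈ (A' :: L).getD c ∅ ↔ c + 1 ≤ β r) : A' = A := by
  ext r
  rw [h r]
  exact h' 0 r

theorem flaggedKeyPoly_congr {β φ ψ : ℕ → ℕ} {A : Finset ℕ} (hβ : WeakComp β) (hA : rowsOf β A)
    (h : ∀ a ∈ A, φ a = ψ a) : flaggedKeyPoly β φ = flaggedKeyPoly β ψ := by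
  obtain ⟨K, hK⟩ := exists_bound_on A φ
  obtain ⟨N, A', L, _, h1, _, _, h3⟩ := flaggedKeyPoly_levels hβ K
  obtain rfl := hA.bound h1
  rw [h3 φ hK, h3 ψ fun a ha => h a ha ▸ hK a ha, keyGen_congr h]

theorem flaggedKeyPoly_small {β φ : ℕ → ℕ} {A : Finset ℕ} (hβ : WeakComp β) (hA : rowsOf β A)
    (hφ : MonotoneOn φ A) {a : ℕ} (ha : a ∈ A) (h : φ a < rankIn A a) :
    flaggedKeyPoly β φ = 0 := by
  obtain ⟨K, hK⟩ := exists_bound_on A φ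
  obtain ⟨N, A', L, _, h1, _, _, h3⟩ := flaggedKeyPoly_levels hβ K
  obtain rfl := hA.bound h1
  rw [h3 φ hK, keyGen_small hφ ha h]

theorem flaggedKeyPoly_step {β φ : ℕ → ℕ} {A : Finset ℕ} {i j : ℕ} (hβ : WeakComp β)
    (hA : rowsOf β A) (hφ : MonotoneOn φ A) (hj : 1 ≤ j) (hi : i ∈ A) (hφi : φ i = j + 1)
    (hlow : ∀ x ∈ A, x < i → φ x < j) :
    flaggedKeyPoly β φ = piOp j (flaggedKeyPoly β (Function.update φ i j)) := by
  obtain ⟨K, hK⟩ := exists_bound_on A φ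
  obtain ⟨N, A', L, hN, h1, _, _, h3⟩ := flaggedKeyPoly_levels hβ K
  obtain rfl := hA.bound h1
  rw [h3 φ hK, keyGen_step hj (hφi ▸ (hK i hi).trans hN) L hφ hi hφi hlow, h3]
  intro a ha
  by_cases e : a = i
  · subst e; rw [Function.update_self]; have := hK a ha; omega
  · rw [Function.update_of_ne e]; exact hK a ha

theorem flaggedKeyPoly_isKey {β φ : ℕ → ℕ} {A : Finset ℕ} {n : ℕ} (hβ : WeakComp β)
    (hA : rowsOf β A) (hφ : MonotoneOn φ A) (hn : ∀ a ∈ A, φ a ≤ n) :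
    flaggedKeyPoly β φ = 0 ∨ ∃ δ, (∀ i, n < i → δ i = 0) ∧ IsKey δ (flaggedKeyPoly β φ) := by
  obtain ⟨N, A', L, hN, h1, h2, _, h3⟩ := flaggedKeyPoly_levels hβ n
  obtain rfl := hA.bound h1
  rw [h3 φ hn]
  refine keyGen_isKey _ φ n A' h2 ?_ hφ hn hN
  intro B hB
  rcases List.mem_cons.mp hB with rfl | hB
  · exact Finset.Subset.refl _
  · exact (List.pairwise_cons.mp h2).1 B hB

theorem pushC_levels {φ β : ℕ → ℕ} (v : ℕ) : ∀ (L : List (Finset ℕ)) (k a : ℕ),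
    (∀ c r, r ∈ L.getD c ∅ ↔ c + 1 + k ≤ β r) → (∀ r, β r ≤ L.length + k) →
    (∀ r, k < β r → (φ r = v ↔ r = a)) → pushC φ L v = β a - k
  | [], k, a, _, h2, _ => by
    have := h2 a
    simp [pushC] at this ⊢
    omega
  | A :: L, k, a, h1, h2, h3 => by
    rw [pushC_cons, pushC_levels (β := β) v L (k + 1) a]
    · have h4 := h1 0 a
      simp only [List.getD_cons_zero] at h4
      have : (∃ r ∈ A, φ r = v) ↔ 1 + k ≤ β a := by
        rw [← Nat.zero_add 1, ← h4]
        constructor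
        · rintro ⟨r, hr, e⟩
          have : 0 + 1 + k ≤ β r := (h1 0 r).mp hr
          rw [← (h3 r (by omega)).mp e]; exact hr
        · intro ha
          refine ⟨a, ha, (h3 a ?_).mpr rfl⟩
          have := h4.mp ha; omega
      simp only [this]
      split_ifs <;> omega
    · intro c r
      have := h1 (c + 1) r
      simp only [List.getD_cons_succ] at this
      rw [this]; omega
    · intro r; have := h2 r; simp at this; omega
    · intro r hr; exact h3 r (by omega)

theorem flaggedKeyPoly_isKey_of_strictMono {β φ γ : ℕ → ℕ} {A : Finset ℕ} (hβ : WeakComp β)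
    (hA : rowsOf β A) (hφ : StrictMonoOn φ A) (h1 : ∀ a ∈ A, 1 ≤ φ a)
    (hγ : ∀ a ∈ A, γ (φ a) = β a) (hγ' : ∀ v, (∀ a ∈ A, φ a ≠ v) → γ v = 0) :
    IsKey γ (flaggedKeyPoly β φ) := by
  obtain ⟨K, hK⟩ := exists_bound_on A φ
  obtain ⟨N, A', L, hN, h2, h3, h4, h5⟩ := flaggedKeyPoly_levels hβ K
  obtain rfl := hA.bound h2
  have hall : ∀ B ∈ A' :: L, B ⊆ A' := by
    intro B hB
    rcases List.mem_cons.mp hB with rfl | hB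
    · exact Finset.Subset.refl _
    · exact (List.pairwise_cons.mp h3).1 B hB
  rw [h5 φ hK]
  have e : γ = pushC φ (A' :: L) := by
    funext v
    by_cases hv : ∃ a ∈ A', φ a = v
    · obtain ⟨a, ha, rfl⟩ := hv
      rw [hγ a ha, pushC_levels (β := β) (φ a) (A' :: L) 0 a]
      · rfl
      · intro c r; rw [h2]
      · intro r; exact h4 r
      · intro r hr
        exact ⟨fun e => hφ.injOn ((hA r).mpr hr) ha e, fun e => by rw [e]⟩
    · push Not at hv
      rw [hγ' v hv, pushC_eq_zero]
      intro B hB a ha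
      exact hv a (hall B hB ha)
  rw [e]
  exact keyGen_isKey_pushC _ φ A' h3 hall hφ fun a ha => ⟨h1 a ha, (hK a ha).trans hN⟩

/-- The exponent of the monomial of a sequence of columns. -/
def seqWt (L : List (Finset ℕ)) (U : ℕ → ℕ → ℕ) : ℕ →₀ ℕ :=
  ∑ c ∈ Finset.range L.length, ∑ r ∈ L.getD c ∅, Finsupp.single (U c r) 1

theorem seqMon_eq_monomial (L : List (Finset ℕ)) (U : ℕ → ℕ → ℕ) :
    seqMon L U = monomial (seqWt L U) 1 := by
  rw [seqMon_eq_prod, seqWt, monomial_sum_one]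
  refine Finset.prod_congr rfl fun c _ => ?_
  rw [monomial_sum_one]
  exact Finset.prod_congr rfl fun r _ => by rw [← X_pow_eq_monomial, pow_one]

theorem sum_seqWt (L : List (Finset ℕ)) (U : ℕ → ℕ → ℕ) (I : Finset ℕ) (g : ℕ → ℕ) :
    ∑ i ∈ I, g i * seqWt L U i =
      ∑ c ∈ Finset.range L.length, ∑ r ∈ L.getD c ∅, if U c r ∈ I then g (U c r) else 0 := by
  simp only [seqWt, Finsupp.finset_sum_apply, Finset.mul_sum]
  rw [Finset.sum_comm]
  refine Finset.sum_congr rfl fun c _ => ?_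
  rw [Finset.sum_comm]
  refine Finset.sum_congr rfl fun r _ => ?_
  simp only [Finsupp.single_apply, mul_ite, mul_one, mul_zero]
  rw [Finset.sum_ite_eq]

/-- The column sequence of the key tableau whose row `r` is constant equal to `r`. -/
def idSeq (β : ℕ → ℕ) : ℕ → ℕ → ℕ := fun c r => if c + 1 ≤ β r then r else 0

theorem idSeq_mem {β φ : ℕ → ℕ} {A : Finset ℕ} {L : List (Finset ℕ)} {N : ℕ} (h0 : β 0 = 0)
    (hL : ∀ c r, r ∈ (A :: L).getD c ∅ ↔ c + 1 ≤ β r) (hN : ∀ a ∈ A, a ≤ N)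
    (hφ : ∀ a ∈ A, a ≤ φ a) : idSeq β ∈ fullSeq N A L φ := by
  rw [mem_fullSeq]
  have hz : ∀ c r, idSeq β c r ≠ 0 ↔ c + 1 ≤ β r := by
    intro c r
    unfold idSeq
    split_ifs with h
    · have : r ≠ 0 := by rintro rfl; omega
      simp [h, this]
    · simp [h]
  refine ⟨fun a ha => ?_, fun c => ?_, fun c => ⟨fun r => ?_, fun r k hrk hk hlt => ?_⟩⟩
  · unfold idSeq
    split_ifs
    · exact hφ a ha
    · exact Nat.zero_le _
  · rw [mem_columns]
    refine ⟨fun r => ?_, fun r => ?_, fun x hx y hy hxy => ?_⟩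
    · rw [hz, hL]
    · unfold idSeq
      split_ifs with h
      · exact hN r ((hL 0 r).mpr (by omega))
      · exact Nat.zero_le _
    · have h1 := (hL c x).mp hx
      have h2 := (hL c y).mp hy
      unfold idSeq at hxy
      rwa [if_pos h1, if_pos h2] at hxy
  · unfold idSeq
    split_ifs <;> omega
  · have h1 := (hz c k).mp hk
    unfold idSeq at hlt
    rw [if_pos h1] at hlt
    split_ifs at hlt <;> omega

theorem sum_levels {β : ℕ → ℕ} {L : List (Finset ℕ)} (hL : ∀ c r, r ∈ L.getD c ∅ ↔ c + 1 ≤ β r)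
    (hl : ∀ r, β r ≤ L.length) (I : Finset ℕ) :
    ∑ c ∈ Finset.range L.length, ((L.getD c ∅).filter (· ∈ I)).card = ∑ i ∈ I, β i := by
  have : ∀ c, ((L.getD c ∅).filter (· ∈ I)).card = ∑ i ∈ I, if c + 1 ≤ β i then 1 else 0 := by
    intro c
    rw [← Finset.card_filter]
    congr 1
    ext i
    simp only [Finset.mem_filter, hL]
    tauto
  simp only [this]
  rw [Finset.sum_comm]
  refine Finset.sum_congr rfl fun i _ => ?_
  rw [← Finset.card_filter]
  have : (Finset.range L.length).filter (fun c => c + 1 ≤ β i) = Finset.range (β i) := by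
    ext c
    simp only [Finset.mem_filter, Finset.mem_range]
    have := hl i
    omega
  rw [this, Finset.card_range]

theorem seqWt_idSeq {β : ℕ → ℕ} {L : List (Finset ℕ)} (hL : ∀ c r, r ∈ L.getD c ∅ ↔ c + 1 ≤ β r)
    (hl : ∀ r, β r ≤ L.length) (i : ℕ) : seqWt L (idSeq β) i = β i := by
  have h1 := sum_seqWt L (idSeq β) {i} (fun _ => 1)
  simp only [Finset.sum_singleton, one_mul] at h1
  rw [h1]
  have h2 := sum_levels hL hl {i}
  rw [Finset.sum_singleton] at h2
  rw [← h2]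
  refine Finset.sum_congr rfl fun c _ => ?_
  rw [Finset.card_filter]
  refine Finset.sum_congr rfl fun r hr => ?_
  have : idSeq β c r = r := if_pos ((hL c r).mp hr)
  rw [this]

theorem coeff_keyGen (N : ℕ) (A : Finset ℕ) (L : List (Finset ℕ)) (φ : ℕ → ℕ) (d : ℕ →₀ ℕ) :
    coeff d (keyGen N (A :: L) φ) =
      (((fullSeq N A L φ).filter fun U => seqWt (A :: L) U = d).card : ℤ) := by
  rw [keyGen_eq_sum, coeff_sum, Finset.card_filter]
  push_cast
  refine Finset.sum_congr rfl fun U _ => ?_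
  rw [seqMon_eq_monomial, coeff_monomial]
theorem flaggedKeyPoly_ne_zero {β φ : ℕ → ℕ} {A : Finset ℕ} (hβ : WeakComp β) (hA : rowsOf β A)
    (hφ : ∀ a ∈ A, a ≤ φ a) : flaggedKeyPoly β φ ≠ 0 := by
  obtain ⟨K, hK⟩ := exists_bound_on A φ
  obtain ⟨N, A', L, hN, h2, h3, h4, h5⟩ := flaggedKeyPoly_levels hβ K
  obtain rfl := hA.bound h2
  intro h
  rw [h5 φ hK] at h
  have hm := idSeq_mem hβ.1 h2 (fun a ha => (hφ a ha).trans ((hK a ha).trans hN)) hφ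
  have := coeff_keyGen N A' L φ (seqWt (A' :: L) (idSeq β))
  rw [h, coeff_zero] at this
  have h6 : idSeq β ∈ (fullSeq N A' L φ).filter
      fun U => seqWt (A' :: L) U = seqWt (A' :: L) (idSeq β) :=
    Finset.mem_filter.mpr ⟨hm, rfl⟩
  have := Finset.card_pos.mpr ⟨_, h6⟩
  omega

theorem entry_le_of_mem_fullSeq {N : ℕ} {A : Finset ℕ} {L : List (Finset ℕ)} {φ : ℕ → ℕ}
    {U : ℕ → ℕ → ℕ} (hU : U ∈ fullSeq N A L φ) {a : ℕ} (ha : a ∈ A) (c : ℕ) : U c a ≤ φ a := by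
  rw [mem_fullSeq] at hU
  induction c with
  | zero => exact hU.1 a ha
  | succ c ih => exact ((hU.2.2 c).1 a).trans ih

theorem compLE_of_mem_fullSeq {β φ : ℕ → ℕ} {A : Finset ℕ} {L : List (Finset ℕ)} {N : ℕ}
    (hL : ∀ c r, r ∈ (A :: L).getD c ∅ ↔ c + 1 ≤ β r) (hl : ∀ r, β r ≤ (A :: L).length)
    (hφ : ∀ a ∈ A, φ a ≤ a) {U : ℕ → ℕ → ℕ} (hU : U ∈ fullSeq N A L φ) :
    compLE β (seqWt (A :: L) U) := by
  intro k
  have h1 := sum_seqWt (A :: L) U (Finset.Icc 1 k) (fun _ => 1)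
  simp only [one_mul] at h1
  rw [h1, ← sum_levels hL hl]
  refine Finset.sum_le_sum fun c _ => ?_
  rw [Finset.card_filter]
  refine Finset.sum_le_sum fun r hr => ?_
  have hrA : r ∈ A := (hL 0 r).mpr (by have := (hL c r).mp hr; omega)
  have h2 := (entry_le_of_mem_fullSeq hU hrA c).trans (hφ r hrA)
  have h3 : U c r ≠ 0 := (((mem_columns.mp ((mem_fullSeq.mp hU).2.1 c)).1) r).mpr hr
  simp only [Finset.mem_Icc]
  split_ifs <;> omega

theorem eq_idSeq_of_seqWt {β φ : ℕ → ℕ} {A : Finset ℕ} {L : List (Finset ℕ)} {N : ℕ}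
    (hL : ∀ c r, r ∈ (A :: L).getD c ∅ ↔ c + 1 ≤ β r) (hl : ∀ r, β r ≤ (A :: L).length)
    (hφ : ∀ a ∈ A, φ a ≤ a) {U : ℕ → ℕ → ℕ} (hU : U ∈ fullSeq N A L φ)
    (hw : seqWt (A :: L) U = seqWt (A :: L) (idSeq β)) : U = idSeq β := by
  obtain ⟨B, hB⟩ : ∃ B, ∀ i ∈ A, i < B :=
    ⟨A.sup id + 1, fun i hi => Nat.lt_succ_of_le (Finset.le_sup (f := id) hi)⟩
  have hle : ∀ c, ∀ r ∈ (A :: L).getD c ∅, U c r ≤ r ∧ r < B := by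
    intro c r hr
    have hrA : r ∈ A := (hL 0 r).mpr (by have := (hL c r).mp hr; omega)
    exact ⟨(entry_le_of_mem_fullSeq hU hrA c).trans (hφ r hrA), hB r hrA⟩
  have h1 := sum_seqWt (A :: L) U (Finset.range B) id
  have h2 := sum_seqWt (A :: L) (idSeq β) (Finset.range B) id
  rw [hw, h2] at h1
  have hid : ∀ c, ∀ r ∈ (A :: L).getD c ∅, idSeq β c r = r := fun c r hr =>
    if_pos ((hL c r).mp hr)
  have e1 : ∀ c, ∀ r ∈ (A :: L).getD c ∅,
      (if U c r ∈ Finset.range B then id (U c r) else 0) = U c r := by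
    intro c r hr
    rw [if_pos]; · rfl
    rw [Finset.mem_range]; exact (hle c r hr).1.trans_lt (hle c r hr).2
  have e2 : ∀ c, ∀ r ∈ (A :: L).getD c ∅,
      (if idSeq β c r ∈ Finset.range B then id (idSeq β c r) else 0) = r := by
    intro c r hr
    rw [hid c r hr, if_pos]; · rfl
    rw [Finset.mem_range]; exact (hle c r hr).2
  rw [Finset.sum_congr rfl fun c _ => Finset.sum_congr rfl (e2 c),
    Finset.sum_congr rfl fun c _ => Finset.sum_congr rfl (e1 c)] at h1
  have h3 := (Finset.sum_eq_sum_iff_of_le (s := Finset.range (A :: L).length)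
    (f := fun c => ∑ r ∈ (A :: L).getD c ∅, U c r) (g := fun c => ∑ r ∈ (A :: L).getD c ∅, r)
    (fun c _ => Finset.sum_le_sum fun r hr => (hle c r hr).1)).mp h1.symm
  funext c r
  have hcol := mem_columns.mp ((mem_fullSeq.mp hU).2.1 c)
  by_cases hr : r ∈ (A :: L).getD c ∅
  · have hc : c ∈ Finset.range (A :: L).length := by
      rw [Finset.mem_range]
      have := (hL c r).mp hr
      have := hl r
      omega
    have := (Finset.sum_eq_sum_iff_of_le (fun r hr => (hle c r hr).1)).mp (h3 c hc) r hr
    rw [this, hid c r hr]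
  · have : U c r = 0 := by
      by_contra h
      exact hr ((hcol.1 r).mp h)
    rw [this]
    exact (if_neg fun h => hr ((hL c r).mpr h)).symm

theorem flaggedKeyPoly_triangular {β φ : ℕ → ℕ} {A : Finset ℕ} (hβ : WeakComp β)
    (hA : rowsOf β A) (hφ : ∀ a ∈ A, φ a = a) :
    (∀ d : ℕ →₀ ℕ, coeff d (flaggedKeyPoly β φ) ≠ 0 → compLE β d) ∧
      ∀ d : ℕ →₀ ℕ, (∀ i, d i = β i) → coeff d (flaggedKeyPoly β φ) = 1 := by
  obtain ⟨K, hK⟩ := exists_bound_on A φ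
  obtain ⟨N, A', L, hN, h2, h3, h4, h5⟩ := flaggedKeyPoly_levels hβ K
  obtain rfl := hA.bound h2
  have hφ' : ∀ a ∈ A', φ a ≤ a := fun a ha => (hφ a ha).le
  rw [h5 φ hK]
  constructor
  · intro d hd
    rw [coeff_keyGen, Nat.cast_ne_zero, Finset.card_ne_zero] at hd
    obtain ⟨U, hU⟩ := hd
    rw [Finset.mem_filter] at hU
    rw [← hU.2]
    exact compLE_of_mem_fullSeq h2 h4 hφ' hU.1
  · intro d hd
    have hd' : d = seqWt (A' :: L) (idSeq β) := by
      ext i; rw [hd, seqWt_idSeq h2 h4]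
    have hm := idSeq_mem hβ.1 h2 (fun a ha => hφ a ha ▸ (hK a ha).trans hN)
      (fun a ha => (hφ a ha).ge)
    rw [coeff_keyGen, hd']
    have : ((fullSeq N A' L φ).filter fun U => seqWt (A' :: L) U = seqWt (A' :: L) (idSeq β)) =
        {idSeq β} := by
      ext U
      rw [Finset.mem_filter, Finset.mem_singleton]
      constructor
      · exact fun h => eq_idSeq_of_seqWt h2 h4 hφ' h.1 h.2
      · rintro rfl; exact ⟨hm, rfl⟩
    rw [this, Finset.card_singleton]; rfl

/-! ### Coxeter–Knuth equivalence -/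

theorem CKEquiv.refl (u : List ℕ) : CKEquiv u u := Relation.EqvGen.refl u

theorem CKEquiv.symm {u v : List ℕ} (h : CKEquiv u v) : CKEquiv v u := Relation.EqvGen.symm _ _ h

theorem CKEquiv.trans {u v w : List ℕ} (h : CKEquiv u v) (h' : CKEquiv v w) : CKEquiv u w :=
  Relation.EqvGen.trans _ _ _ h h'

theorem CKStep.context {u v : List ℕ} (h : CKStep u v) (c d : List ℕ) :
    CKStep (c ++ u ++ d) (c ++ v ++ d) := by
  rcases h with ⟨a, b, x, y, z, h1, h2, rfl, rfl⟩ | ⟨a, b, x, y, z, h1, h2, rfl, rfl⟩ |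
    ⟨a, b, i, rfl, rfl⟩
  · exact Or.inl ⟨c ++ a, b ++ d, x, y, z, h1, h2, by simp, by simp⟩
  · exact Or.inr (Or.inl ⟨c ++ a, b ++ d, x, y, z, h1, h2, by simp, by simp⟩)
  · exact Or.inr (Or.inr ⟨c ++ a, b ++ d, i, by simp, by simp⟩)

theorem CKEquiv.context {u v : List ℕ} (h : CKEquiv u v) (c d : List ℕ) :
    CKEquiv (c ++ u ++ d) (c ++ v ++ d) := by
  induction h with
  | rel u v h => exact Relation.EqvGen.rel _ _ (h.context c d)
  | refl u => exact CKEquiv.refl _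
  | symm u v _ ih => exact ih.symm
  | trans u v w _ _ ih1 ih2 => exact ih1.trans ih2

theorem CKEquiv.append_left {u v : List ℕ} (h : CKEquiv u v) (c : List ℕ) :
    CKEquiv (c ++ u) (c ++ v) := by
  simpa using h.context c []

theorem CKEquiv.append_right {u v : List ℕ} (h : CKEquiv u v) (d : List ℕ) :
    CKEquiv (u ++ d) (v ++ d) := by
  simpa using h.context [] d

theorem CKEquiv.cons {u v : List ℕ} (h : CKEquiv u v) (a : ℕ) : CKEquiv (a :: u) (a :: v) :=
  h.append_left [a]

/-- `x y z ~ x z y` for `y < x < z`. -/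
theorem ck_right {x y z : ℕ} (h1 : y < x) (h2 : x < z) : CKEquiv [x, y, z] [x, z, y] :=
  Relation.EqvGen.rel _ _ (Or.inl ⟨[], [], x, y, z, h1, h2, rfl, rfl⟩)

/-- `x y z ~ y x z` for `y < z < x`. -/
theorem ck_left {x y z : ℕ} (h1 : y < z) (h2 : z < x) : CKEquiv [x, y, z] [y, x, z] :=
  Relation.EqvGen.rel _ _ (Or.inr (Or.inl ⟨[], [], x, y, z, h1, h2, rfl, rfl⟩))

theorem ck_braid (i : ℕ) : CKEquiv [i, i + 1, i] [i + 1, i, i + 1] :=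
  Relation.EqvGen.rel _ _ (Or.inr (Or.inr ⟨[], [], i, rfl, rfl⟩))

theorem CKEquiv.invariant {α : Type*} (g : List ℕ → α) (h : ∀ u v, CKStep u v → g u = g v)
    {u v : List ℕ} (huv : CKEquiv u v) : g u = g v := by
  induction huv with
  | rel u v h' => exact h u v h'
  | refl u => rfl
  | symm u v _ ih => exact ih.symm
  | trans u v w _ _ ih1 ih2 => exact ih1.trans ih2

theorem CKEquiv.length {u v : List ℕ} (h : CKEquiv u v) : u.length = v.length := by
  refine h.invariant List.length fun u v h => ?_
  rcases h with ⟨a, b, x, y, z, h1, h2, rfl, rfl⟩ | ⟨a, b, x, y, z, h1, h2, rfl, rfl⟩ |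
    ⟨a, b, i, rfl, rfl⟩ <;> simp

theorem CKEquiv.mem_iff {u v : List ℕ} (h : CKEquiv u v) (x : ℕ) : x ∈ u ↔ x ∈ v := by
  refine iff_of_eq (h.invariant (fun u => x ∈ u) fun u v h => ?_)
  rcases h with ⟨a, b, x, y, z, h1, h2, rfl, rfl⟩ | ⟨a, b, x, y, z, h1, h2, rfl, rfl⟩ |
    ⟨a, b, i, rfl, rfl⟩ <;> simp <;> tauto

theorem CKEquiv.wordPerm {u v : List ℕ} (h : CKEquiv u v) : wordPerm u = wordPerm v := by
  refine h.invariant _root_.wordPerm fun u v h => ?_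
  rcases h with ⟨a, b, x, y, z, h1, h2, rfl, rfl⟩ | ⟨a, b, x, y, z, h1, h2, rfl, rfl⟩ |
    ⟨a, b, i, rfl, rfl⟩
  · have : sPerm y * sPerm z = sPerm z * sPerm y := by
      ext k; exact sPerm_comm (i := y) (j := z) (by omega) k
    have h3 : _root_.wordPerm [x, y, z] = _root_.wordPerm [x, z, y] := by
      simp [_root_.wordPerm, this]
    simp only [wordPerm_append, h3]
  · have : sPerm x * sPerm y = sPerm y * sPerm x := by
      ext k; exact (sPerm_comm (i := y) (j := x) (by omega) k).symm
    have h3 : _root_.wordPerm [x, y, z] = _root_.wordPerm [y, x, z] := by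
      simp [_root_.wordPerm, ← mul_assoc, this]
    simp only [wordPerm_append, h3]
  · have h3 : _root_.wordPerm [i, i + 1, i] = _root_.wordPerm [i + 1, i, i + 1] := by
      simp only [_root_.wordPerm, List.map_cons, List.map_nil, List.prod_cons, List.prod_nil,
        mul_one]
      ext k
      exact sPerm_braid i k
    simp only [wordPerm_append, h3]

theorem CKEquiv.isReducedWord {u v : List ℕ} (h : CKEquiv u v) (hu : IsReducedWord u) :
    IsReducedWord v :=
  ⟨fun x hx => hu.1 x ((h.mem_iff x).mpr hx), fun σ h1 h2 => by
    rw [← h.length]; exact hu.2 σ h1 (h2.trans h.wordPerm.symm)⟩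

theorem CKEquiv.isReducedWordFor {u v : List ℕ} {w : Equiv.Perm ℕ} (h : CKEquiv u v)
    (hu : IsReducedWordFor w u) : IsReducedWordFor w v :=
  ⟨h.isReducedWord hu.1, h.wordPerm.symm.trans hu.2⟩

/-- A word none of whose Coxeter–Knuth equivalents contains a factor `x x`, or a factor `x y x`
with `x` and `y` not adjacent. -/
def Good (ρ : List ℕ) : Prop :=
  ∀ σ, CKEquiv ρ σ → (∀ a b x, σ ≠ a ++ [x, x] ++ b) ∧
    ∀ a b x y, σ = a ++ [x, y, x] ++ b → x = y + 1 ∨ y = x + 1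

theorem Good.equiv {u v : List ℕ} (hu : Good u) (h : CKEquiv u v) : Good v :=
  fun σ hσ => hu σ (h.trans hσ)

theorem Good.factor {c u d : List ℕ} (h : Good (c ++ u ++ d)) : Good u := by
  intro σ hσ
  obtain ⟨h1, h2⟩ := h _ (hσ.context c d)
  refine ⟨fun a b x e => h1 (c ++ a) (b ++ d) x (by simp [e]), fun a b x y e =>
    h2 (c ++ a) (b ++ d) x y (by simp [e])⟩

theorem Good.left {u d : List ℕ} (h : Good (u ++ d)) : Good u :=
  Good.factor (c := []) (d := d) (by simpa using h)

theorem Good.right {c u : List ℕ} (h : Good (c ++ u)) : Good u :=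
  Good.factor (c := c) (d := []) (by simpa using h)

theorem Good.tail {a : ℕ} {u : List ℕ} (h : Good (a :: u)) : Good u :=
  Good.right (c := [a]) h

theorem Good.ne {x y : ℕ} {u : List ℕ} (h : Good (x :: y :: u)) : x ≠ y := by
  rintro rfl
  exact (h _ (CKEquiv.refl _)).1 [] u x rfl

theorem Good.braid {x y : ℕ} {u : List ℕ} (h : Good (x :: y :: x :: u)) :
    x = y + 1 ∨ y = x + 1 :=
  (h _ (CKEquiv.refl _)).2 [] u x y rfl

theorem IsReducedWord.good {ρ : List ℕ} (h : IsReducedWord ρ) : Good ρ := by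
  intro σ hσ
  have hs := hσ.isReducedWord h
  constructor
  · rintro a b x rfl
    have := hs.2 (a ++ b) (fun y hy => hs.1 y (by simp at hy ⊢; tauto)) ?_
    · simp at this
    · have e : wordPerm [x, x] = 1 := by
        ext k
        simp [wordPerm, sPerm_sPerm]
      simp only [wordPerm_append, e, mul_one]
  · rintro a b x y rfl
    by_contra hc
    push Not at hc
    by_cases hxy : x = y
    · subst hxy
      have := hs.2 (a ++ [x] ++ b) (fun y hy => hs.1 y (by simp at hy ⊢; tauto)) ?_
      · simp at this
      · have e : wordPerm [x, x, x] = wordPerm [x] := by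
          ext k
          simp [wordPerm, sPerm_sPerm]
        simp only [wordPerm_append, e]
    · have := hs.2 (a ++ [y] ++ b) (fun y hy => hs.1 y (by simp at hy ⊢; tauto)) ?_
      · simp at this
      · have e : wordPerm [x, y, x] = wordPerm [y] := by
          ext k
          simp only [wordPerm, List.map_cons, List.map_nil, List.prod_cons, List.prod_nil,
            mul_one, Equiv.Perm.mul_apply]
          rcases lt_or_gt_of_ne hxy with hlt | hlt
          · rw [sPerm_comm (by omega), sPerm_sPerm]
          · rw [← sPerm_comm (by omega), sPerm_sPerm]
        simp only [wordPerm_append, e]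

/-- Reversal of a word combined with the complement `x ↦ K - x`. -/
def revComp (K : ℕ) (u : List ℕ) : List ℕ := (u.map (K - ·)).reverse

theorem revComp_append (K : ℕ) (u v : List ℕ) :
    revComp K (u ++ v) = revComp K v ++ revComp K u := by simp [revComp]

theorem length_revComp (K : ℕ) (u : List ℕ) : (revComp K u).length = u.length := by simp [revComp]

theorem mem_revComp_le {K : ℕ} {u : List ℕ} {x : ℕ} (h : x ∈ revComp K u) : x ≤ K := by
  simp only [revComp, List.mem_reverse, List.mem_map] at h
  obtain ⟨y, _, rfl⟩ := h
  omega

theorem revComp_revComp {K : ℕ} {u : List ℕ} (h : ∀ x ∈ u, x ≤ K) : revComp K (revComp K u) = u := by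
  simp only [revComp, List.map_reverse, List.reverse_reverse, List.map_map]
  conv_rhs => rw [← List.map_id u]
  refine List.map_congr_left fun x hx => ?_
  have := h x hx
  simp; omega

theorem CKStep.revComp {K : ℕ} {u v : List ℕ} (h : CKStep u v) (hu : ∀ x ∈ u, x ≤ K) :
    CKEquiv (revComp K u) (revComp K v) := by
  rcases h with ⟨a, b, x, y, z, h1, h2, rfl, rfl⟩ | ⟨a, b, x, y, z, h1, h2, rfl, rfl⟩ |
    ⟨a, b, i, rfl, rfl⟩
  · have hz := hu z (by simp)
    have : CKEquiv (_root_.revComp K [x, y, z]) (_root_.revComp K [x, z, y]) :=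
      (ck_left (x := K - y) (y := K - z) (z := K - x) (by omega) (by omega)).symm
    simp only [revComp_append]
    exact ((this.append_right _).append_left _)
  · have hz := hu x (by simp)
    have : CKEquiv (_root_.revComp K [x, y, z]) (_root_.revComp K [y, x, z]) :=
      (ck_right (x := K - z) (y := K - x) (z := K - y) (by omega) (by omega)).symm
    simp only [revComp_append]
    exact ((this.append_right _).append_left _)
  · have hz := hu (i + 1) (by simp)
    have : CKEquiv (_root_.revComp K [i, i + 1, i]) (_root_.revComp K [i + 1, i, i + 1]) := by
      have := (ck_braid (K - (i + 1))).symm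
      rw [show K - (i + 1) + 1 = K - i by omega] at this
      exact this
    simp only [revComp_append]
    exact ((this.append_right _).append_left _)

theorem CKEquiv.revComp {K : ℕ} {u v : List ℕ} (h : CKEquiv u v) (hu : ∀ x ∈ u, x ≤ K) :
    CKEquiv (revComp K u) (revComp K v) := by
  induction h with
  | rel u v h => exact h.revComp hu
  | refl u => exact CKEquiv.refl _
  | symm u v h ih =>
    exact (ih fun x hx => hu x ((CKEquiv.mem_iff h x).mp hx)).symm
  | trans u v w h1 _ ih1 ih2 =>
    exact (ih1 hu).trans (ih2 fun x hx => hu x ((CKEquiv.mem_iff h1 x).mpr hx))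

theorem Good.revComp {K : ℕ} {u : List ℕ} (h : Good u) (hu : ∀ x ∈ u, x ≤ K) :
    Good (revComp K u) := by
  intro σ hσ
  have hσK : ∀ x ∈ σ, x ≤ K := fun x hx => mem_revComp_le ((hσ.mem_iff x).mpr hx)
  have h1 := hσ.revComp fun x hx => mem_revComp_le hx
  rw [revComp_revComp hu] at h1
  obtain ⟨h2, h3⟩ := h _ h1
  constructor
  · rintro a b x rfl
    refine h2 (_root_.revComp K b) (_root_.revComp K a) (K - x) ?_
    simp only [revComp_append, List.append_assoc]
    rfl
  · rintro a b x y rfl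
    have := h3 (_root_.revComp K b) (_root_.revComp K a) (K - x) (K - y) (by
      simp only [revComp_append, List.append_assoc]
      rfl)
    have := hσK x (by simp)
    have := hσK y (by simp)
    omega

theorem pairwise_revComp {K : ℕ} {u : List ℕ} (h : u.Pairwise (· < ·)) (hu : ∀ x ∈ u, x ≤ K) :
    (revComp K u).Pairwise (· < ·) := by
  unfold revComp
  rw [List.pairwise_reverse, List.pairwise_map]
  refine h.imp_of_mem fun {x y} hx hy hxy => ?_
  have := hu x hx
  have := hu y hy
  omega

/-! ### The first column of Edelman–Greene insertion -/

/-- Insertion of a letter into a column (an ascending list): the new column together with the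
list of bumped letters, which has at most one element. -/
def insL (a : ℕ) : List ℕ → List ℕ × List ℕ
  | [] => ([a], [])
  | s :: S => if a < s then (a :: S, [s]) else if a = s then (s :: S, S.head?.toList)
      else (s :: (insL a S).1, (insL a S).2)

theorem insL_lt {a s : ℕ} (S : List ℕ) (h : a < s) : insL a (s :: S) = (a :: S, [s]) := by
  rw [insL, if_pos h]

theorem insL_eq (a : ℕ) (S : List ℕ) : insL a (a :: S) = (a :: S, S.head?.toList) := by
  rw [insL, if_neg (lt_irrefl a), if_pos rfl]

theorem insL_gt {a s : ℕ} (S : List ℕ) (h : s < a) :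
    insL a (s :: S) = (s :: (insL a S).1, (insL a S).2) := by
  rw [insL, if_neg (by omega), if_neg (by omega)]

theorem mem_insL_self (a : ℕ) (S : List ℕ) : a ∈ (insL a S).1 := by
  induction S with
  | nil => simp [insL]
  | cons s S ih =>
    rcases lt_trichotomy a s with h | rfl | h
    · simp [insL_lt S h]
    · simp [insL_eq]
    · simp [insL_gt S h, ih]

theorem mem_of_mem_insL {a x : ℕ} {S : List ℕ} (hx : x ∈ (insL a S).1) : x = a ∨ x ∈ S := by
  induction S with
  | nil => simpa [insL] using hx
  | cons s S ih =>
    rcases lt_trichotomy a s with h | rfl | h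
    · rw [insL_lt S h] at hx
      simp at hx ⊢; tauto
    · rw [insL_eq] at hx
      exact Or.inr hx
    · rw [insL_gt S h] at hx
      simp at hx ⊢; tauto

theorem pairwise_insL {a : ℕ} {S : List ℕ} (hS : S.Pairwise (· < ·)) :
    (insL a S).1.Pairwise (· < ·) := by
  induction S with
  | nil => simp [insL]
  | cons s S ih =>
    rw [List.pairwise_cons] at hS
    rcases lt_trichotomy a s with h | rfl | h
    · rw [insL_lt S h]
      exact List.pairwise_cons.mpr ⟨fun x hx => h.trans (hS.1 x hx), hS.2⟩
    · rw [insL_eq]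
      exact List.pairwise_cons.mpr hS
    · rw [insL_gt S h]
      refine List.pairwise_cons.mpr ⟨fun x hx => ?_, ih hS.2⟩
      rcases mem_of_mem_insL hx with rfl | hx
      exacts [h, hS.1 x hx]

theorem insL_snd {a : ℕ} {S : List ℕ} (hS : S.Pairwise (· < ·)) :
    (insL a S).2 = [] ∨ ∃ b, (insL a S).2 = [b] ∧ b ∈ S ∧ a < b := by
  induction S with
  | nil => simp [insL]
  | cons s S ih =>
    rw [List.pairwise_cons] at hS
    rcases lt_trichotomy a s with h | rfl | h
    · rw [insL_lt S h]
      exact Or.inr ⟨s, rfl, by simp, h⟩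
    · rw [insL_eq]
      rcases S with _ | ⟨t, S⟩
      · simp
      · exact Or.inr ⟨t, rfl, by simp, hS.1 t (by simp)⟩
    · rw [insL_gt S h]
      rcases ih hS.2 with h | ⟨b, h1, h2, h3⟩
      · exact Or.inl h
      · exact Or.inr ⟨b, h1, by simp [h2], h3⟩

/-- A smaller letter inserted after `z` bumps some letter which is at most `z`. -/
theorem insL_snd_of_lt_mem {x z : ℕ} {T : List ℕ} (hT : T.Pairwise (· < ·)) (hz : z ∈ T)
    (hx : x < z) : ∃ b, (insL x T).2 = [b] ∧ b ∈ T ∧ x < b ∧ b ≤ z := by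
  induction T with
  | nil => simp at hz
  | cons s T ih =>
    rw [List.pairwise_cons] at hT
    have hsz : s ≤ z := by
      rcases List.mem_cons.mp hz with rfl | hz
      exacts [le_rfl, (hT.1 z hz).le]
    rcases lt_trichotomy x s with h | rfl | h
    · rw [insL_lt T h]
      exact ⟨s, rfl, by simp, h, hsz⟩
    · rw [insL_eq]
      rcases T with _ | ⟨t, T⟩
      · simp at hz; omega
      · refine ⟨t, rfl, by simp, hT.1 t (by simp), ?_⟩
        have hz' : z ∈ t :: T := by
          rcases List.mem_cons.mp hz with rfl | hz
          exacts [absurd hx (lt_irrefl _), hz]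
        rcases List.mem_cons.mp hz' with rfl | hz'
        exacts [le_rfl, ((List.pairwise_cons.mp hT.2).1 z hz').le]
    · rw [insL_gt T h]
      have hz' : z ∈ T := by
        rcases List.mem_cons.mp hz with rfl | hz
        exacts [absurd hx (by omega), hz]
      obtain ⟨b, h1, h2, h3⟩ := ih hT.2 hz'
      exact ⟨b, h1, by simp [h2], h3⟩

/-- A small letter moves through a decreasing word up to its last letter. -/
theorem ck_move_left {a s : ℕ} {S : List ℕ} (hS : (s :: S).Pairwise (· < ·)) (h : a < s) :
    CKEquiv (a :: (S.reverse ++ [s])) (S.reverse ++ [a, s]) := by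
  induction S generalizing s with
  | nil => exact CKEquiv.refl _
  | cons d S ih =>
    rw [List.pairwise_cons] at hS
    have hd := hS.1 d (by simp)
    have h1 := (ih hS.2 (h.trans hd)).append_right [s]
    have h2 := ((ck_left (x := d) h hd).symm).append_left S.reverse
    simp only [List.reverse_cons, List.append_assoc, List.cons_append, List.nil_append] at h1 h2 ⊢
    exact h1.trans h2

/-- A small letter moves left through an increasing word whose first letter stays put. -/
theorem ck_move_right {a b : ℕ} {A : List ℕ} (hA : (a :: A).Pairwise (· < ·)) (h : b < a) :
    CKEquiv (a :: (A ++ [b])) (a :: b :: A) := by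
  induction A generalizing a with
  | nil => exact CKEquiv.refl _
  | cons d A ih =>
    rw [List.pairwise_cons] at hA
    have hd := hA.1 d (by simp)
    have h1 := (ih hA.2 (h.trans hd)).cons a
    have h2 := ((ck_right (x := a) h hd).symm).append_right A
    simp only [List.append_assoc, List.cons_append, List.nil_append] at h1 h2 ⊢
    exact h1.trans h2

theorem Good.head_succ {a : ℕ} {S : List ℕ} (hS : (a :: S).Pairwise (· < ·))
    (hg : Good (a :: (a :: S).reverse)) : ∃ S', S = (a + 1) :: S' := by
  rcases S with _ | ⟨c, S⟩
  · exact absurd rfl hg.ne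
  · have hS' := List.pairwise_cons.mp hS
    have hc := hS'.1 c (by simp)
    have h1 := (ck_move_left hS'.2 hc).append_right [a]
    have h2 : Good (S.reverse ++ [a, c, a]) := hg.equiv (by simpa using h1)
    have := h2.right.braid
    exact ⟨S, by rw [show c = a + 1 by omega]⟩

theorem insL_equiv {a : ℕ} {S : List ℕ} (hS : S.Pairwise (· < ·)) (hg : Good (a :: S.reverse)) :
    CKEquiv (a :: S.reverse) ((insL a S).1.reverse ++ (insL a S).2) := by
  induction S with
  | nil => exact CKEquiv.refl _
  | cons s S ih =>
    have hS' := List.pairwise_cons.mp hS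
    rcases lt_trichotomy a s with h | rfl | h
    · rw [insL_lt S h]
      simpa using ck_move_left hS h
    · obtain ⟨S', rfl⟩ := hg.head_succ hS
      have h1 := (ck_move_left hS'.2 (lt_add_one a)).append_right [a]
      have h2 := (ck_braid a).append_left S'.reverse
      rw [insL_eq]
      simp only [List.reverse_cons, List.append_assoc, List.cons_append, List.nil_append,
        List.head?_cons, Option.toList_some] at h1 h2 ⊢
      exact h1.trans h2
    · have h1 := (ih hS'.2 (Good.left (u := a :: S.reverse) (d := [s])
        (by simpa using hg))).append_right [s]
      rw [insL_gt S h]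
      have h2 : CKEquiv (a :: (s :: S).reverse) ((insL a S).1.reverse ++ (insL a S).2 ++ [s]) := by
        simpa using h1
      refine h2.trans ?_
      rcases insL_snd (a := a) hS'.2 with hb | ⟨b, hb, hbS, hab⟩
      · rw [hb]
        simpa using CKEquiv.refl _
      · rw [hb]
        have hT := pairwise_insL (a := a) hS'.2
        have hm := mem_insL_self a S
        have hsub : ∀ x ∈ (insL a S).1, s < x := fun x hx => by
          rcases mem_of_mem_insL hx with rfl | hx
          exacts [h, hS'.1 x hx]
        rcases hT' : (insL a S).1 with _ | ⟨t, T⟩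
        · rw [hT'] at hm; simp at hm
        · rw [hT'] at hT hm hsub
          have hst := hsub t (by simp)
          have hta : t ≤ a := by
            rcases List.mem_cons.mp hm with rfl | hm
            exacts [le_rfl, ((List.pairwise_cons.mp hT).1 a hm).le]
          have := (ck_right hst (lt_of_le_of_lt hta hab)).symm.append_left T.reverse
          simpa using this

/-- Insertion of a word, read from right to left, into a column. -/
def insW : List ℕ → List ℕ → List ℕ × List ℕ
  | [], S => (S, [])
  | a :: ρ, S => ((insL a (insW ρ S).1).1, (insL a (insW ρ S).1).2 ++ (insW ρ S).2)

theorem insW_append (u v S : List ℕ) : insW (u ++ v) S =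
    ((insW u (insW v S).1).1, (insW u (insW v S).1).2 ++ (insW v S).2) := by
  induction u with
  | nil => rfl
  | cons a u ih => simp [insW, ih]

theorem pairwise_insW {u S : List ℕ} (hS : S.Pairwise (· < ·)) :
    (insW u S).1.Pairwise (· < ·) := by
  induction u with
  | nil => exact hS
  | cons a u ih => exact pairwise_insL ih

theorem mem_of_mem_insW {u S : List ℕ} {x : ℕ} (hx : x ∈ (insW u S).1) : x ∈ u ∨ x ∈ S := by
  induction u with
  | nil => exact Or.inr hx
  | cons a u ih =>
    rcases mem_of_mem_insL hx with rfl | hx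
    · simp
    · have := ih hx
      simp; tauto

theorem insW_strip {s : ℕ} {u : List ℕ} (S : List ℕ) (h : ∀ x ∈ u, s < x) :
    insW u (s :: S) = (s :: (insW u S).1, (insW u S).2) := by
  induction u with
  | nil => rfl
  | cons a u ih =>
    simp only [insW, ih fun x hx => h x (by simp [hx]), insL_gt _ (h a (by simp))]

theorem insW_equiv {u S : List ℕ} (hS : S.Pairwise (· < ·)) (hg : Good (u ++ S.reverse)) :
    CKEquiv (u ++ S.reverse) ((insW u S).1.reverse ++ (insW u S).2) := by
  induction u with
  | nil => simpa [insW] using CKEquiv.refl _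
  | cons a u ih =>
    have h1 := (ih (Good.tail hg)).cons a
    refine h1.trans ?_
    have h2 : Good (a :: (insW u S).1.reverse) := (Good.equiv hg h1).left
    have := (insL_equiv (pairwise_insW hS) h2).append_right (insW u S).2
    simpa [insW] using this

/-- If a letter larger than `z` bumps after `z` was inserted, then `z` bumped something smaller. -/
theorem insL_insL_snd {x z : ℕ} {S : List ℕ} (hS : S.Pairwise (· < ·))
    (hg : Good (z :: S.reverse)) (h : z < x) :
    (insL x (insL z S).1).2 = [] ∨ ∃ b c, (insL x (insL z S).1).2 = [b] ∧
      (insL z S).2 = [c] ∧ z < c ∧ c < b := by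
  induction S with
  | nil => left; rw [show (insL z []).1 = [z] from rfl, insL_gt _ h]; rfl
  | cons s S ih =>
    have hS' := List.pairwise_cons.mp hS
    have hbump : ∀ c, c ≤ x ∨ (∀ y ∈ S, c < y) → (insL x S).2 = [] ∨
        ∃ b, (insL x S).2 = [b] ∧ c < b := fun c hc => by
      rcases insL_snd (a := x) hS'.2 with hb | ⟨b, hb, hbS, hab⟩
      · exact Or.inl hb
      · refine Or.inr ⟨b, hb, ?_⟩
        rcases hc with hc | hc
        exacts [by omega, hc b hbS]
    rcases lt_trichotomy z s with h1 | rfl | h1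
    · rw [insL_lt S h1, insL_gt _ h]
      rcases hbump s (Or.inr hS'.1) with hb | ⟨b, hb, hb'⟩
      · exact Or.inl hb
      · exact Or.inr ⟨b, s, hb, rfl, h1, hb'⟩
    · obtain ⟨S', rfl⟩ := hg.head_succ hS
      rw [insL_eq, insL_gt _ h]
      rcases hbump (z + 1) (Or.inl h) with hb | ⟨b, hb, hb'⟩
      · exact Or.inl hb
      · exact Or.inr ⟨b, z + 1, hb, rfl, by omega, hb'⟩
    · rw [insL_gt S h1, insL_gt _ (h1.trans h)]
      exact ih hS'.2 (Good.left (u := z :: S.reverse) (d := [s]) (by simpa using hg))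

theorem insW_three (x y z : ℕ) (S : List ℕ) : insW [x, y, z] S =
    ((insL x (insL y (insL z S).1).1).1,
      (insL x (insL y (insL z S).1).1).2 ++ ((insL y (insL z S).1).2 ++ (insL z S).2)) := by
  simp [insW]

/-- Two words insert into the column `S` in the same way, up to equivalence. -/
def SameIns (u v S : List ℕ) : Prop :=
  (insW u S).1 = (insW v S).1 ∧ CKEquiv (insW u S).2 (insW v S).2

theorem sameIns_strip {u v S : List ℕ} {s : ℕ} (hu : ∀ x ∈ u, s < x) (hv : ∀ x ∈ v, s < x)
    (h : SameIns u v S) : SameIns u v (s :: S) := by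
  unfold SameIns
  rw [insW_strip S hu, insW_strip S hv]
  exact ⟨by rw [h.1], h.2⟩

theorem Good.of_cons {u S : List ℕ} {s : ℕ} (h : Good (u ++ (s :: S).reverse)) :
    Good (u ++ S.reverse) :=
  Good.left (d := [s]) (by simpa using h)

theorem sameIns_right {x y z : ℕ} (hyx : y < x) (hxz : x < z) {S : List ℕ}
    (hS : S.Pairwise (· < ·)) (hg : Good ([x, y, z] ++ S.reverse)) :
    SameIns [x, y, z] [x, z, y] S := by
  have hyz := hyx.trans hxz
  induction S with
  | nil =>
    unfold SameIns
    rw [insW_three, insW_three]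
    rw [show (insL z []).1 = [z] from rfl, show (insL y []).1 = [y] from rfl, insL_lt _ hyz,
      insL_gt _ hyz, insL_gt _ hyx, insL_gt _ hyx, show (insL z []).1 = [z] from rfl,
      insL_lt _ hxz]
    exact ⟨rfl, CKEquiv.refl _⟩
  | cons s S ih =>
    have hS' := List.pairwise_cons.mp hS
    have hg2 : Good ([x, z, y] ++ (s :: S).reverse) :=
      hg.equiv ((ck_right hyx hxz).append_right _)
    rcases lt_trichotomy y s with hys | rfl | hys
    · unfold SameIns
      rw [insW_three, insW_three]
      rcases lt_trichotomy z s with hzs | rfl | hzs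
      · rw [insL_lt S hzs, insL_lt _ hys, insL_lt S hyz, insL_gt _ hyz, insL_gt _ hyx,
          insL_gt _ hyx]
        rcases S with _ | ⟨t, S⟩
        · rw [show insL z [] = ([z], []) from rfl, insL_lt _ hxz]
          exact ⟨rfl, CKEquiv.refl _⟩
        · have hst := hS'.1 t (by simp)
          rw [insL_lt S (hzs.trans hst), insL_lt S (hxz.trans (hzs.trans hst)), insL_lt S hxz]
          exact ⟨rfl, ck_left hzs hst⟩
      · obtain ⟨S', rfl⟩ := (Good.right (c := [x, y]) hg).head_succ hS
        rw [insL_eq, insL_lt _ hys, insL_gt _ hys, insL_gt _ hyx, insL_gt _ hyx,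
          insL_lt _ (by omega : z < z + 1), insL_lt _ (by omega : x < z + 1), insL_lt _ hxz]
        exact ⟨rfl, (ck_braid z).symm⟩
      · rw [insL_gt S hzs, insL_lt _ hys, insL_lt _ hys, insL_gt _ hyz, insL_gt _ hyx]
        have hT := pairwise_insL (a := z) hS'.2
        obtain ⟨b', h1, h2, h3, h4⟩ := insL_snd_of_lt_mem hT (mem_insL_self z S) hxz
        refine ⟨rfl, ?_⟩
        rw [h1]
        have hs : s < b' := by
          rcases mem_of_mem_insL h2 with rfl | h2
          exacts [hzs, hS'.1 _ h2]
        rcases insL_snd (a := z) hS'.2 with hb | ⟨b, hb, hbS, hab⟩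
        · rw [hb]; exact CKEquiv.refl _
        · rw [hb]
          exact ck_right hs (by omega)
    · obtain ⟨S', rfl⟩ := (Good.right (c := [x, z]) hg2).head_succ hS
      unfold SameIns
      rw [insW_three, insW_three]
      have hT := pairwise_insL (a := z) hS'.2
      obtain ⟨b', h1, h2, h3, h4⟩ := insL_snd_of_lt_mem hT (mem_insL_self z _) hxz
      have hz : y + 1 < z := by omega
      have e := insL_gt S' hz
      rw [insL_gt _ hyz, insL_eq, insL_eq, insL_gt _ hyz, insL_gt _ hyx, h1]
      refine ⟨rfl, ?_⟩
      rcases insL_snd (a := z) hS'.2 with hb | ⟨b, hb, hbS, hab⟩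
      · rw [hb, e]; exact CKEquiv.refl _
      · rw [hb, e]
        exact ck_right (by omega : y + 1 < b') (by omega)
    · refine sameIns_strip ?_ ?_ (ih hS'.2 hg.of_cons)
      · simp; omega
      · simp; omega

theorem sameIns_left {x y z : ℕ} (hyz : y < z) (hzx : z < x) {S : List ℕ}
    (hS : S.Pairwise (· < ·)) (hg : Good ([x, y, z] ++ S.reverse)) :
    SameIns [x, y, z] [y, x, z] S := by
  have hyx := hyz.trans hzx
  induction S with
  | nil =>
    unfold SameIns
    rw [insW_three, insW_three]
    rw [show insL z [] = ([z], []) from rfl, insL_lt _ hyz, insL_gt _ hyx, insL_gt _ hzx,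
      show insL x [] = ([x], []) from rfl, insL_lt _ hyz]
    exact ⟨rfl, CKEquiv.refl _⟩
  | cons s S ih =>
    have hS' := List.pairwise_cons.mp hS
    have hg2 : Good ([y, x, z] ++ (s :: S).reverse) :=
      hg.equiv ((ck_left hyz hzx).append_right _)
    rcases lt_trichotomy y s with hys | rfl | hys
    · unfold SameIns
      rw [insW_three, insW_three]
      rcases lt_trichotomy z s with hzs | rfl | hzs
      · rw [insL_lt S hzs, insL_lt _ hyz, insL_gt _ hyx, insL_gt _ hzx, insL_lt _ hyz]
        refine ⟨rfl, ?_⟩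
        rcases insL_snd (a := x) hS'.2 with hb | ⟨b, hb, hbS, hab⟩
        · rw [hb]; exact CKEquiv.refl _
        · rw [hb]
          exact ck_left hzs (hS'.1 b hbS)
      · obtain ⟨S', rfl⟩ := (Good.right (c := [x, y]) hg).head_succ hS
        rw [insL_eq, insL_lt _ hys, insL_gt _ hyx, insL_gt _ hzx, insL_lt _ hys]
        refine ⟨rfl, ?_⟩
        rcases insL_snd (a := x) hS'.2 with hb | ⟨b, hb, hbS, hab⟩
        · rw [hb]; exact CKEquiv.refl _
        · rw [hb]
          exact ck_left (by omega) (by omega : z + 1 < b)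
      · rw [insL_gt S hzs, insL_lt _ hys, insL_gt _ hyx, insL_gt _ (hzs.trans hzx), insL_lt _ hys]
        refine ⟨rfl, ?_⟩
        rcases insL_insL_snd hS'.2 (Good.right (c := [x, y]) hg.of_cons) hzx with
          hb | ⟨b, c, hb, hc, h1, h2⟩
        · rw [hb]; exact CKEquiv.refl _
        · rw [hb, hc]
          exact ck_left (by omega) h2
    · have hgz : Good (z :: (y :: S).reverse) := Good.right (c := [x, y]) hg
      have h1 := (insL_equiv hS hgz).cons y
      have h2 : Good (y :: ((insL z (y :: S)).1.reverse)) :=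
        (Good.equiv (Good.right (c := [x]) hg) h1).left
      rw [insL_gt S hyz] at h2
      have hT : (y :: (insL z S).1).Pairwise (· < ·) := by
        have := pairwise_insL (a := z) hS
        rwa [insL_gt S hyz] at this
      obtain ⟨T, hT'⟩ := h2.head_succ hT
      have hx : y + 1 < x := by omega
      have key := insL_insL_snd hS'.2 (Good.right (c := [x, y]) hg.of_cons) hzx
      unfold SameIns
      rw [insW_three, insW_three]
      rw [hT', insL_gt _ hx] at key
      dsimp only at key
      rw [insL_gt _ hyz, hT', insL_eq, insL_gt _ hyx, insL_gt _ hx, insL_eq]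
      refine ⟨rfl, ?_⟩
      rcases key with hb | ⟨b, c, hb, hc, h1, h2⟩
      · simp only [hb]; exact CKEquiv.refl _
      · simp only [hb, hc]
        exact ck_left (by omega : y + 1 < c) h2
    · refine sameIns_strip ?_ ?_ (ih hS'.2 hg.of_cons)
      · simp; omega
      · simp; omega

theorem sameIns_braid (i : ℕ) {S : List ℕ} (hS : S.Pairwise (· < ·))
    (hg : Good ([i, i + 1, i] ++ S.reverse)) :
    SameIns [i, i + 1, i] [i + 1, i, i + 1] S := by
  have hi := lt_add_one i
  induction S with
  | nil =>
    unfold SameIns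
    rw [insW_three, insW_three]
    rw [show insL i [] = ([i], []) from rfl, insL_gt _ hi,
      show insL (i + 1) [] = ([i + 1], []) from rfl, insL_eq, insL_lt _ hi, insL_gt _ hi]
    exact ⟨rfl, CKEquiv.refl _⟩
  | cons s S ih =>
    have hS' := List.pairwise_cons.mp hS
    have hg2 : Good ([i + 1, i, i + 1] ++ (s :: S).reverse) :=
      hg.equiv ((ck_braid i).append_right _)
    rcases lt_trichotomy i s with his | rfl | his
    · unfold SameIns
      rw [insW_three, insW_three]
      rcases eq_or_ne s (i + 1) with rfl | hs
      · obtain ⟨S', rfl⟩ := (Good.right (c := [i + 1, i]) hg2).head_succ hS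
        rw [insL_lt _ hi, insL_gt _ hi, insL_lt _ (lt_add_one (i + 1)), insL_eq, insL_eq,
          insL_lt _ hi, insL_gt _ hi, insL_lt _ (lt_add_one (i + 1))]
        exact ⟨rfl, ck_braid (i + 1)⟩
      · have hs : i + 1 < s := by omega
        rw [insL_lt _ his, insL_gt _ hi, insL_eq, insL_lt _ hs, insL_lt _ hi, insL_gt _ hi]
        rcases S with _ | ⟨t, S⟩
        · exact ⟨rfl, CKEquiv.refl _⟩
        · have hst := hS'.1 t (by simp)
          rw [insL_lt _ (hs.trans hst)]
          exact ⟨rfl, (ck_left hs hst).symm⟩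
    · obtain ⟨S', rfl⟩ := (Good.right (c := [i, i + 1]) hg).head_succ hS
      obtain ⟨S'', rfl⟩ := (Good.of_cons (u := [i + 1])
        (Good.right (c := [i + 1, i]) hg2)).head_succ hS'.2
      unfold SameIns
      rw [insW_three, insW_three, insL_eq, insL_gt _ hi, insL_eq, insL_eq, insL_gt _ hi, insL_eq]
      exact ⟨rfl, ck_braid (i + 1)⟩
    · refine sameIns_strip ?_ ?_ (ih hS'.2 hg.of_cons)
      · simp; omega
      · simp; omega

/-- The first column of the insertion tableau of a word. -/
def colA (ρ : List ℕ) : List ℕ := (insW ρ []).1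

/-- The letters bumped out of the first column. -/
def colR (ρ : List ℕ) : List ℕ := (insW ρ []).2

theorem pairwise_colA (ρ : List ℕ) : (colA ρ).Pairwise (· < ·) := pairwise_insW List.Pairwise.nil

theorem Good.colA_equiv {ρ : List ℕ} (h : Good ρ) : CKEquiv ρ ((colA ρ).reverse ++ colR ρ) := by
  simpa [colA, colR] using insW_equiv (u := ρ) (S := []) List.Pairwise.nil (by simpa using h)

theorem colA_append (u v : List ℕ) : colA (u ++ v) = (insW u (colA v)).1 := by
  simp [colA, insW_append]

theorem colR_append (u v : List ℕ) : colR (u ++ v) = (insW u (colA v)).2 ++ colR v := by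
  simp [colA, colR, insW_append]

theorem CKEquiv.colA_colR {ρ σ : List ℕ} (h : CKEquiv ρ σ) (hg : Good ρ) :
    colA ρ = colA σ ∧ CKEquiv (colR ρ) (colR σ) := by
  induction h with
  | rel ρ σ h =>
    have main : ∀ a b t t' : List ℕ, ρ = a ++ t ++ b →
        (∀ S : List ℕ, S.Pairwise (· < ·) → Good (t ++ S.reverse) → SameIns t t' S) →
        colA ρ = colA (a ++ t' ++ b) ∧ CKEquiv (colR ρ) (colR (a ++ t' ++ b)) := by
      rintro a b t t' rfl h
      have hb : Good (t ++ b) := Good.right (c := a) (by simpa using hg)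
      have hS := h (colA b) (pairwise_colA b)
        (hb.equiv ((hb.right.colA_equiv.append_left t).trans
          (by simpa using CKEquiv.refl _))).left
      simp only [List.append_assoc, colA_append, colR_append, insW_append]
      rw [hS.1]
      exact ⟨rfl, (hS.2.append_right _).append_left _⟩
    rcases h with ⟨a, b, x, y, z, h1, h2, h3, rfl⟩ | ⟨a, b, x, y, z, h1, h2, h3, rfl⟩ |
      ⟨a, b, i, h3, rfl⟩
    · exact main a b _ _ h3 fun S hS hg => sameIns_right h1 h2 hS hg
    · exact main a b _ _ h3 fun S hS hg => sameIns_left h1 h2 hS hg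
    · exact main a b _ _ h3 fun S hS hg => sameIns_braid i hS hg
  | refl u => exact ⟨rfl, CKEquiv.refl _⟩
  | symm u v h ih =>
    have := ih (hg.equiv (CKEquiv.symm h))
    exact ⟨this.1.symm, this.2.symm⟩
  | trans u v w h _ ih1 ih2 =>
    have h1 := ih1 hg
    have h2 := ih2 (hg.equiv h)
    exact ⟨h1.1.trans h2.1, h1.2.trans h2.2⟩

/-! ### Exchanging the lengths of two increasing blocks -/

/-- The number of letters of `A` which are at most `x` minus the number of letters of `B`
which are less than `x`. -/
def excess (A B : List ℕ) (x : ℕ) : ℤ :=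
  (A.map fun y => if y ≤ x then (1 : ℤ) else 0).sum - (B.map fun y => if y < x then (1 : ℤ) else 0).sum

theorem excess_cons_left (a : ℕ) (A B : List ℕ) (x : ℕ) :
    excess (a :: A) B x = excess A B x + if a ≤ x then 1 else 0 := by
  simp only [excess, List.map_cons, List.sum_cons]; ring

theorem excess_cons_right (b : ℕ) (A B : List ℕ) (x : ℕ) :
    excess A (b :: B) x = excess A B x - if b < x then 1 else 0 := by
  simp only [excess, List.map_cons, List.sum_cons]; ring

theorem excess_nil (x : ℕ) : excess [] [] x = 0 := by simp [excess]

theorem excess_nonpos_of_lt {A : List ℕ} {x : ℕ} (h : ∀ y ∈ A, x < y) (B : List ℕ) :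
    excess A B x ≤ 0 := by
  induction A with
  | nil =>
    induction B with
    | nil => simp [excess_nil]
    | cons b B ih => rw [excess_cons_right]; split_ifs <;> omega
  | cons a A ih =>
    rw [excess_cons_left, if_neg (by have := h a (by simp); omega), add_zero]
    exact ih fun y hy => h y (by simp [hy])

theorem excess_nonneg_of_le {B : List ℕ} {x : ℕ} (h : ∀ y ∈ B, x ≤ y) (A : List ℕ) :
    0 ≤ excess A B x := by
  induction A with
  | nil =>
    induction B with
    | nil => simp [excess_nil]
    | cons b B ih =>
      rw [excess_cons_right, if_neg (by have := h b (by simp); omega), sub_zero]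
      exact ih fun y hy => h y (by simp [hy])
  | cons a A ih => rw [excess_cons_left]; split_ifs <;> omega

theorem excess_of_forall_lt {A B : List ℕ} {x : ℕ} (hA : ∀ y ∈ A, y ≤ x) (hB : ∀ y ∈ B, y < x) :
    excess A B x = A.length - B.length := by
  induction A with
  | nil =>
    induction B with
    | nil => simp [excess_nil]
    | cons b B ih =>
      rw [excess_cons_right, if_pos (hB b (by simp)), ih fun y hy => hB y (by simp [hy])]
      simp; ring
  | cons a A ih =>
    rw [excess_cons_left, if_pos (hA a (by simp)), ih fun y hy => hA y (by simp [hy])]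
    simp; ring

theorem ck_exchange {C : List ℕ} : ∀ {a : ℕ} {B : List ℕ}, (a :: C).Pairwise (· < ·) →
    (a :: B).Pairwise (· < ·) → (∀ x, excess C B x ≤ 0) →
    CKEquiv (a :: (C ++ B)) (C ++ a :: B) := by
  induction C with
  | nil => intro a B _ _ _; exact CKEquiv.refl _
  | cons c C ih =>
    intro a B hC hB h
    obtain ⟨hC1, hC2⟩ := List.pairwise_cons.mp hC
    obtain ⟨hB1, hB2⟩ := List.pairwise_cons.mp hB
    have hC2' := List.pairwise_cons.mp hC2
    rcases B with _ | ⟨b, B⟩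
    · have := h c
      rw [excess_cons_left, if_pos le_rfl] at this
      have h2 := excess_nonneg_of_le (B := []) (x := c) (by simp) C
      omega
    · have hB2' := List.pairwise_cons.mp hB2
      have hbc : b < c := by
        by_contra hbc
        have := h c
        rw [excess_cons_left, if_pos le_rfl] at this
        have h2 := excess_nonneg_of_le (B := b :: B) (x := c) (fun y hy => by
          rcases List.mem_cons.mp hy with rfl | hy
          · omega
          · have := hB2'.1 y hy; omega) C
        omega
      have hab := hB1 b (by simp)
      have hCB : ∀ x, excess C B x ≤ 0 := fun x => by
        rcases lt_or_ge x c with hx | hx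
        · exact excess_nonpos_of_lt (fun y hy => hx.trans (hC2'.1 y hy)) B
        · have := h x
          rw [excess_cons_left, excess_cons_right, if_pos hx, if_pos (by omega)] at this
          omega
      have hCB' : ∀ x, excess C (b :: B) x ≤ 0 := fun x => by
        rw [excess_cons_right]
        have := hCB x
        split_ifs <;> omega
      have h1 := (((ck_move_right hC2 hbc).append_right B).cons a)
      have h2 := (ck_left hab hbc).symm.append_right (C ++ B)
      have h3 := ((ih (a := b) (B := B) (List.pairwise_cons.mpr
        ⟨fun y hy => hbc.trans (hC2'.1 y hy), hC2'.2⟩) hB2 hCB).cons a).cons c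
      have h4 := (ih (a := a) (B := b :: B) (List.pairwise_cons.mpr
        ⟨fun y hy => hC1 y (by simp [hy]), hC2'.2⟩) hB hCB').cons c
      simp only [List.append_assoc, List.cons_append, List.nil_append] at h1 h2 h3 h4 ⊢
      exact h1.trans (h2.trans (h3.trans h4))

theorem ck_transfer {C : List ℕ} : ∀ {a : ℕ} {B : List ℕ}, (a :: C).Pairwise (· < ·) →
    B.Pairwise (· < ·) → (∀ b ∈ B, a ≤ b) → (∀ x, excess C B x ≤ 0) → Good (a :: (C ++ B)) →
    ∃ (z : ℕ) (Y : List ℕ), Y.Pairwise (· < ·) ∧ CKEquiv (a :: (C ++ B)) (C ++ Y) ∧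
      Y.Perm (z :: B) ∧ a ≤ z ∧ (∀ x, a < x → x ≤ z → x ∈ C) ∧ excess C Y z = 0 ∧
      (∀ x, excess C Y x ≤ 0) ∧ ∀ x, z < x → excess C Y x < 0 := by
  induction C with
  | nil =>
    intro a B hC hB hab h hg
    have hB1 : (a :: B).Pairwise (· < ·) := by
      refine List.pairwise_cons.mpr ⟨fun b hb => lt_of_le_of_ne (hab b hb) ?_, hB⟩
      rintro rfl
      rcases B with _ | ⟨b, B⟩
      · simp at hb
      · have hne := hg.ne
        rcases List.mem_cons.mp hb with rfl | hb'
        · exact hne rfl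
        · have := (List.pairwise_cons.mp hB).1 _ hb'
          have := hab b (by simp)
          omega
    refine ⟨a, a :: B, hB1, CKEquiv.refl _, List.Perm.refl _, le_rfl, fun x h1 h2 => by omega,
      ?_, ?_, ?_⟩
    · refine le_antisymm (excess_nonpos_of_lt (by simp) _) (excess_nonneg_of_le ?_ _)
      intro y hy
      rcases List.mem_cons.mp hy with rfl | hy
      exacts [le_rfl, hab y hy]
    · exact fun x => excess_nonpos_of_lt (by simp) _
    · intro x hx
      have := h x
      rw [excess_cons_right, if_pos hx]; omega
  | cons c C ih =>
    intro a B hC hB hab h hg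
    obtain ⟨hC1, hC2⟩ := List.pairwise_cons.mp hC
    have hC2' := List.pairwise_cons.mp hC2
    have hac := hC1 c (by simp)
    by_cases haB : a ∈ B
    · rcases B with _ | ⟨b, B⟩
      · simp at haB
      have hB' := List.pairwise_cons.mp hB
      obtain rfl : a = b := by
        rcases List.mem_cons.mp haB with rfl | haB
        · rfl
        · have := hB'.1 _ haB
          have := hab b (by simp)
          omega
      have h1 := (((ck_move_right hC2 hac).append_right B).cons a)
      have hg1 : Good (a :: c :: a :: (C ++ B)) := hg.equiv (by simpa using h1)
      have hc : c = a + 1 := by have := hg1.braid; omega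
      subst hc
      have h2 := (ck_braid a).append_right (C ++ B)
      have hg2 : Good ((a + 1) :: (C ++ B)) :=
        Good.right (c := [a + 1, a]) (hg1.equiv (by simpa using h2))
      obtain ⟨z, Y, hY, hYe, hYp, hz, hzC, e1, e2, e3⟩ := ih hC2 hB'.2
        (fun b hb => hB'.1 b hb) (fun x => by
          rcases lt_or_ge x (a + 1) with hx | hx
          · exact excess_nonpos_of_lt (fun y hy => hx.trans (hC2'.1 y hy)) B
          · have := h x
            rw [excess_cons_left, excess_cons_right, if_pos hx, if_pos (by omega)] at this
            omega) hg2
      have haY : (a :: Y).Pairwise (· < ·) := by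
        refine List.pairwise_cons.mpr ⟨fun y hy => ?_, hY⟩
        rcases List.mem_cons.mp (hYp.mem_iff.mp hy) with rfl | hy
        exacts [by omega, hB'.1 y hy]
      have haC : (a :: C).Pairwise (· < ·) :=
        List.pairwise_cons.mpr ⟨fun y hy => hC1 y (by simp [hy]), hC2'.2⟩
      have h3 := (hYe.cons a).cons (a + 1)
      have h4 := (ck_exchange haC haY e2).cons (a + 1)
      have hex : ∀ x, a + 1 ≤ x → excess ((a + 1) :: C) (a :: Y) x = excess C Y x := fun x hx => by
        rw [excess_cons_left, excess_cons_right, if_pos hx, if_pos (by omega)]; ring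
      refine ⟨z, a :: Y, haY, ?_, (hYp.cons a).trans (List.Perm.swap _ _ _), by omega, ?_, ?_,
        ?_, ?_⟩
      · simp only [List.append_assoc, List.cons_append, List.nil_append] at h1 h2 h3 h4 ⊢
        exact h1.trans (h2.trans (h3.trans h4))
      · intro x hx hxz
        rcases eq_or_ne x (a + 1) with rfl | hx'
        · simp
        · exact List.mem_cons_of_mem _ (hzC x (by omega) hxz)
      · rw [hex z hz, e1]
      · intro x
        rcases lt_or_ge x (a + 1) with hx | hx
        · refine excess_nonpos_of_lt (fun y hy => ?_) _
          rcases List.mem_cons.mp hy with rfl | hy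
          exacts [hx, hx.trans (hC2'.1 y hy)]
        · rw [hex x hx]; exact e2 x
      · intro x hx
        rw [hex x (by omega)]; exact e3 x hx
    · have hB1 : (a :: B).Pairwise (· < ·) := List.pairwise_cons.mpr
        ⟨fun b hb => lt_of_le_of_ne (hab b hb) (by rintro rfl; exact haB hb), hB⟩
      refine ⟨a, a :: B, hB1, ck_exchange hC hB1 h, List.Perm.refl _, le_rfl,
        fun x h1 h2 => by omega, ?_, ?_, ?_⟩
      · refine le_antisymm (excess_nonpos_of_lt hC1 _) (excess_nonneg_of_le ?_ _)
        intro y hy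
        rcases List.mem_cons.mp hy with rfl | hy
        exacts [le_rfl, hab y hy]
      · intro x
        have := h x
        rw [excess_cons_right]; split_ifs <;> omega
      · intro x hx
        have := h x
        rw [excess_cons_right, if_pos hx]; omega

/-- The relation between a pair of blocks and the pair obtained by moving one letter from the
first to the second block. -/
def Moved (A B X Y : List ℕ) : Prop :=
  ∃ a z, A.Perm (a :: X) ∧ Y.Perm (z :: B) ∧ a ≤ z ∧ (∀ x, a < x → x ≤ z → x ∈ X) ∧
    (∀ x, excess X Y x ≤ excess X Y z) ∧ (∀ x, z < x → excess X Y x < excess X Y z) ∧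
    (∀ x, excess A B x ≤ excess X Y z + 1) ∧ 0 ≤ excess X Y z

theorem exists_moved {A : List ℕ} : ∀ {B : List ℕ}, A.Pairwise (· < ·) → B.Pairwise (· < ·) →
    Good (A ++ B) → (∃ x, 1 ≤ excess A B x) →
    ∃ X Y : List ℕ, X.Pairwise (· < ·) ∧ Y.Pairwise (· < ·) ∧ CKEquiv (A ++ B) (X ++ Y) ∧
      Moved A B X Y := by
  induction A with
  | nil =>
    rintro B _ _ _ ⟨x, hx⟩
    have := excess_nonpos_of_lt (A := []) (x := x) (by simp) B
    omega
  | cons a₀ A ih =>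
    rintro B hA hB hg ⟨x₀, hx₀⟩
    obtain ⟨hA1, hA2⟩ := List.pairwise_cons.mp hA
    by_cases hpair : ∃ b B', B = b :: B' ∧ b < a₀
    · obtain ⟨b, B, rfl, hb⟩ := hpair
      obtain ⟨hB1, hB2⟩ := List.pairwise_cons.mp hB
      have h1 := (ck_move_right hA hb).append_right B
      have hg1 : Good (A ++ B) :=
        Good.right (c := [a₀, b]) (hg.equiv (by simpa using h1))
      have hx1 : 1 ≤ excess A B x₀ := by
        have hax : a₀ ≤ x₀ := by
          by_contra hc
          have := excess_nonpos_of_lt (A := a₀ :: A) (x := x₀) (fun y hy => by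
            rcases List.mem_cons.mp hy with rfl | hy
            · omega
            · have := hA1 y hy; omega) (b :: B)
          omega
        rw [excess_cons_left, excess_cons_right, if_pos hax, if_pos (by omega)] at hx₀
        omega
      obtain ⟨X, Y, hX, hY, hXY, a, z, p1, p2, haz, hzX, m1, m2, m3, m4⟩ := ih hA2 hB2 hg1 ⟨x₀, hx1⟩
      have haA : a ∈ A := p1.mem_iff.mpr (by simp)
      have ha₀z : a₀ < z := lt_of_lt_of_le (hA1 a haA) haz
      have hX' : (a₀ :: X).Pairwise (· < ·) :=
        List.pairwise_cons.mpr ⟨fun y hy => hA1 y (p1.mem_iff.mpr (by simp [hy])), hX⟩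
      have hY' : (b :: Y).Pairwise (· < ·) := by
        refine List.pairwise_cons.mpr ⟨fun y hy => ?_, hY⟩
        rcases List.mem_cons.mp (p2.mem_iff.mp hy) with rfl | hy
        exacts [hb.trans ha₀z, hB1 y hy]
      have h2 := ((ck_move_right hX' hb).append_right Y).symm
      have h3 := (hXY.cons b).cons a₀
      have hex : ∀ (C D : List ℕ) x, excess (a₀ :: C) (b :: D) x ≤ excess C D x := fun C D x => by
        rw [excess_cons_left, excess_cons_right]; split_ifs <;> omega
      have hexz : excess (a₀ :: X) (b :: Y) z = excess X Y z := by
        rw [excess_cons_left, excess_cons_right, if_pos ha₀z.le, if_pos (by omega)]; ring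
      refine ⟨a₀ :: X, b :: Y, hX', hY', ?_, a, z, (p1.cons a₀).trans (List.Perm.swap _ _ _),
        (p2.cons b).trans (List.Perm.swap _ _ _), haz,
        fun x h1 h2 => List.mem_cons_of_mem _ (hzX x h1 h2), ?_, ?_, ?_, ?_⟩
      · simp only [List.append_assoc, List.cons_append, List.nil_append] at h1 h2 h3 ⊢
        exact h1.trans (h3.trans h2)
      · exact fun x => hexz ▸ (hex X Y x).trans (m1 x)
      · exact fun x hx => hexz ▸ (hex X Y x).trans_lt (m2 x hx)
      · exact fun x => hexz ▸ (hex A B x).trans (m3 x)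
      · exact hexz ▸ m4
    · have hB0 : ∀ b ∈ B, a₀ ≤ b := by
        intro b hb
        rcases B with _ | ⟨c, B⟩
        · simp at hb
        · have hc : a₀ ≤ c := not_lt.mp fun h => hpair ⟨c, B, rfl, h⟩
          rcases List.mem_cons.mp hb with rfl | hb
          exacts [hc, hc.trans ((List.pairwise_cons.mp hB).1 b hb).le]
      by_cases hsk : ∃ x, 1 ≤ excess A B x
      · obtain ⟨X, Y, hX, hY, hXY, a, z, p1, p2, haz, hzX, m1, m2, m3, m4⟩ :=
          ih hA2 hB (Good.tail hg) hsk
        have haA : a ∈ A := p1.mem_iff.mpr (by simp)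
        have ha₀z : a₀ < z := lt_of_lt_of_le (hA1 a haA) haz
        have hX' : (a₀ :: X).Pairwise (· < ·) :=
          List.pairwise_cons.mpr ⟨fun y hy => hA1 y (p1.mem_iff.mpr (by simp [hy])), hX⟩
        have hexz : excess (a₀ :: X) Y z = excess X Y z + 1 := by
          rw [excess_cons_left, if_pos ha₀z.le]
        have hex : ∀ (C D : List ℕ) x, excess (a₀ :: C) D x ≤ excess C D x + 1 := fun C D x => by
          rw [excess_cons_left]; split_ifs <;> omega
        refine ⟨a₀ :: X, Y, hX', hY, hXY.cons a₀, a, z, (p1.cons a₀).trans (List.Perm.swap _ _ _),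
          p2, haz, fun x h1 h2 => List.mem_cons_of_mem _ (hzX x h1 h2), ?_, ?_, ?_, ?_⟩
        · intro x
          have := hex X Y x
          have := m1 x
          omega
        · intro x hx
          have := hex X Y x
          have := m2 x hx
          omega
        · intro x
          have := hex A B x
          have := m3 x
          omega
        · omega
      · push Not at hsk
        obtain ⟨z, Y, hY, hYe, hYp, hz, hzC, e1, e2, e3⟩ := ck_transfer hA hB hB0
          (fun x => by have := hsk x; omega) hg
        refine ⟨A, Y, hA2, hY, hYe, a₀, z, List.Perm.refl _, hYp, hz, hzC, ?_, ?_, ?_, ?_⟩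
        · rw [e1]; exact e2
        · rw [e1]; exact e3
        · intro x
          have := hsk x
          rw [excess_cons_left, e1]; split_ifs <;> omega
        · omega

theorem perm_eq_of_increasing {A B : List ℕ} (hA : A.Pairwise (· < ·)) (hB : B.Pairwise (· < ·))
    (h : A.Perm B) : A = B :=
  h.eq_of_pairwise (fun a b _ _ h1 h2 => absurd h1 (by omega)) hA hB

theorem Moved.unique {A B A' B' X Y : List ℕ} (hA : A.Pairwise (· < ·))
    (hB : B.Pairwise (· < ·)) (hA' : A'.Pairwise (· < ·)) (hB' : B'.Pairwise (· < ·))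
    (h : Moved A B X Y) (h' : Moved A' B' X Y) : A = A' ∧ B = B' := by
  obtain ⟨a, z, p1, p2, haz, hzX, m1, m2, -⟩ := h
  obtain ⟨a', z', p1', p2', haz', hzX', m1', m2', -⟩ := h'
  have hna : ∀ {A : List ℕ} {a}, A.Pairwise (· < ·) → A.Perm (a :: X) → a ∉ X := by
    intro A a hA p ha
    have hn : (a :: X).Nodup := p.nodup_iff.mp (hA.imp fun h => h.ne)
    exact (List.nodup_cons.mp hn).1 ha
  obtain rfl : z = z' := by
    rcases lt_trichotomy z z' with h | h | h
    · have := m2 z' h; have := m1' z; omega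
    · exact h
    · have := m2' z h; have := m1 z'; omega
  obtain rfl : a = a' := by
    rcases lt_trichotomy a a' with h | h | h
    · exact absurd (hzX a' h haz') (hna hA' p1')
    · exact h
    · exact absurd (hzX' a h haz) (hna hA p1)
  exact ⟨perm_eq_of_increasing hA hA' (p1.trans p1'.symm),
    perm_eq_of_increasing hB hB' ((p2.symm.trans p2').cons_inv)⟩

/-- Pairs of increasing blocks of lengths `p` and `q` whose concatenation is equivalent to `c`. -/
def blockPairs (c : List ℕ) (p q : ℕ) : Set (List ℕ × List ℕ) :=
  {P | P.1.Pairwise (· < ·) ∧ P.2.Pairwise (· < ·) ∧ P.1.length = p ∧ P.2.length = q ∧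
    CKEquiv c (P.1 ++ P.2)}

/-- There is an injective map between two sets. -/
def Injects {α : Type*} (s t : Set α) : Prop := ∃ f : α → α, Set.MapsTo f s t ∧ Set.InjOn f s

theorem Injects.refl {α : Type*} (s : Set α) : Injects s s :=
  ⟨id, Set.mapsTo_id s, Set.injOn_id s⟩

theorem Injects.trans {α : Type*} {s t u : Set α} (h : Injects s t) (h' : Injects t u) :
    Injects s u := by
  obtain ⟨f, hf1, hf2⟩ := h
  obtain ⟨g, hg1, hg2⟩ := h'
  exact ⟨g ∘ f, hg1.comp hf1, hg2.comp hf2 hf1⟩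

theorem injects_of_rel {α : Type*} {s t : Set α} (R : α → α → Prop)
    (h : ∀ a ∈ s, ∃ b ∈ t, R a b) (hR : ∀ a ∈ s, ∀ a' ∈ s, ∀ b, R a b → R a' b → a = a') :
    Injects s t := by
  refine ⟨fun a => if ha : a ∈ s then (h a ha).choose else a, ?_, ?_⟩
  · intro a ha
    simp only [dif_pos ha]
    exact (h a ha).choose_spec.1
  · intro a ha a' ha' e
    simp only [dif_pos ha, dif_pos ha'] at e
    exact hR a ha a' ha' _ (h a ha).choose_spec.2 (e ▸ (h a' ha').choose_spec.2)

theorem injects_blockPairs_moves {c : List ℕ} (hc : Good c) (m p q : ℕ) :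
    Injects (blockPairs c (p + m) q ∩ {P | m = 0 ∨ ∃ x, (m : ℤ) ≤ excess P.1 P.2 x})
      (blockPairs c p (q + m)) := by
  induction m generalizing q with
  | zero =>
    simp only [true_or, add_zero, Set.setOf_true, Set.inter_univ]
    exact Injects.refl _
  | succ m ih =>
    have h1 := ih (q + 1)
    rw [show q + 1 + m = q + (m + 1) by omega] at h1
    refine Injects.trans (injects_of_rel (fun P Q => Moved P.1 P.2 Q.1 Q.2) ?_ ?_) h1
    · rintro ⟨A, B⟩ ⟨⟨hA, hB, hp, hq, hcAB⟩, hm⟩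
      obtain ⟨x, hx⟩ := hm.resolve_left (by omega)
      simp only at hA hB hp hq hcAB hx
      obtain ⟨X, Y, hX, hY, hXY, hM⟩ := exists_moved hA hB (hc.equiv hcAB) ⟨x, by push_cast at hx; omega⟩
      obtain ⟨a, z, p1, p2, haz, hzX, m1, m2, m3, m4⟩ := id hM
      refine ⟨(X, Y), ⟨⟨hX, hY, ?_, ?_, hcAB.trans hXY⟩, ?_⟩, hM⟩
      · have := p1.length_eq
        simp only [List.length_cons] at this ⊢; omega
      · have := p2.length_eq
        simp only [List.length_cons] at this ⊢; omega
      · right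
        have := m3 x
        exact ⟨z, by push_cast at hx; simp only; omega⟩
    · rintro ⟨A, B⟩ ⟨⟨hA, hB, -⟩, -⟩ ⟨A', B'⟩ ⟨⟨hA', hB', -⟩, -⟩ Q h h'
      have := Moved.unique hA hB hA' hB' h h'
      exact Prod.ext this.1 this.2

theorem injects_blockPairs_of_le {c : List ℕ} (hc : Good c) {p q : ℕ} (h : q ≤ p) :
    Injects (blockPairs c p q) (blockPairs c q p) := by
  have h1 := injects_blockPairs_moves hc (p - q) q q
  rw [show q + (p - q) = p by omega] at h1
  refine Injects.trans ⟨id, ?_, Set.injOn_id _⟩ h1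
  rintro ⟨A, B⟩ hP
  refine ⟨hP, Or.inr ⟨(A ++ B).sum + 1, ?_⟩⟩
  have hle : ∀ y ∈ A ++ B, y < (A ++ B).sum + 1 := fun y hy =>
    Nat.lt_succ_of_le (List.single_le_sum (by simp) y hy)
  have := excess_of_forall_lt (A := A) (B := B) (x := (A ++ B).sum + 1)
    (fun y hy => (hle y (by simp [hy])).le) fun y hy => hle y (by simp [hy])
  change ((p - q : ℕ) : ℤ) ≤ excess A B _
  rw [this]
  have h1 := hP.2.2.1
  have h2 := hP.2.2.2.1
  simp only at h1 h2
  omega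

theorem injects_blockPairs {c : List ℕ} (hc : Good c) (p q : ℕ) :
    Injects (blockPairs c p q) (blockPairs c q p) := by
  rcases le_total q p with h | h
  · exact injects_blockPairs_of_le hc h
  · have hK : ∀ x ∈ c, x ≤ c.sum := fun y hy => List.single_le_sum (by simp) y hy
    set K := c.sum
    have step : ∀ {c : List ℕ} {p q : ℕ}, (∀ x ∈ c, x ≤ K) → Injects (blockPairs c p q)
        (blockPairs (revComp K c) q p) := by
      intro c p q hK
      refine ⟨fun P => (revComp K P.2, revComp K P.1), ?_, ?_⟩
      · rintro ⟨A, B⟩ ⟨hA, hB, hp, hq, hcAB⟩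
        simp only at hA hB hp hq hcAB
        have hAB : ∀ x ∈ A ++ B, x ≤ K := fun x hx => hK x ((hcAB.mem_iff x).mpr hx)
        refine ⟨pairwise_revComp hB fun x hx => hAB x (by simp [hx]),
          pairwise_revComp hA fun x hx => hAB x (by simp [hx]), by simp [length_revComp, hq],
          by simp [length_revComp, hp], ?_⟩
        simp only
        rw [← revComp_append]
        exact hcAB.revComp hK
      · rintro ⟨A, B⟩ ⟨hA, hB, hp, hq, hcAB⟩ ⟨A', B'⟩ ⟨hA', hB', hp', hq', hcAB'⟩ e
        simp only at hcAB hcAB'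
        have hAB : ∀ x ∈ A ++ B, x ≤ K := fun x hx => hK x ((hcAB.mem_iff x).mpr hx)
        have hAB' : ∀ x ∈ A' ++ B', x ≤ K := fun x hx => hK x ((hcAB'.mem_iff x).mpr hx)
        simp only [Prod.mk.injEq] at e
        have e1 := congrArg (revComp K) e.1
        have e2 := congrArg (revComp K) e.2
        rw [revComp_revComp fun x hx => hAB x (by simp [hx]),
          revComp_revComp fun x hx => hAB' x (by simp [hx])] at e1 e2
        rw [e1, e2]
    have h1 := step (p := p) (q := q) hK
    have h2 := injects_blockPairs_of_le (hc.revComp hK) h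
    have h3 := step (c := revComp K c) (p := p) (q := q) fun x hx => mem_revComp_le hx
    rw [revComp_revComp hK] at h3
    exact (h1.trans h2).trans h3

/-- An injective map on good pairs of increasing blocks which exchanges the two lengths and
preserves the equivalence class of the concatenation. -/
theorem exists_exchange : ∃ θ : List ℕ × List ℕ → List ℕ × List ℕ,
    (∀ A B : List ℕ, A.Pairwise (· < ·) → B.Pairwise (· < ·) → Good (A ++ B) →
      (θ (A, B)).1.Pairwise (· < ·) ∧ (θ (A, B)).2.Pairwise (· < ·) ∧
      (θ (A, B)).1.length = B.length ∧ (θ (A, B)).2.length = A.length ∧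
      CKEquiv (A ++ B) ((θ (A, B)).1 ++ (θ (A, B)).2)) ∧
    Set.InjOn θ {P | P.1.Pairwise (· < ·) ∧ P.2.Pairwise (· < ·) ∧ Good (P.1 ++ P.2)} := by
  classical
  let cls : List ℕ → Set (List ℕ) := fun u => {v | CKEquiv u v}
  have hcls : ∀ u v : List ℕ, CKEquiv u v → cls u = cls v := fun u v h => by
    ext x
    exact ⟨fun h' => h.symm.trans h', fun h' => h.trans h'⟩
  let BP : Set (List ℕ) → ℕ → ℕ → Set (List ℕ × List ℕ) := fun C p q =>
    {P | P.1.Pairwise (· < ·) ∧ P.2.Pairwise (· < ·) ∧ P.1.length = p ∧ P.2.length = q ∧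
      P.1 ++ P.2 ∈ C}
  have hBP : ∀ c p q, BP (cls c) p q = blockPairs c p q := fun c p q => rfl
  let g : Set (List ℕ) → ℕ → ℕ → List ℕ × List ℕ → List ℕ × List ℕ := fun C p q =>
    if h : Injects (BP C p q) (BP C q p) then h.choose else id
  have hg : ∀ c p q, Good c → Set.MapsTo (g (cls c) p q) (BP (cls c) p q) (BP (cls c) q p) ∧
      Set.InjOn (g (cls c) p q) (BP (cls c) p q) := fun c p q hc => by
    have h : Injects (BP (cls c) p q) (BP (cls c) q p) := by
      rw [hBP, hBP]; exact injects_blockPairs hc p q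
    simp only [g, dif_pos h]
    exact h.choose_spec
  let θ : List ℕ × List ℕ → List ℕ × List ℕ := fun P =>
    g (cls (P.1 ++ P.2)) P.1.length P.2.length P
  have hself : ∀ P : List ℕ × List ℕ, P.1.Pairwise (· < ·) → P.2.Pairwise (· < ·) →
      P ∈ BP (cls (P.1 ++ P.2)) P.1.length P.2.length := fun P h1 h2 =>
    ⟨h1, h2, rfl, rfl, CKEquiv.refl _⟩
  have hθ : ∀ P : List ℕ × List ℕ, P.1.Pairwise (· < ·) → P.2.Pairwise (· < ·) →
      Good (P.1 ++ P.2) → θ P ∈ BP (cls (P.1 ++ P.2)) P.2.length P.1.length :=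
    fun P h1 h2 h3 => (hg _ _ _ h3).1 (hself P h1 h2)
  refine ⟨θ, fun A B hA hB hG => hθ (A, B) hA hB hG, ?_⟩
  rintro P ⟨h1, h2, h3⟩ P' ⟨h1', h2', h3'⟩ e
  have k := hθ P h1 h2 h3
  have k' := hθ P' h1' h2' h3'
  rw [← e] at k'
  have e1 : P.2.length = P'.2.length := k.2.2.1.symm.trans k'.2.2.1
  have e2 : P.1.length = P'.1.length := k.2.2.2.1.symm.trans k'.2.2.2.1
  have e3 : cls (P.1 ++ P.2) = cls (P'.1 ++ P'.2) :=
    (hcls _ _ k.2.2.2.2).trans (hcls _ _ k'.2.2.2.2).symm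
  refine (hg (P.1 ++ P.2) P.1.length P.2.length h3).2 (hself P h1 h2) ?_ ?_
  · rw [e1, e2, e3]; exact hself P' h1' h2'
  · have : θ P' = g (cls (P.1 ++ P.2)) P.1.length P.2.length P' := by
      simp only [θ, e1, e2, e3]
    rw [← this]; exact e

/-! ### Monotonicity of the first column -/

theorem mem_insL_iff {a x : ℕ} {S : List ℕ} (hS : S.Pairwise (· < ·)) :
    x ∈ (insL a S).1 ↔ x = a ∨ (x ∈ S ∧ (x < a ∨ a ∈ S ∨ ∃ y ∈ S, a < y ∧ y < x)) := by
  induction S with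
  | nil => simp [insL]
  | cons s S ih =>
    have hS' := (List.pairwise_cons.mp hS).1
    rcases lt_trichotomy a s with h | rfl | h
    · rw [insL_lt S h]
      have ha : a ∉ S := fun h' => by have := hS' a h'; omega
      simp only [List.mem_cons]
      constructor
      · rintro (hx | hx)
        · exact Or.inl hx
        · exact Or.inr ⟨Or.inr hx, Or.inr (Or.inr ⟨s, Or.inl rfl, h, hS' x hx⟩)⟩
      · rintro (hx | ⟨rfl | hx, h1 | h1 | ⟨y, hy, h1, h2⟩⟩)
        · exact Or.inl hx
        · omega
        · rcases h1 with h1 | h1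
          · omega
          · exact absurd h1 ha
        · rcases hy with rfl | hy
          · omega
          · have := hS' y hy; omega
        all_goals exact Or.inr hx
    · rw [insL_eq]
      simp
    · rw [insL_gt S h]
      simp only [List.mem_cons, ih (List.pairwise_cons.mp hS).2]
      constructor
      · rintro (rfl | rfl | ⟨hx, h1⟩)
        · exact Or.inr ⟨Or.inl rfl, Or.inl h⟩
        · exact Or.inl rfl
        · refine Or.inr ⟨Or.inr hx, ?_⟩
          rcases h1 with h1 | h1 | ⟨y, hy, h1⟩
          · exact Or.inl h1
          · exact Or.inr (Or.inl (Or.inr h1))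
          · exact Or.inr (Or.inr ⟨y, Or.inr hy, h1⟩)
      · rintro (rfl | ⟨rfl | hx, h1⟩)
        · exact Or.inr (Or.inl rfl)
        · exact Or.inl rfl
        · refine Or.inr (Or.inr ⟨hx, ?_⟩)
          rcases h1 with h1 | (h1 | h1) | ⟨y, rfl | hy, h1⟩
          · exact Or.inl h1
          · omega
          · exact Or.inr (Or.inl h1)
          · omega
          · exact Or.inr (Or.inr ⟨y, hy, h1⟩)

theorem length_insL {a : ℕ} {S : List ℕ} (hS : S.Pairwise (· < ·)) :
    (insL a S).1.length = if ∀ y ∈ S, y < a then S.length + 1 else S.length := by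
  induction S with
  | nil => simp [insL]
  | cons s S ih =>
    rcases lt_trichotomy a s with h | rfl | h
    · rw [insL_lt S h, if_neg (fun h' => by have := h' s (by simp); omega)]
      simp
    · rw [insL_eq, if_neg (fun h' => by have := h' a (by simp); omega)]
    · rw [insL_gt S h]
      simp only [List.length_cons, ih (List.pairwise_cons.mp hS).2, List.forall_mem_cons]
      by_cases h' : ∀ y ∈ S, y < a
      · rw [if_pos h', if_pos ⟨h, h'⟩]
      · rw [if_neg h', if_neg (fun h2 => h' h2.2)]

theorem insW_mono {u S S' : List ℕ} (hS : S.Pairwise (· < ·)) (hS' : S'.Pairwise (· < ·))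
    (h : S ⊆ S') (hl : S'.length ≤ S.length + 1) :
    (insW u S).1 ⊆ (insW u S').1 ∧ (insW u S').1.length ≤ (insW u S).1.length + 1 := by
  induction u with
  | nil => exact ⟨h, hl⟩
  | cons a u ih =>
    have h1 := pairwise_insW (u := u) hS
    have h2 := pairwise_insW (u := u) hS'
    simp only [insW]
    refine ⟨fun x hx => ?_, ?_⟩
    · rw [mem_insL_iff h1] at hx
      rw [mem_insL_iff h2]
      rcases hx with rfl | ⟨hx, h3⟩
      · exact Or.inl rfl
      · refine Or.inr ⟨ih.1 hx, ?_⟩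
        rcases h3 with h3 | h3 | ⟨y, hy, h3⟩
        · exact Or.inl h3
        · exact Or.inr (Or.inl (ih.1 h3))
        · exact Or.inr (Or.inr ⟨y, ih.1 hy, h3⟩)
    · rw [length_insL h1, length_insL h2]
      by_cases h3 : ∀ y ∈ (insW u S').1, y < a
      · rw [if_pos h3, if_pos (fun y hy => h3 y (ih.1 hy))]
        have := ih.2; omega
      · rw [if_neg h3]
        have := ih.2
        split_ifs <;> omega

theorem insW_subset {u S S' : List ℕ} (hS : S.Pairwise (· < ·)) (hS' : S'.Pairwise (· < ·))
    (h : S ⊆ S') : (insW u S).1 ⊆ (insW u S').1 := by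
  induction u with
  | nil => exact h
  | cons a u ih =>
    have h1 := pairwise_insW (u := u) hS
    have h2 := pairwise_insW (u := u) hS'
    simp only [insW]
    intro x hx
    rw [mem_insL_iff h1] at hx
    rw [mem_insL_iff h2]
    rcases hx with rfl | ⟨hx, h3⟩
    · exact Or.inl rfl
    · refine Or.inr ⟨ih hx, ?_⟩
      rcases h3 with h3 | h3 | ⟨y, hy, h3⟩
      · exact Or.inl h3
      · exact Or.inr (Or.inl (ih h3))
      · exact Or.inr (Or.inr ⟨y, ih hy, h3⟩)

theorem colA_increasing {b : ℕ} {B : List ℕ} (h : (b :: B).Pairwise (· < ·)) :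
    colA (b :: B) = [b] ∧ colR (b :: B) = B := by
  induction B generalizing b with
  | nil => simp [colA, colR, insW, insL]
  | cons c B ih =>
    rw [List.pairwise_cons] at h
    have hc := ih h.2
    unfold colA colR at hc ⊢
    rw [insW, hc.1, hc.2, insL_lt _ (h.1 c (by simp))]
    exact ⟨rfl, rfl⟩

/-- The set of entries of the first column. -/
def colSet (ρ : List ℕ) : Finset ℕ := (colA ρ).toFinset

theorem mem_colSet {ρ : List ℕ} {x : ℕ} : x ∈ colSet ρ ↔ x ∈ colA ρ := by simp [colSet]

theorem card_colSet (ρ : List ℕ) : (colSet ρ).card = (colA ρ).length :=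
  List.toFinset_card_of_nodup ((pairwise_colA ρ).imp (fun h => ne_of_lt h))

theorem mem_of_mem_colSet {ρ : List ℕ} {x : ℕ} (h : x ∈ colSet ρ) : x ∈ ρ := by
  rw [mem_colSet] at h
  simpa using mem_of_mem_insW h

theorem colSet_subset_append (u v : List ℕ) : colSet u ⊆ colSet (u ++ v) := by
  intro x hx
  rw [mem_colSet] at hx ⊢
  rw [colA_append]
  exact insW_subset List.Pairwise.nil (pairwise_colA v) (List.nil_subset _) hx

theorem card_colSet_append {u B : List ℕ} (hB : B.Pairwise (· < ·)) :
    (colSet (u ++ B)).card ≤ (colSet u).card + 1 := by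
  rw [card_colSet, card_colSet, colA_append]
  refine (insW_mono List.Pairwise.nil (pairwise_colA B) (List.nil_subset _) ?_).2
  cases B with
  | nil => simp [colA, insW]
  | cons b B => simp [(colA_increasing hB).1]

theorem card_filter_colSet_append {u B : List ℕ} (hB : B.Pairwise (· < ·)) (p : ℕ → Prop) :
    ((colSet (u ++ B)).filter p).card ≤ ((colSet u).filter p).card + 1 := by
  have h1 := Finset.card_filter_add_card_filter_not (s := colSet (u ++ B)) p
  have h2 := Finset.card_filter_add_card_filter_not (s := colSet u) p
  have h3 := card_colSet_append (u := u) hB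
  have h4 := Finset.card_le_card (Finset.filter_subset_filter (fun x => ¬ p x)
    (colSet_subset_append u B))
  omega

theorem min_mem_colSet {u : List ℕ} {m : ℕ} (hm : m ∈ u) (h : ∀ x ∈ u, m ≤ x) : m ∈ colSet u := by
  rw [mem_colSet]
  unfold colA
  induction u with
  | nil => simp at hm
  | cons a u ih =>
    rw [insW, mem_insL_iff (pairwise_insW List.Pairwise.nil)]
    by_cases hma : m = a
    · exact Or.inl hma
    · have hmu : m ∈ u := by simpa [hma] using hm
      refine Or.inr ⟨ih hmu (fun x hx => h x (by simp [hx])), Or.inl ?_⟩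
      have := h a (by simp)
      omega

theorem exists_mem_colSet_le {u : List ℕ} {x : ℕ} (hx : x ∈ u) : ∃ m ∈ colSet u, m ≤ x := by
  obtain ⟨m, hm, h⟩ := u.toFinset.exists_min_image id ⟨x, by simpa using hx⟩
  exact ⟨m, min_mem_colSet (by simpa using hm) (fun y hy => h y (by simpa using hy)),
    h x (by simpa using hx)⟩

theorem CKEquiv.colSet_eq {ρ σ : List ℕ} (h : CKEquiv ρ σ) (hg : Good ρ) :
    colSet ρ = colSet σ := by
  unfold colSet; rw [(h.colA_colR hg).1]

/-! ### Flagged increasing factorizations of an equivalence class -/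

/-- The concatenation of the blocks of `f` with indices `k + m, …, k + 1`. -/
def blk (f : ℕ → List ℕ) (k : ℕ) : ℕ → List ℕ
  | 0 => []
  | m + 1 => f (k + m + 1) ++ blk f k m

theorem blk_add (f : ℕ → List ℕ) (k m m' : ℕ) :
    blk f k (m + m') = blk f (k + m) m' ++ blk f k m := by
  induction m' with
  | zero => simp [blk]
  | succ m' ih =>
    rw [← add_assoc, blk, blk, ih, List.append_assoc]
    simp only [add_assoc]

theorem mem_blk {f : ℕ → List ℕ} {k m x : ℕ} :
    x ∈ blk f k m ↔ ∃ i, k < i ∧ i ≤ k + m ∧ x ∈ f i := by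
  induction m with
  | zero => simp only [blk, List.not_mem_nil, false_iff]; rintro ⟨i, h1, h2, -⟩; omega
  | succ m ih =>
    rw [blk, List.mem_append, ih]
    constructor
    · rintro (h | ⟨i, h1, h2, h3⟩)
      · exact ⟨k + m + 1, by omega, by omega, h⟩
      · exact ⟨i, h1, by omega, h3⟩
    · rintro ⟨i, h1, h2, h3⟩
      by_cases hi : i = k + m + 1
      · exact Or.inl (hi ▸ h3)
      · exact Or.inr ⟨i, h1, by omega, h3⟩

theorem blk_congr {f g : ℕ → List ℕ} {k m : ℕ} (h : ∀ i, k < i → i ≤ k + m → f i = g i) :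
    blk f k m = blk g k m := by
  induction m with
  | zero => rfl
  | succ m ih =>
    rw [blk, blk, ih (fun i h1 h2 => h i h1 (by omega)), h _ (by omega) (by omega)]

theorem blk_split (f : ℕ → List ℕ) {k n : ℕ} (h : k ≤ n) :
    blk f 0 n = blk f k (n - k) ++ blk f 0 k := by
  obtain ⟨m, rfl⟩ := Nat.exists_eq_add_of_le h
  simpa using blk_add f 0 k m

theorem blk_split_pair (f : ℕ → List ℕ) {j n : ℕ} (hj : 1 ≤ j) (h : j + 1 ≤ n) :
    blk f 0 n = blk f (j + 1) (n - (j + 1)) ++ (f (j + 1) ++ f j) ++ blk f 0 (j - 1) := by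
  obtain ⟨j, rfl⟩ : ∃ i, j = i + 1 := ⟨j - 1, by omega⟩
  rw [blk_split f h, blk, blk]
  simp

theorem card_filter_colSet_blk (u : List ℕ) {f : ℕ → List ℕ} (hf : ∀ i, (f i).Pairwise (· < ·))
    (p : ℕ → Prop) (k m : ℕ) :
    ((colSet (u ++ blk f k m)).filter p).card ≤ ((colSet u).filter p).card + m := by
  induction m generalizing u with
  | zero => simp [blk]
  | succ m ih =>
    rw [blk, ← List.append_assoc]
    have h1 := ih (u ++ f (k + m + 1))
    have h2 := card_filter_colSet_append (u := u) (hf (k + m + 1)) p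
    omega

theorem rankIn_colSet_blk (u : List ℕ) {f : ℕ → List ℕ} (hf : ∀ i, (f i).Pairwise (· < ·))
    (a k m : ℕ) : rankIn (colSet (u ++ blk f k m)) a ≤ rankIn (colSet u) a + m := by
  unfold rankIn
  convert card_filter_colSet_blk u hf (· ≤ a) k m

theorem rankIn_eq_zero {A : Finset ℕ} {a : ℕ} (h : ∀ x ∈ A, a < x) : rankIn A a = 0 := by
  rw [rankIn, Finset.card_eq_zero, Finset.filter_eq_empty_iff]
  exact fun x hx => not_le.mpr (h x hx)

/-- Increasing factorizations with at most `n` blocks of the words equivalent to `ρ₀`, flagged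
through the entries of the first column. -/
def XF (n : ℕ) (φ : ℕ → ℕ) (ρ₀ : List ℕ) : Set (ℕ → List ℕ) :=
  {f | (∀ i, i = 0 ∨ n < i → f i = []) ∧ (∀ i, (f i).Pairwise (· < ·)) ∧
    (∀ i, ∀ x ∈ f i, ∃ a ∈ colSet ρ₀, a ≤ x ∧ i ≤ φ a) ∧ CKEquiv ρ₀ (blk f 0 n)}

theorem mem_of_mem_block {n : ℕ} {f : ℕ → List ℕ} (h0 : ∀ i, i = 0 ∨ n < i → f i = [])
    {i x : ℕ} (hx : x ∈ f i) : 1 ≤ i ∧ i ≤ n ∧ x ∈ blk f 0 n := by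
  have hi : ¬ (i = 0 ∨ n < i) := fun h => by rw [h0 i h] at hx; simp at hx
  exact ⟨by omega, by omega, mem_blk.mpr ⟨i, by omega, by omega, hx⟩⟩

theorem finite_factorizations (n : ℕ) (L : Finset ℕ) :
    {f : ℕ → List ℕ | (∀ i, i = 0 ∨ n < i → f i = []) ∧ (∀ i, (f i).Pairwise (· < ·)) ∧
      ∀ i, ∀ x ∈ f i, x ∈ L}.Finite := by
  let g : (ℕ → List ℕ) → Fin (n + 1) → Finset ℕ := fun f i => (f i).toFinset
  refine Set.Finite.of_finite_image (f := g) ?_ ?_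
  · refine (Set.Finite.pi' (t := fun _ : Fin (n + 1) => (↑L.powerset : Set (Finset ℕ)))
      (fun _ => Finset.finite_toSet _)).subset ?_
    rintro _ ⟨f, hf, rfl⟩ i
    simp only [Finset.coe_powerset, Set.mem_preimage, Set.mem_powerset_iff]
    intro x hx
    exact hf.2.2 i x (by simpa [g] using hx)
  · intro f hf f' hf' h
    funext i
    by_cases hi : i = 0 ∨ n < i
    · rw [hf.1 i hi, hf'.1 i hi]
    · have h1 : (f i).toFinset = (f' i).toFinset := congrFun h ⟨i, by omega⟩
      refine perm_eq_of_increasing (hf.2.1 i) (hf'.2.1 i) ?_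
      rw [List.perm_ext_iff_of_nodup ((hf.2.1 i).imp (fun h => ne_of_lt h))
        ((hf'.2.1 i).imp (fun h => ne_of_lt h))]
      intro x
      rw [← List.mem_toFinset, h1, List.mem_toFinset]

theorem XF_finite (n : ℕ) (φ : ℕ → ℕ) (ρ₀ : List ℕ) : (XF n φ ρ₀).Finite := by
  refine (finite_factorizations n ρ₀.toFinset).subset fun f hf => ⟨hf.1, hf.2.1, fun i x hx => ?_⟩
  rw [List.mem_toFinset, hf.2.2.2.mem_iff]
  exact (mem_of_mem_block hf.1 hx).2.2

/-- The generating polynomial of the flagged factorizations of an equivalence class. -/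
def genF (n : ℕ) (φ : ℕ → ℕ) (ρ₀ : List ℕ) : MvPolynomial ℕ ℤ :=
  ∑ᶠ f ∈ XF n φ ρ₀, xExp (fun i => (f i).length)

theorem genF_eq_sum (n : ℕ) (φ : ℕ → ℕ) (ρ₀ : List ℕ) :
    genF n φ ρ₀ = ∑ f ∈ (XF_finite n φ ρ₀).toFinset, xExp (fun i => (f i).length) :=
  finsum_mem_eq_finite_toFinset_sum _ _

theorem weakComp_lengths {n : ℕ} {f : ℕ → List ℕ} (h0 : ∀ i, i = 0 ∨ n < i → f i = []) :
    WeakComp (fun i => (f i).length) :=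
  weakComp_of_bound (N := n + 1) (by simp [h0 0 (Or.inl rfl)])
    fun i hi => by simp [h0 i (Or.inr (by omega))]

/-- Every letter of a block is bounded below by a column entry lying in a block at least as far
to the left. -/
theorem exists_column_entry {n : ℕ} {ρ₀ : List ℕ} (hg : Good ρ₀) {f : ℕ → List ℕ}
    (h0 : ∀ i, i = 0 ∨ n < i → f i = []) (he : CKEquiv ρ₀ (blk f 0 n)) {k x : ℕ} (hx : x ∈ f k) :
    ∃ m ∈ colSet ρ₀, m ≤ x ∧ ∃ k', k ≤ k' ∧ m ∈ f k' := by
  obtain ⟨h1, h2, h3⟩ := mem_of_mem_block h0 hx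
  have hxu : x ∈ blk f (k - 1) (n - (k - 1)) := mem_blk.mpr ⟨k, by omega, by omega, hx⟩
  obtain ⟨m, hm, hmx⟩ := exists_mem_colSet_le hxu
  obtain ⟨k', hk', -, hmk⟩ := mem_blk.mp (mem_of_mem_colSet hm)
  refine ⟨m, ?_, hmx, k', by omega, hmk⟩
  rw [he.colSet_eq hg, blk_split f (show k - 1 ≤ n by omega)]
  exact colSet_subset_append _ _ hm

theorem mem_XF_iff {n : ℕ} {φ : ℕ → ℕ} {ρ₀ : List ℕ} (hg : Good ρ₀) (hφ : Monotone φ)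
    {f : ℕ → List ℕ} : f ∈ XF n φ ρ₀ ↔ (∀ i, i = 0 ∨ n < i → f i = []) ∧
      (∀ i, (f i).Pairwise (· < ·)) ∧ (∀ i, ∀ x ∈ f i, i ≤ φ x) ∧ CKEquiv ρ₀ (blk f 0 n) := by
  constructor
  · rintro ⟨h0, h1, h2, h3⟩
    refine ⟨h0, h1, fun i x hx => ?_, h3⟩
    obtain ⟨a, -, hax, hi⟩ := h2 i x hx
    exact hi.trans (hφ hax)
  · rintro ⟨h0, h1, h2, h3⟩
    refine ⟨h0, h1, fun i x hx => ?_, h3⟩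
    obtain ⟨m, hm, hmx, k', hk, hmk⟩ := exists_column_entry hg h0 h3 hx
    exact ⟨m, hm, hmx, hk.trans (h2 k' m hmk)⟩

theorem XF_congr {n : ℕ} {φ ψ : ℕ → ℕ} {ρ₀ : List ℕ} (h : ∀ a ∈ colSet ρ₀, φ a = ψ a) :
    XF n φ ρ₀ = XF n ψ ρ₀ := by
  have : ∀ φ ψ : ℕ → ℕ, (∀ a ∈ colSet ρ₀, φ a = ψ a) → XF n φ ρ₀ ⊆ XF n ψ ρ₀ := by
    rintro φ ψ h f ⟨h0, h1, h2, h3⟩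
    refine ⟨h0, h1, fun i x hx => ?_, h3⟩
    obtain ⟨a, ha, hax, hi⟩ := h2 i x hx
    exact ⟨a, ha, hax, h a ha ▸ hi⟩
  exact (this φ ψ h).antisymm (this ψ φ fun a ha => (h a ha).symm)

theorem genF_congr {n : ℕ} {φ ψ : ℕ → ℕ} {ρ₀ : List ℕ} (h : ∀ a ∈ colSet ρ₀, φ a = ψ a) :
    genF n φ ρ₀ = genF n ψ ρ₀ := by
  rw [genF, genF, XF_congr h]

theorem XF_eq_empty {n : ℕ} {φ : ℕ → ℕ} {ρ₀ : List ℕ} (hg : Good ρ₀)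
    (hφ : MonotoneOn φ ↑(colSet ρ₀)) {a : ℕ} (ha : a ∈ colSet ρ₀) (han : φ a ≤ n)
    (h : φ a < rankIn (colSet ρ₀) a) : XF n φ ρ₀ = ∅ := by
  rw [Set.eq_empty_iff_forall_notMem]
  rintro f ⟨h0, h1, h2, h3⟩
  have h4 := rankIn_colSet_blk (blk f (φ a) (n - φ a)) h1 a 0 (φ a)
  rw [← blk_split f han, ← h3.colSet_eq hg,
    rankIn_eq_zero (A := colSet (blk f (φ a) (n - φ a)))] at h4
  · omega
  intro x hx
  by_contra! hxa
  obtain ⟨i, hi, -, hxi⟩ := mem_blk.mp (mem_of_mem_colSet hx)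
  obtain ⟨b, hb, hbx, hib⟩ := h2 i x hxi
  have := hφ (Finset.mem_coe.mpr hb) (Finset.mem_coe.mpr ha) (hbx.trans hxa)
  omega

/-! ### The flagged factorizations satisfy the Demazure recursion -/

/-- A weight-exchanging injective self-map of a finite set makes the generating polynomial
symmetric in two consecutive variables. -/
theorem swapV_sum_eq {ι : Type*} (s : Finset ι) (w : ι → ℕ → ℕ) (j : ℕ)
    (hw : ∀ f ∈ s, WeakComp (w f)) (σ : ι → ι) (hσ : ∀ f ∈ s, σ f ∈ s)
    (hinj : Set.InjOn σ ↑s) (hσw : ∀ f ∈ s, w (σ f) = swapC (w f) j) :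
    swapV j (∑ f ∈ s, xExp (w f)) = ∑ f ∈ s, xExp (w f) := by
  rw [map_sum]
  calc ∑ f ∈ s, swapV j (xExp (w f)) = ∑ f ∈ s, xExp (w (σ f)) :=
        Finset.sum_congr rfl fun f hf => by rw [swapV_xExp (hw f hf), hσw f hf]
    _ = ∑ f ∈ s.image σ, xExp (w f) := (Finset.sum_image (f := fun f => xExp (w f)) hinj).symm
    _ = _ := by
      rw [Finset.eq_of_subset_of_card_le (Finset.image_subset_iff.mpr hσ)
        (Finset.card_image_of_injOn hinj).ge]

/-- Replace the blocks `j + 1` and `j` of `f` by the two members of `P`. -/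
def setPair (f : ℕ → List ℕ) (j : ℕ) (P : List ℕ × List ℕ) : ℕ → List ℕ :=
  fun i => if i = j + 1 then P.1 else if i = j then P.2 else f i

theorem setPair_left (f : ℕ → List ℕ) (j : ℕ) (P : List ℕ × List ℕ) :
    setPair f j P (j + 1) = P.1 := if_pos rfl

theorem setPair_right (f : ℕ → List ℕ) (j : ℕ) (P : List ℕ × List ℕ) :
    setPair f j P j = P.2 := by
  rw [setPair, if_neg (by omega), if_pos rfl]

theorem setPair_of_ne (f : ℕ → List ℕ) {i j : ℕ} (P : List ℕ × List ℕ) (h1 : i ≠ j)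
    (h2 : i ≠ j + 1) : setPair f j P i = f i := by
  rw [setPair, if_neg h2, if_neg h1]

theorem setPair_cases {p : ℕ → List ℕ → Prop} {f : ℕ → List ℕ} {j : ℕ} {P : List ℕ × List ℕ}
    (h1 : p (j + 1) P.1) (h2 : p j P.2) (h : ∀ i, i ≠ j → i ≠ j + 1 → p i (f i)) (i : ℕ) :
    p i (setPair f j P i) := by
  by_cases hi : i = j + 1
  · subst hi; rwa [setPair_left]
  · by_cases hi' : i = j
    · subst hi'; rwa [setPair_right]
    · rw [setPair_of_ne f P hi' hi]; exact h i hi' hi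

theorem setPair_inj {f g : ℕ → List ℕ} {j : ℕ} {P Q : List ℕ × List ℕ}
    (h : setPair f j P = setPair g j Q) : P = Q ∧ ∀ i, i ≠ j → i ≠ j + 1 → f i = g i := by
  refine ⟨Prod.ext ?_ ?_, fun i h1 h2 => ?_⟩
  · simpa [setPair_left] using congrFun h (j + 1)
  · simpa [setPair_right] using congrFun h j
  · simpa [setPair_of_ne _ _ h1 h2] using congrFun h i

theorem setPair_mem_XF {n j i : ℕ} {φ : ℕ → ℕ} {ρ₀ : List ℕ} (hj : 1 ≤ j) (hn : j + 1 ≤ n)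
    (hi : i ∈ colSet ρ₀) (hφi : φ i = j + 1) (hlt : ∀ x ∈ colSet ρ₀, x < i → φ x < j)
    {f : ℕ → List ℕ} (hf : f ∈ XF n φ ρ₀) {P : List ℕ × List ℕ} (h1 : P.1.Pairwise (· < ·))
    (h2 : P.2.Pairwise (· < ·)) (he : CKEquiv (f (j + 1) ++ f j) (P.1 ++ P.2)) :
    setPair f j P ∈ XF n φ ρ₀ := by
  have hle : ∀ x ∈ P.1 ++ P.2, i ≤ x := by
    intro x hx
    rw [← he.mem_iff, List.mem_append] at hx
    have : ∃ a ∈ colSet ρ₀, a ≤ x ∧ j ≤ φ a := by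
      rcases hx with hx | hx
      · obtain ⟨a, ha, hax, h⟩ := hf.2.2.1 _ x hx
        exact ⟨a, ha, hax, by omega⟩
      · exact hf.2.2.1 _ x hx
    obtain ⟨a, ha, hax, h⟩ := this
    by_contra! hxi
    have := hlt a ha (by omega)
    omega
  refine ⟨setPair_cases (p := fun i l => i = 0 ∨ n < i → l = []) (by omega) (by omega)
    fun i _ _ => hf.1 i, setPair_cases (p := fun _ l => l.Pairwise (· < ·)) h1 h2
    fun i _ _ => hf.2.1 i, setPair_cases (p := fun k l => ∀ x ∈ l, ∃ a ∈ colSet ρ₀, a ≤ x ∧ k ≤ φ a)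
    (fun x hx => ⟨i, hi, hle x (by simp [hx]), hφi.ge⟩)
    (fun x hx => ⟨i, hi, hle x (by simp [hx]), by omega⟩) fun i _ _ => hf.2.2.1 i, ?_⟩
  refine hf.2.2.2.trans ?_
  rw [blk_split_pair f hj hn, blk_split_pair (setPair f j P) hj hn, setPair_left, setPair_right]
  rw [blk_congr (f := setPair f j P) (g := f) (k := j + 1)
    (fun i h1 h2 => setPair_of_ne f P (by omega) (by omega)),
    blk_congr (f := setPair f j P) (g := f) (k := 0)
    (fun i h1 h2 => setPair_of_ne f P (by omega) (by omega))]
  exact he.context _ _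

theorem good_pair {n j : ℕ} {f : ℕ → List ℕ} (hj : 1 ≤ j) (hn : j + 1 ≤ n)
    (hg : Good (blk f 0 n)) : Good (f (j + 1) ++ f j) := by
  rw [blk_split_pair f hj hn] at hg
  exact hg.factor

theorem length_setPair {f : ℕ → List ℕ} {j : ℕ} {P : List ℕ × List ℕ}
    (h1 : P.1.length = (f j).length) (h2 : P.2.length = (f (j + 1)).length) :
    (fun i => (setPair f j P i).length) = swapC (fun i => (f i).length) j := by
  funext i
  by_cases hi : i = j + 1
  · subst hi; rw [setPair_left, swapC_right, h1]
  · by_cases hi' : i = j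
    · subst hi'; rw [setPair_right, swapC_left, h2]
    · rw [setPair_of_ne f P hi' hi, swapC_of_ne _ hi' hi]

theorem mem_XF_update_iff {n j i : ℕ} {φ : ℕ → ℕ} {ρ₀ : List ℕ} (hg : Good ρ₀)
    (hmono : MonotoneOn φ ↑(colSet ρ₀))
    (hi : i ∈ colSet ρ₀) (hφi : φ i = j + 1) (hlt : ∀ x ∈ colSet ρ₀, x < i → φ x < j)
    {f : ℕ → List ℕ} (hf : f ∈ XF n φ ρ₀) :
    f ∈ XF n (Function.update φ i j) ρ₀ ↔ i ∉ f (j + 1) := by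
  constructor
  · intro h hmem
    obtain ⟨a, ha, hai, hja⟩ := h.2.2.1 _ i hmem
    rcases hai.lt_or_eq with h1 | rfl
    · rw [Function.update_of_ne (by omega)] at hja
      have := hlt a ha h1
      omega
    · rw [Function.update_self] at hja
      omega
  · intro hmem
    refine ⟨hf.1, hf.2.1, fun k x hx => ?_, hf.2.2.2⟩
    by_contra! hcon
    have key : ∀ a ∈ colSet ρ₀, a ≤ x → k ≤ φ a → a = i := by
      intro a ha hax hka
      by_contra hne
      have := hcon a ha hax
      rw [Function.update_of_ne hne] at this
      omega
    obtain ⟨a, ha, hax, hka⟩ := hf.2.2.1 k x hx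
    obtain rfl := key a ha hax hka
    have hk : k = j + 1 := by
      have := hcon a ha hax
      rw [Function.update_self] at this
      omega
    subst hk
    obtain ⟨m, hm, hmx, k', hk', hmk⟩ := exists_column_entry hg hf.1 hf.2.2.2 hx
    obtain ⟨b, hb, hbm, hkb⟩ := hf.2.2.1 k' m hmk
    obtain rfl := key b hb (by omega) (by omega)
    obtain rfl : k' = j + 1 := by omega
    obtain rfl := key m hm hmx
      (hka.trans (hmono (Finset.mem_coe.mpr hb) (Finset.mem_coe.mpr hm) hbm))
    exact hmem hmk

theorem Good.not_mem_head {i : ℕ} {A B : List ℕ} (h : Good (i :: (A ++ B)))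
    (hA : A.Pairwise (· < ·)) (hle : ∀ x ∈ A, i ≤ x) : i ∉ A := by
  cases A with
  | nil => simp
  | cons a A =>
    have hne : i ≠ a := Good.ne (by simpa using h)
    have h1 := hle a (by simp)
    intro hmem
    rcases List.mem_cons.mp hmem with h2 | h2
    · exact hne h2
    · have := (List.pairwise_cons.mp hA).1 i h2
      omega

/-- The block lengths of `f`, with the length of block `j` raised by one. -/
def raisedLengths (j : ℕ) (f : ℕ → List ℕ) (k : ℕ) : ℕ :=
  (if k = j then 1 else 0) + (f k).length

theorem genF_step {n j i : ℕ} {φ : ℕ → ℕ} {ρ₀ : List ℕ} (hg : Good ρ₀)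
    (hmono : MonotoneOn φ ↑(colSet ρ₀)) (hj : 1 ≤ j) (hn : j + 1 ≤ n)
    (hi : i ∈ colSet ρ₀) (hφi : φ i = j + 1) (hlt : ∀ x ∈ colSet ρ₀, x < i → φ x < j) :
    genF n φ ρ₀ = piOp j (genF n (Function.update φ i j) ρ₀) := by
  obtain ⟨θ, hθ, hθinj⟩ := exists_exchange
  have hgood : ∀ f ∈ XF n φ ρ₀, Good (f (j + 1) ++ f j) := fun f hf =>
    good_pair hj hn (hg.equiv hf.2.2.2)
  have hX : ∀ f, f ∈ (XF_finite n φ ρ₀).toFinset ↔ f ∈ XF n φ ρ₀ := fun f => by simp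
  apply eq_piOp_of_symm
  · rw [genF_eq_sum]
    have hP : ∀ f ∈ XF n φ ρ₀, _ := fun f hf =>
      hθ (f (j + 1)) (f j) (hf.2.1 _) (hf.2.1 _) (hgood f hf)
    refine swapV_sum_eq _ _ j (fun f hf => weakComp_lengths ((hX f).mp hf).1)
      (fun f => setPair f j (θ (f (j + 1), f j))) (fun f hf => ?_) (fun f hf f' hf' h => ?_)
      (fun f hf => ?_)
    · rw [hX] at hf ⊢
      obtain ⟨h1, h2, -, -, h5⟩ := hP f hf
      exact setPair_mem_XF hj hn hi hφi hlt hf h1 h2 h5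
    · rw [Finset.mem_coe, hX] at hf hf'
      obtain ⟨h1, h2⟩ := setPair_inj h
      have h3 := hθinj ⟨hf.2.1 _, hf.2.1 _, hgood f hf⟩ ⟨hf'.2.1 _, hf'.2.1 _, hgood f' hf'⟩ h1
      funext k
      by_cases hk : k = j
      · subst hk; exact congrArg Prod.snd h3
      · by_cases hk' : k = j + 1
        · subst hk'; exact congrArg Prod.fst h3
        · exact h2 k hk hk'
    · rw [hX] at hf
      obtain ⟨-, -, h3, h4, -⟩ := hP f hf
      exact length_setPair h3 h4
  · set φ' := Function.update φ i j with hφ'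
    have hsub : XF n φ' ρ₀ ⊆ XF n φ ρ₀ := by
      rintro f ⟨h0, h1, h2, h3⟩
      refine ⟨h0, h1, fun k x hx => ?_, h3⟩
      obtain ⟨a, ha, hax, hka⟩ := h2 k x hx
      refine ⟨a, ha, hax, ?_⟩
      by_cases hai : a = i
      · subst hai
        rw [hφ', Function.update_self] at hka
        omega
      · rwa [hφ', Function.update_of_ne hai] at hka
    have hdiff : genF n φ ρ₀ - genF n φ' ρ₀ = ∑ f ∈ (XF_finite n φ ρ₀).toFinset.filter
        (fun f => i ∈ f (j + 1)), xExp (fun i => (f i).length) := by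
      rw [genF_eq_sum, genF_eq_sum, sub_eq_iff_eq_add,
        ← Finset.sum_filter_add_sum_filter_not _ (fun f => i ∈ f (j + 1))]
      congr 1
      refine Finset.sum_congr (Finset.ext fun f => ?_) fun _ _ => rfl
      rw [Finset.mem_filter, hX, Set.Finite.mem_toFinset]
      constructor
      · rintro ⟨h1, h2⟩
        exact (mem_XF_update_iff hg hmono hi hφi hlt h1).mpr h2
      · intro h
        exact ⟨hsub h, (mem_XF_update_iff hg hmono hi hφi hlt (hsub h)).mp h⟩
    have hY : ∀ f, f ∈ (XF_finite n φ ρ₀).toFinset.filter (fun f => i ∈ f (j + 1)) ↔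
        f ∈ XF n φ ρ₀ ∧ i ∈ f (j + 1) := fun f => by rw [Finset.mem_filter, hX]
    rw [hdiff, Finset.mul_sum]
    have hXj : ∀ f ∈ XF n φ ρ₀, X j * xExp (fun i => (f i).length) =
        xExp (raisedLengths j f) := by
      intro f hf
      unfold raisedLengths
      rw [xExp_add (N := n + 1) (fun k hk => if_neg (by omega))
        (fun k hk => by simp [hf.1 k (Or.inr (by omega))])]
      congr 1
      rw [xExp_eq_monomial_of_coe (β := fun k => if k = j then 1 else 0)
        (d := Finsupp.single j 1)
        (weakComp_of_bound (N := n + 1) (if_neg (by omega)) (fun k hk => if_neg (by omega)))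
        (fun k => by rw [Finsupp.single_apply]; split_ifs <;> omega)]
      rfl
    have hWC : ∀ f ∈ XF n φ ρ₀, WeakComp (raisedLengths j f) := by
      intro f hf
      refine weakComp_of_bound (N := n + 1) ?_ fun k hk => ?_
      · simp [raisedLengths, hf.1 0 (Or.inl rfl), show ¬ (0 = j) by omega]
      · simp [raisedLengths, hf.1 k (Or.inr (by omega)), show ¬ (k = j) by omega]
    have hsplit : ∀ f ∈ XF n φ ρ₀, i ∈ f (j + 1) → ∃ A, f (j + 1) = i :: A ∧ (∀ x ∈ A, i < x) ∧
        A.Pairwise (· < ·) ∧ ∀ x ∈ f j, i ≤ x := by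
      intro f hf hmem
      have hge : ∀ k, j ≤ k → ∀ x ∈ f k, i ≤ x := by
        intro k hk x hx
        obtain ⟨a, ha, hax, hka⟩ := hf.2.2.1 _ x hx
        by_contra! hxi
        have := hlt a ha (by omega)
        omega
      have hp := hf.2.1 (j + 1)
      cases h : f (j + 1) with
      | nil => rw [h] at hmem; simp at hmem
      | cons b A =>
        rw [h, List.pairwise_cons] at hp
        obtain rfl : b = i := by
          have h1 := hge (j + 1) (by omega) b (by rw [h]; simp)
          rw [h] at hmem
          rcases List.mem_cons.mp hmem with h2 | h2
          · exact h2.symm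
          · have := hp.1 i h2
            omega
        exact ⟨A, rfl, hp.1, hp.2, hge j le_rfl⟩
    rw [Finset.sum_congr rfl fun f hf => hXj f ((hY f).mp hf).1]
    have hP : ∀ f ∈ XF n φ ρ₀, ∀ A, f (j + 1) = i :: A → _ := fun f hf A hA =>
      hθ A (f j) (List.pairwise_cons.mp (hA ▸ hf.2.1 (j + 1))).2 (hf.2.1 _)
        (Good.tail (by simpa [hA] using hgood f hf))
    have hcons : ∀ f ∈ XF n φ ρ₀, ∀ A, f (j + 1) = i :: A → (∀ x ∈ A, i < x) →
        (∀ x ∈ f j, i ≤ x) → (i :: (θ (A, f j)).1).Pairwise (· < ·) := by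
      intro f hf A hA h1 h2
      obtain ⟨h3, h4, -, -, h7⟩ := hP f hf A hA
      have hle : ∀ x ∈ (θ (A, f j)).1, i ≤ x := by
        intro x hx
        have : x ∈ A ++ f j := (h7.mem_iff x).mpr (by simp [hx])
        rcases List.mem_append.mp this with h | h
        · exact (h1 x h).le
        · exact h2 x h
      have hgd : Good (i :: ((θ (A, f j)).1 ++ (θ (A, f j)).2)) := by
        have h8 := hgood f hf
        rw [hA] at h8
        exact Good.equiv h8 (h7.append_left [i])
      refine List.pairwise_cons.mpr ⟨fun x hx => lt_of_le_of_ne (hle x hx) ?_, h3⟩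
      rintro rfl
      exact hgd.not_mem_head h3 hle hx
    refine swapV_sum_eq _ (raisedLengths j) j (fun f hf => ?_)
      (fun f => setPair f j (i :: (θ ((f (j + 1)).tail, f j)).1, (θ ((f (j + 1)).tail, f j)).2))
      (fun f hf => ?_) (fun f hf f' hf' h => ?_) (fun f hf => ?_)
    · exact hWC f ((hY f).mp hf).1
    · rw [hY] at hf ⊢
      obtain ⟨A, hA, h1, h2, h3⟩ := hsplit f hf.1 hf.2
      obtain ⟨h4, h5, -, -, h8⟩ := hP f hf.1 A hA
      have h9 := hcons f hf.1 A hA h1 h3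
      rw [hA, List.tail_cons]
      refine ⟨setPair_mem_XF hj hn hi hφi hlt hf.1 h9 h5 ?_, by simp [setPair_left]⟩
      rw [hA]
      exact h8.append_left [i]
    · rw [Finset.mem_coe, hY] at hf hf'
      obtain ⟨A, hA, h1, h2, h3⟩ := hsplit f hf.1 hf.2
      obtain ⟨A', hA', h1', h2', h3'⟩ := hsplit f' hf'.1 hf'.2
      simp only [hA, hA', List.tail_cons] at h
      obtain ⟨h4, h5⟩ := setPair_inj h
      simp only [Prod.mk.injEq, List.cons.injEq, true_and] at h4
      have h6 := hθinj (x₁ := (A, f j)) (x₂ := (A', f' j))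
        ⟨h2, hf.1.2.1 _, Good.tail (by simpa [hA] using hgood f hf.1)⟩
        ⟨h2', hf'.1.2.1 _, Good.tail (by simpa [hA'] using hgood f' hf'.1)⟩ (Prod.ext h4.1 h4.2)
      funext k
      by_cases hk : k = j
      · subst hk; exact congrArg Prod.snd h6
      · by_cases hk' : k = j + 1
        · subst hk'; rw [hA, hA', show A = A' from congrArg Prod.fst h6]
        · exact h5 k hk hk'
    · rw [hY] at hf
      obtain ⟨A, hA, h1, h2, h3⟩ := hsplit f hf.1 hf.2
      obtain ⟨-, -, h6, h7, -⟩ := hP f hf.1 A hA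
      funext k
      simp only [hA, List.tail_cons, raisedLengths]
      by_cases hk : k = j + 1
      · subst hk
        rw [setPair_left, swapC_right, raisedLengths]
        simp [h6, add_comm]
      · by_cases hk' : k = j
        · subst hk'
          rw [setPair_right, swapC_left, raisedLengths, hA]
          simp [h7, add_comm]
        · rw [setPair_of_ne _ _ hk' hk, swapC_of_ne _ hk' hk, raisedLengths]

/-! ### Stripping the first column from a tightly flagged factorization -/

theorem ck_move_letter {x y : ℕ} {D : List ℕ} (hD : (y :: D).Pairwise (· > ·)) (h : y < x) :
    CKEquiv (y :: D ++ [x]) (y :: x :: D) := by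
  induction D generalizing y with
  | nil => exact CKEquiv.refl _
  | cons d D ih =>
    rw [List.pairwise_cons] at hD
    have hd : d < y := hD.1 d (by simp)
    exact ((ih hD.2 (hd.trans h)).append_left [y]).trans ((ck_right hd h).append_right D)

theorem ck_move_block {y : ℕ} {D F : List ℕ} (hD : (y :: D).Pairwise (· > ·))
    (hF : (y :: F).Pairwise (· < ·)) : CKEquiv (y :: D ++ F) (y :: F ++ D) := by
  induction F generalizing y with
  | nil => simpa using CKEquiv.refl _
  | cons x F ih =>
    rw [List.pairwise_cons] at hF
    have hx : y < x := hF.1 x (by simp)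
    have h1 := (ck_move_letter hD hx).append_right F
    have h2 : (x :: D).Pairwise (· > ·) := List.pairwise_cons.mpr
      ⟨fun z hz => ((List.pairwise_cons.mp hD).1 z hz).trans hx, (List.pairwise_cons.mp hD).2⟩
    have h3 := (ih h2 hF.2).append_left [y]
    simp only [List.append_assoc, List.cons_append, List.nil_append] at h1 h3 ⊢
    exact h1.trans h3

/-- The word `e m, …, e 1`. -/
def descWord (e : ℕ → ℕ) : ℕ → List ℕ
  | 0 => []
  | m + 1 => e (m + 1) :: descWord e m

theorem mem_descWord {e : ℕ → ℕ} {m x : ℕ} :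
    x ∈ descWord e m ↔ ∃ i, 1 ≤ i ∧ i ≤ m ∧ e i = x := by
  induction m with
  | zero => simp only [descWord, List.not_mem_nil, false_iff]; rintro ⟨i, h1, h2, -⟩; omega
  | succ m ih =>
    rw [descWord, List.mem_cons, ih]
    constructor
    · rintro (h | ⟨i, h1, h2, h3⟩)
      · exact ⟨m + 1, by omega, le_rfl, h.symm⟩
      · exact ⟨i, h1, by omega, h3⟩
    · rintro ⟨i, h1, h2, h3⟩
      by_cases hi : i = m + 1
      · exact Or.inl (hi ▸ h3.symm)
      · exact Or.inr ⟨i, h1, by omega, h3⟩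

theorem pairwise_descWord {e : ℕ → ℕ} {m : ℕ}
    (he : ∀ i k, 1 ≤ i → i < k → k ≤ m → e i < e k) : (descWord e m).Pairwise (· > ·) := by
  induction m with
  | zero => exact List.Pairwise.nil
  | succ m ih =>
    refine List.pairwise_cons.mpr ⟨fun x hx => ?_, ih fun i k h1 h2 h3 => he i k h1 h2 (by omega)⟩
    obtain ⟨i, h1, h2, rfl⟩ := mem_descWord.mp hx
    exact he i (m + 1) h1 (by omega) le_rfl

theorem descWord_append_equiv {e : ℕ → ℕ} {f g : ℕ → List ℕ} {m : ℕ}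
    (he : ∀ i k, 1 ≤ i → i < k → k ≤ m → e i < e k)
    (hf : ∀ i, 1 ≤ i → i ≤ m → f i = e i :: g i ∧ (f i).Pairwise (· < ·)) :
    CKEquiv (descWord e m ++ blk g 0 m) (blk f 0 m) := by
  induction m with
  | zero => exact CKEquiv.refl _
  | succ m ih =>
    obtain ⟨h1, h2⟩ := hf (m + 1) (by omega) le_rfl
    have h3 := (ck_move_block (pairwise_descWord he) (h1 ▸ h2)).append_right (blk g 0 m)
    have h4 := (ih (fun i k h1 h2 h3 => he i k h1 h2 (by omega))
      (fun i h1 h2 => hf i h1 (by omega))).append_left (f (m + 1))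
    rw [h1] at h4
    simp only [descWord, blk, Nat.zero_add, h1, List.append_assoc, List.cons_append] at h3 h4 ⊢
    exact h3.trans h4

theorem colR_blk {e : ℕ → ℕ} {f g : ℕ → List ℕ} {h : ℕ}
    (he : ∀ i k, 1 ≤ i → i < k → k ≤ h → e i < e k)
    (hf : ∀ i, 1 ≤ i → i ≤ h → f i = e i :: g i ∧ (f i).Pairwise (· < ·)) (m k : ℕ)
    (hm : k + m ≤ h) : colR (blk f k m) = blk g k m := by
  induction m generalizing k with
  | zero => rfl
  | succ m ih =>
    have h1 : ∀ f : ℕ → List ℕ, blk f k (m + 1) = blk f (k + 1) m ++ f (k + 1) := fun f => by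
      rw [add_comm m 1, blk_add]; simp [blk]
    obtain ⟨h2, h3⟩ := hf (k + 1) (by omega) (by omega)
    rw [h1, h1, colR_append, h2, (colA_increasing (h2 ▸ h3)).1, (colA_increasing (h2 ▸ h3)).2,
      insW_strip]
    · exact congrArg (· ++ g (k + 1)) (ih (k + 1) (by omega))
    · intro x hx
      obtain ⟨i, hi, hi', hxi⟩ := mem_blk.mp hx
      obtain ⟨h4, h5⟩ := hf i (by omega) (by omega)
      have h6 := he (k + 1) i (by omega) (by omega) (by omega)
      rw [h4] at hxi h5
      rcases List.mem_cons.mp hxi with rfl | hxi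
      · exact h6
      · exact h6.trans ((List.pairwise_cons.mp h5).1 x hxi)

/-- The number of entries of `A` smaller than `x`. -/
def belowCount (A : Finset ℕ) (x : ℕ) : ℕ := (A.filter (· < x)).card

theorem belowCount_mono (A : Finset ℕ) : Monotone (belowCount A) := fun x y h =>
  Finset.card_le_card fun a ha => by
    rw [Finset.mem_filter] at ha ⊢
    exact ⟨ha.1, ha.2.trans_le h⟩

theorem belowCount_le (A : Finset ℕ) (x : ℕ) : belowCount A x ≤ A.card :=
  Finset.card_filter_le _ _

theorem le_belowCount_iff {A : Finset ℕ} {a x : ℕ} (ha : a ∈ A) :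
    rankIn A a ≤ belowCount A x ↔ a < x := by
  constructor
  · intro h
    by_contra! hxa
    have : A.filter (· < x) ⊂ A.filter (· ≤ a) := by
      refine (Finset.ssubset_iff_of_subset fun y hy => ?_).mpr
        ⟨a, by simpa using ha, by simpa using fun _ => hxa⟩
      rw [Finset.mem_filter] at hy ⊢
      exact ⟨hy.1, by omega⟩
    have := Finset.card_lt_card this
    unfold rankIn belowCount at h
    omega
  · intro h
    refine Finset.card_le_card fun y hy => ?_
    rw [Finset.mem_filter] at hy ⊢
    exact ⟨hy.1, by omega⟩

theorem exists_enumeration (A : Finset ℕ) : ∃ e : ℕ → ℕ,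
    ∀ i, 1 ≤ i → i ≤ A.card → e i ∈ A ∧ rankIn A (e i) = i :=
  ⟨fun i => if h : 1 ≤ i ∧ i ≤ A.card then (exists_rankIn_eq h.1 h.2).choose else 0,
    fun i h1 h2 => by
      beta_reduce
      rw [dif_pos ⟨h1, h2⟩]
      exact (exists_rankIn_eq h1 h2).choose_spec⟩

/-- Prefix the blocks `1, …, h` of `g` by the letters `e 1, …, e h`. -/
def addHeads (e : ℕ → ℕ) (h : ℕ) (g : ℕ → List ℕ) : ℕ → List ℕ :=
  fun i => if 1 ≤ i ∧ i ≤ h then e i :: g i else []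

theorem addHeads_of_le (e : ℕ → ℕ) {h : ℕ} (g : ℕ → List ℕ) {i : ℕ} (h1 : 1 ≤ i) (h2 : i ≤ h) :
    addHeads e h g i = e i :: g i := if_pos ⟨h1, h2⟩

theorem blk_eq_of_empty {n h : ℕ} (hn : h ≤ n) {f : ℕ → List ℕ} (hf : ∀ i, h < i → f i = []) :
    blk f 0 n = blk f 0 h := by
  rw [blk_split f hn]
  have : blk f h (n - h) = [] := by
    rw [List.eq_nil_iff_forall_not_mem]
    intro x hx
    obtain ⟨i, hi, -, hxi⟩ := mem_blk.mp hx
    rw [hf i hi] at hxi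
    simp at hxi
  rw [this, List.nil_append]

theorem descWord_eq_reverse_colA {ρ₀ : List ℕ} {e : ℕ → ℕ}
    (he : ∀ i, 1 ≤ i → i ≤ (colSet ρ₀).card → e i ∈ colSet ρ₀ ∧ rankIn (colSet ρ₀) (e i) = i)
    (hs : ∀ i k, 1 ≤ i → i < k → k ≤ (colSet ρ₀).card → e i < e k) :
    descWord e (colSet ρ₀).card = (colA ρ₀).reverse := by
  rw [← List.reverse_eq_iff]
  have h1 : (descWord e (colSet ρ₀).card).reverse.Pairwise (· < ·) :=
    List.pairwise_reverse.mpr (pairwise_descWord hs)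
  refine perm_eq_of_increasing h1 (pairwise_colA ρ₀) ?_
  rw [List.perm_ext_iff_of_nodup (h1.imp (fun h => ne_of_lt h))
    ((pairwise_colA ρ₀).imp (fun h => ne_of_lt h))]
  intro x
  rw [List.mem_reverse, mem_descWord, ← mem_colSet]
  constructor
  · rintro ⟨i, h1, h2, rfl⟩
    exact (he i h1 h2).1
  · intro hx
    have h2 := he _ (rankIn_pos hx) (rankIn_le_card _ x)
    exact ⟨_, rankIn_pos hx, rankIn_le_card _ x, rankIn_injOn _ h2.1 hx h2.2⟩

theorem Good.colR {ρ : List ℕ} (h : Good ρ) : Good (colR ρ) :=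
  (h.equiv h.colA_equiv).right

theorem addHeads_mem_XF {n : ℕ} {ρ₀ : List ℕ} (hg : Good ρ₀) {e : ℕ → ℕ}
    (he : ∀ i, 1 ≤ i → i ≤ (colSet ρ₀).card → e i ∈ colSet ρ₀ ∧ rankIn (colSet ρ₀) (e i) = i)
    (hs : ∀ i k, 1 ≤ i → i < k → k ≤ (colSet ρ₀).card → e i < e k)
    (hn : (colSet ρ₀).card ≤ n) {g : ℕ → List ℕ}
    (hgm : g ∈ XF n (belowCount (colSet ρ₀)) (colR ρ₀)) :
    addHeads e (colSet ρ₀).card g ∈ XF n (rankIn (colSet ρ₀)) ρ₀ := by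
  rw [mem_XF_iff hg.colR (belowCount_mono _)] at hgm
  obtain ⟨h0, h1, h2, h3⟩ := hgm
  set h := (colSet ρ₀).card with hh
  have hlt : ∀ i, 1 ≤ i → i ≤ h → ∀ x ∈ g i, e i < x := fun i hi hi' x hx => by
    have := h2 i x hx
    rw [← le_belowCount_iff (he i hi hi').1, (he i hi hi').2]
    exact this
  have hinc : ∀ i, (addHeads e h g i).Pairwise (· < ·) := by
    intro i
    by_cases hi : 1 ≤ i ∧ i ≤ h
    · rw [addHeads_of_le e g hi.1 hi.2]
      exact List.pairwise_cons.mpr ⟨hlt i hi.1 hi.2, h1 i⟩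
    · rw [addHeads, if_neg hi]
      exact List.Pairwise.nil
  refine ⟨fun i hi => if_neg (by omega), hinc, fun i x hx => ?_, ?_⟩
  · have hi : 1 ≤ i ∧ i ≤ h := by
      by_contra hi
      rw [addHeads, if_neg hi] at hx
      simp at hx
    rw [addHeads_of_le e g hi.1 hi.2] at hx
    refine ⟨e i, (he i hi.1 hi.2).1, ?_, (he i hi.1 hi.2).2.ge⟩
    rcases List.mem_cons.mp hx with rfl | hx
    · exact le_rfl
    · exact (hlt i hi.1 hi.2 x hx).le
  · have hg0 : ∀ i, h < i → g i = [] := by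
      intro i hi
      rw [List.eq_nil_iff_forall_not_mem]
      intro x hx
      have := h2 i x hx
      have := belowCount_le (colSet ρ₀) x
      omega
    rw [blk_eq_of_empty hn (f := addHeads e h g) (fun i hi => if_neg (by omega))]
    rw [blk_eq_of_empty hn hg0] at h3
    refine (hg.colA_equiv.trans (h3.append_left _)).trans ?_
    rw [← descWord_eq_reverse_colA he hs]
    exact descWord_append_equiv hs fun i hi hi' => ⟨addHeads_of_le e g hi hi', hinc i⟩

theorem exists_addHeads {n : ℕ} {ρ₀ : List ℕ} (hg : Good ρ₀) {e : ℕ → ℕ}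
    (he : ∀ i, 1 ≤ i → i ≤ (colSet ρ₀).card → e i ∈ colSet ρ₀ ∧ rankIn (colSet ρ₀) (e i) = i)
    (hs : ∀ i k, 1 ≤ i → i < k → k ≤ (colSet ρ₀).card → e i < e k)
    (hn : (colSet ρ₀).card ≤ n) {f : ℕ → List ℕ} (hf : f ∈ XF n (rankIn (colSet ρ₀)) ρ₀) :
    ∃ g ∈ XF n (belowCount (colSet ρ₀)) (colR ρ₀), addHeads e (colSet ρ₀).card g = f := by
  obtain ⟨h0, h1, h2, h3⟩ := hf
  set h := (colSet ρ₀).card with hh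
  have hge : ∀ i, ∀ x ∈ f i, 1 ≤ i ∧ i ≤ h ∧ e i ≤ x := by
    intro i x hx
    obtain ⟨a, ha, hax, hia⟩ := h2 i x hx
    have hi := (mem_of_mem_block h0 hx).1
    have hih := hia.trans (rankIn_le_card _ a)
    refine ⟨hi, hih, ?_⟩
    by_contra! hlt
    have := rankIn_lt (he i hi hih).1 (hax.trans_lt hlt)
    rw [(he i hi hih).2] at this
    omega
  have hmem : ∀ i, 1 ≤ i → i ≤ h → e i ∈ f i := by
    intro i hi hih
    have h4 := rankIn_colSet_blk (blk f (i - 1) (n - (i - 1))) h1 (e i) 0 (i - 1)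
    rw [← blk_split f (by omega), ← h3.colSet_eq hg, (he i hi hih).2] at h4
    have h5 : ∃ x ∈ colSet (blk f (i - 1) (n - (i - 1))), x ≤ e i := by
      by_contra! h5
      rw [rankIn_eq_zero (A := colSet (blk f (i - 1) (n - (i - 1)))) h5] at h4
      omega
    obtain ⟨x, hx, hxe⟩ := h5
    obtain ⟨k, hk, -, hxk⟩ := mem_blk.mp (mem_of_mem_colSet hx)
    obtain ⟨-, hkh, hek⟩ := hge k x hxk
    have hki : k = i := by
      by_contra hne
      have := hs i k hi (by omega) hkh
      omega
    subst hki
    rwa [show e k = x by omega]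
  have hcons : ∀ i, 1 ≤ i → i ≤ h → f i = e i :: (f i).tail := by
    intro i hi hih
    have h4 := hmem i hi hih
    have h5 := h1 i
    cases hfi : f i with
    | nil => rw [hfi] at h4; simp at h4
    | cons b B =>
      rw [hfi] at h4 h5
      have h6 := (hge i b (by rw [hfi]; simp)).2.2
      rcases List.mem_cons.mp h4 with h7 | h7
      · rw [h7, List.tail_cons]
      · have := (List.pairwise_cons.mp h5).1 _ h7
        omega
  have hempty : ∀ i, ¬ (1 ≤ i ∧ i ≤ h) → f i = [] := by
    intro i hi
    rw [List.eq_nil_iff_forall_not_mem]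
    intro x hx
    exact hi ⟨(hge i x hx).1, (hge i x hx).2.1⟩
  refine ⟨fun i => (f i).tail, ?_, ?_⟩
  · rw [mem_XF_iff hg.colR (belowCount_mono _)]
    refine ⟨fun i hi => by simp [h0 i hi], fun i => (h1 i).tail, fun i x hx => ?_, ?_⟩
    · obtain ⟨hi, hih, -⟩ := hge i x (List.mem_of_mem_tail hx)
      have h4 := h1 i
      rw [hcons i hi hih, List.pairwise_cons] at h4
      have h5 := (le_belowCount_iff (he i hi hih).1).mpr (h4.1 x hx)
      rwa [(he i hi hih).2] at h5
    · rw [blk_eq_of_empty hn (f := fun i => (f i).tail)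
        (fun i hi => by rw [hempty i (by omega)]; rfl)]
      rw [blk_eq_of_empty hn (fun i hi => hempty i (by omega))] at h3
      have h4 := (h3.colA_colR hg).2
      rwa [colR_blk (g := fun i => (f i).tail) hs (fun i hi hih => ⟨hcons i hi hih, h1 i⟩) h 0
        (by omega)] at h4
  · funext i
    by_cases hi : 1 ≤ i ∧ i ≤ h
    · rw [addHeads_of_le e _ hi.1 hi.2, ← hcons i hi.1 hi.2]
    · rw [addHeads, if_neg hi, hempty i hi]

theorem genF_rankIn {n : ℕ} {ρ₀ : List ℕ} (hg : Good ρ₀) (hn : (colSet ρ₀).card ≤ n) :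
    genF n (rankIn (colSet ρ₀)) ρ₀ =
      xExp (oneC (colSet ρ₀).card) * genF n (belowCount (colSet ρ₀)) (colR ρ₀) := by
  obtain ⟨e, he⟩ := exists_enumeration (colSet ρ₀)
  have hs : ∀ i k, 1 ≤ i → i < k → k ≤ (colSet ρ₀).card → e i < e k := by
    intro i k h1 h2 h3
    by_contra! h4
    have := rankIn_mono (colSet ρ₀) h4
    rw [(he i h1 (by omega)).2, (he k (by omega) h3).2] at this
    omega
  have hempty : ∀ g ∈ XF n (belowCount (colSet ρ₀)) (colR ρ₀), ∀ i,
      ¬ (1 ≤ i ∧ i ≤ (colSet ρ₀).card) → g i = [] := by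
    intro g hgm i hi
    rw [List.eq_nil_iff_forall_not_mem]
    intro x hx
    have h1 := (mem_of_mem_block hgm.1 hx).1
    obtain ⟨a, -, -, h2⟩ := hgm.2.2.1 i x hx
    have := belowCount_le (colSet ρ₀) a
    omega
  rw [genF_eq_sum, genF_eq_sum, Finset.mul_sum]
  symm
  refine Finset.sum_bij (fun g _ => addHeads e (colSet ρ₀).card g) (fun g hgm => ?_)
    (fun g hgm g' hgm' heq => ?_) (fun f hf => ?_) (fun g hgm => ?_)
  · rw [Set.Finite.mem_toFinset] at hgm ⊢
    exact addHeads_mem_XF hg he hs hn hgm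
  · rw [Set.Finite.mem_toFinset] at hgm hgm'
    funext i
    by_cases hi : 1 ≤ i ∧ i ≤ (colSet ρ₀).card
    · have := congrFun heq i
      rw [addHeads_of_le e _ hi.1 hi.2, addHeads_of_le e _ hi.1 hi.2] at this
      exact (List.cons.inj this).2
    · rw [hempty g hgm i hi, hempty g' hgm' i hi]
  · rw [Set.Finite.mem_toFinset] at hf
    obtain ⟨g, hgm, rfl⟩ := exists_addHeads hg he hs hn hf
    exact ⟨g, by rwa [Set.Finite.mem_toFinset], rfl⟩
  · rw [Set.Finite.mem_toFinset] at hgm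
    rw [← xExp_add (N := n + 1) (β := oneC (colSet ρ₀).card) (γ := fun i => (g i).length)
      (fun i hi => if_neg (by omega)) (fun i hi => by simp [hgm.1 i (Or.inr (by omega))])]
    congr 1
    funext i
    by_cases hi : 1 ≤ i ∧ i ≤ (colSet ρ₀).card
    · rw [addHeads_of_le e _ hi.1 hi.2, oneC, if_pos hi, List.length_cons, add_comm]
    · rw [addHeads, if_neg hi, oneC, if_neg hi, hempty g hgm i hi]; rfl

/-! ### Equivalence classes and flagged key polynomials -/

theorem eval_one_xExp {β : ℕ → ℕ} (h : WeakComp β) :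
    MvPolynomial.eval (fun _ => (1 : ℤ)) (xExp β) = 1 := by
  obtain ⟨N, hN⟩ := h.exists_bound
  rw [xExp_eq hN, map_prod]
  exact Finset.prod_eq_one fun i _ => by simp

theorem genF_ne_zero {n : ℕ} {φ : ℕ → ℕ} {ρ₀ : List ℕ} (h : (XF n φ ρ₀).Nonempty) :
    genF n φ ρ₀ ≠ 0 := by
  intro h0
  have h1 := congrArg (MvPolynomial.eval (fun _ => (1 : ℤ))) h0
  rw [genF_eq_sum, map_sum, map_zero, Finset.sum_congr rfl fun f hf => eval_one_xExp
    (weakComp_lengths ((Set.Finite.mem_toFinset _).mp hf).1), Finset.sum_const,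
    nsmul_eq_mul, mul_one, Nat.cast_eq_zero, Finset.card_eq_zero] at h1
  obtain ⟨f, hf⟩ := h
  have : f ∈ (XF_finite n φ ρ₀).toFinset := (Set.Finite.mem_toFinset _).mpr hf
  rw [h1] at this
  simp at this

theorem exists_singletons (ρ : List ℕ) : ∃ f : ℕ → List ℕ,
    (∀ i, i = 0 ∨ ρ.length < i → f i = []) ∧ (∀ i, (f i).Pairwise (· < ·)) ∧
      blk f 0 ρ.length = ρ := by
  induction ρ with
  | nil => exact ⟨fun _ => [], fun _ _ => rfl, fun _ => List.Pairwise.nil, rfl⟩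
  | cons x ρ ih =>
    obtain ⟨f, h0, h1, h2⟩ := ih
    refine ⟨fun i => if i = ρ.length + 1 then [x] else f i, fun i hi => ?_, fun i => ?_, ?_⟩
    · dsimp only
      rw [List.length_cons] at hi
      rw [if_neg (by omega)]
      exact h0 i (by omega)
    · dsimp only
      split_ifs
      · simp
      · exact h1 i
    · rw [List.length_cons, blk, blk_congr (g := f) fun i h3 h4 => if_neg (by omega), h2]
      simp

theorem XF_nonempty {n : ℕ} {φ : ℕ → ℕ} {ρ₀ : List ℕ} (hg : Good ρ₀) (hn : ρ₀.length ≤ n)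
    (hφ : ∀ a, φ a = n) : (XF n φ ρ₀).Nonempty := by
  obtain ⟨f, h0, h1, h2⟩ := exists_singletons ρ₀
  refine ⟨f, ?_⟩
  rw [mem_XF_iff hg (fun a b _ => by rw [hφ, hφ])]
  have h3 : blk f 0 n = ρ₀ := by rw [blk_eq_of_empty hn (fun i hi => h0 i (Or.inr hi)), h2]
  have h4 : ∀ i, i = 0 ∨ n < i → f i = [] := fun i hi => h0 i (by omega)
  exact ⟨h4, h1, fun i x hx => (mem_of_mem_block h4 hx).2.1.trans (hφ x).ge,
    h3.symm ▸ CKEquiv.refl _⟩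

theorem genF_of_base {n : ℕ} {ρ₀ : List ℕ} (hg : Good ρ₀) {P : (ℕ → ℕ) → MvPolynomial ℕ ℤ → Prop}
    (hcongr : ∀ (φ ψ : ℕ → ℕ) (g : MvPolynomial ℕ ℤ),
      (∀ a ∈ colSet ρ₀, φ a = ψ a) → P φ g → P ψ g)
    (hsmall : ∀ (φ : ℕ → ℕ) (a : ℕ), MonotoneOn φ (colSet ρ₀) → a ∈ colSet ρ₀ →
      φ a < rankIn (colSet ρ₀) a → P φ 0)
    (hbase : P (rankIn (colSet ρ₀)) (genF n (rankIn (colSet ρ₀)) ρ₀))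
    (hstep : ∀ (φ : ℕ → ℕ) (a j : ℕ) (g : MvPolynomial ℕ ℤ), MonotoneOn φ (colSet ρ₀) →
      a ∈ colSet ρ₀ → 1 ≤ j → φ a = j + 1 → (∀ x ∈ colSet ρ₀, x < a → φ x < j) →
      P (Function.update φ a j) g → P φ (piOp j g))
    (φ : ℕ → ℕ) (hφ : MonotoneOn φ (colSet ρ₀)) (hφn : ∀ a ∈ colSet ρ₀, φ a ≤ n) :
    P φ (genF n φ ρ₀) := by
  revert hφn
  refine flag_induction (colSet ρ₀) (fun φ => (∀ a ∈ colSet ρ₀, φ a ≤ n) → P φ (genF n φ ρ₀))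
    ?_ ?_ (fun _ => hbase) ?_ φ hφ
  · intro φ ψ h hP hψ
    rw [← genF_congr h]
    exact hcongr φ ψ _ h (hP fun a ha => (h a ha).trans_le (hψ a ha))
  · intro φ a hm ha h hn
    rw [genF, XF_eq_empty hg hm ha (hn a ha) h, finsum_mem_empty]
    exact hsmall φ a hm ha h
  · intro φ a j hm ha hj hφa hlt _ hP hn
    have hjn : j + 1 ≤ n := hφa ▸ hn a ha
    rw [genF_step hg hm hj hjn ha hφa hlt]
    refine hstep φ a j _ hm ha hj hφa hlt (hP fun b hb => ?_)
    by_cases hba : b = a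
    · subst hba; rw [Function.update_self]; omega
    · rw [Function.update_of_ne hba]; exact hn b hb

theorem genF_rankIn_ne_zero {n : ℕ} {ρ₀ : List ℕ} (hg : Good ρ₀) (hn : ρ₀.length ≤ n) :
    genF n (rankIn (colSet ρ₀)) ρ₀ ≠ 0 := by
  intro h0
  refine genF_ne_zero (XF_nonempty hg hn (φ := fun _ => n) fun _ => rfl)
    (genF_of_base hg (P := fun _ g => g = 0) (fun _ _ _ _ h => h) (fun _ _ _ _ _ => rfl) h0
      (fun _ _ j g _ _ _ _ _ h => ?_) (fun _ => n) (fun _ _ _ _ _ => le_rfl) fun _ _ => le_rfl)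
  rw [h, piOp_zero]

theorem colR_length_lt {ρ : List ℕ} (hg : Good ρ) (h : ρ ≠ []) : (colR ρ).length < ρ.length := by
  have h1 := hg.colA_equiv.length
  obtain ⟨x, hx⟩ := List.exists_mem_of_ne_nil ρ h
  obtain ⟨m, hm, -⟩ := exists_mem_colSet_le hx
  rw [mem_colSet] at hm
  have := List.length_pos_of_mem hm
  simp only [List.length_append, List.length_reverse] at h1
  omega

theorem mem_of_mem_colR {ρ : List ℕ} (hg : Good ρ) {x : ℕ} (hx : x ∈ colR ρ) : x ∈ ρ :=
  (hg.colA_equiv.mem_iff x).mpr (List.mem_append_right _ hx)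

theorem genF_nil (n : ℕ) (φ : ℕ → ℕ) : genF n φ [] = 1 := by
  have : XF n φ [] = {fun _ => []} := by
    ext f
    rw [Set.mem_singleton_iff]
    constructor
    · rintro ⟨h0, -, -, h3⟩
      funext i
      rw [List.eq_nil_iff_forall_not_mem]
      intro x hx
      have := (h3.mem_iff x).mpr (mem_of_mem_block h0 hx).2.2
      simp at this
    · rintro rfl
      refine ⟨fun _ _ => rfl, fun _ => List.Pairwise.nil, fun i x hx => by simp at hx, ?_⟩
      rw [blk_eq_of_empty (Nat.zero_le n) (fun _ _ => rfl)]
      exact CKEquiv.refl _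
  rw [genF, this, finsum_mem_singleton]
  exact xExp_zero

theorem flaggedKeyPoly_zero (φ : ℕ → ℕ) : flaggedKeyPoly (fun _ => 0) φ = 1 := by
  have h0 : WeakComp fun _ => 0 := weakComp_of_bound (N := 0) rfl fun _ _ => rfl
  have h1 : rowsOf (fun _ => 0) ∅ := fun r => by simp
  have h2 : IsKey (fun _ => 0) (flaggedKeyPoly (fun _ => 0) φ) :=
    flaggedKeyPoly_isKey_of_strictMono h0 h1 (by simp [StrictMonoOn]) (by simp) (by simp)
      fun _ _ => rfl
  rw [h2.unique (IsKey.base _ h0 fun _ _ => le_rfl), xExp_zero]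

theorem exists_flaggedKeyPoly_of_rankIn {ρ₀ : List ℕ} (hg : Good ρ₀) {β : ℕ → ℕ}
    (hβ : WeakComp β) (hA : rowsOf β (colSet ρ₀))
    (h : ∀ n, (colSet ρ₀).card ≤ n →
      genF n (rankIn (colSet ρ₀)) ρ₀ = flaggedKeyPoly β (rankIn (colSet ρ₀)))
    (n : ℕ) (φ : ℕ → ℕ) (hm : MonotoneOn φ (colSet ρ₀)) (hn : ∀ a ∈ colSet ρ₀, φ a ≤ n) :
    genF n φ ρ₀ = flaggedKeyPoly β φ := by
  by_cases hc : (colSet ρ₀).card ≤ n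
  · refine genF_of_base hg (P := fun φ g => g = flaggedKeyPoly β φ) ?_ ?_ (h n hc) ?_ φ hm hn
    · intro φ ψ g hφψ hg'
      rw [hg', flaggedKeyPoly_congr hβ hA hφψ]
    · intro φ a hm ha h
      rw [flaggedKeyPoly_small hβ hA hm ha h]
    · intro φ a j g hm ha hj hφa hlt hg'
      rw [hg', flaggedKeyPoly_step hβ hA hm hj ha hφa hlt]
  · obtain ⟨a, ha, hra⟩ := exists_rankIn_eq (A := colSet ρ₀) (show 1 ≤ _ by omega) le_rfl
    have hlt : φ a < rankIn (colSet ρ₀) a := by have := hn a ha; omega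
    rw [flaggedKeyPoly_small hβ hA hm ha hlt, genF, XF_eq_empty hg hm ha (hn a ha) hlt,
      finsum_mem_empty]

/-- The flagged factorizations of an equivalence class are counted by a flagged key polynomial
whose nonzero rows are the entries of the first column. -/
theorem exists_flaggedKeyPoly (ρ₀ : List ℕ) (hg : Good ρ₀) (hpos : ∀ x ∈ ρ₀, 1 ≤ x) :
    ∃ β, WeakComp β ∧ rowsOf β (colSet ρ₀) ∧ ∀ n φ, MonotoneOn φ (colSet ρ₀) →
      (∀ a ∈ colSet ρ₀, φ a ≤ n) → genF n φ ρ₀ = flaggedKeyPoly β φ := by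
  induction hl : ρ₀.length using Nat.strong_induction_on generalizing ρ₀ with
  | _ l ih =>
  suffices key : ∃ β, WeakComp β ∧ rowsOf β (colSet ρ₀) ∧ ∀ n, (colSet ρ₀).card ≤ n →
      genF n (rankIn (colSet ρ₀)) ρ₀ = flaggedKeyPoly β (rankIn (colSet ρ₀)) by
    obtain ⟨β, hβ, hA, h⟩ := key
    exact ⟨β, hβ, hA, exists_flaggedKeyPoly_of_rankIn hg hβ hA h⟩
  by_cases hne : ρ₀ = []
  · subst hne
    refine ⟨fun _ => 0, weakComp_of_bound (N := 0) rfl fun _ _ => rfl, fun r => ?_, fun n _ => ?_⟩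
    · constructor
      · intro h; have := mem_of_mem_colSet h; simp at this
      · intro h; simp at h
    · rw [genF_nil, flaggedKeyPoly_zero]
  obtain ⟨β₁, hβ₁, hA₁, h₁⟩ := ih _ (hl ▸ colR_length_lt hg hne) (colR ρ₀) hg.colR
    (fun x hx => hpos x (mem_of_mem_colR hg hx)) rfl
  set A := colSet ρ₀ with hAdef
  have hb : ∀ n, A.card ≤ n → genF n (belowCount A) (colR ρ₀) = flaggedKeyPoly β₁ (belowCount A) :=
    fun n hn => h₁ n _ (fun a _ b _ h => belowCount_mono A h) fun a _ =>
      (belowCount_le A a).trans hn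
  obtain ⟨δ, hδ, hkey⟩ : ∃ δ : ℕ → ℕ, (∀ i, A.card < i → δ i = 0) ∧
      IsKey δ (flaggedKeyPoly β₁ (belowCount A)) := by
    refine (flaggedKeyPoly_isKey hβ₁ hA₁ (fun a _ b _ h => belowCount_mono A h)
      (fun a _ => belowCount_le A a)).resolve_left fun h0 => ?_
    have hN := genF_rankIn_ne_zero hg (le_max_right A.card ρ₀.length)
    rw [genF_rankIn hg (le_max_left _ _), hb _ (le_max_left _ _), h0, mul_zero] at hN
    exact hN rfl
  have hδ0 : δ 0 = 0 := hkey.weakComp.1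
  have hApos : ∀ a ∈ A, 1 ≤ a := fun a ha => hpos a (mem_of_mem_colSet ha)
  let β : ℕ → ℕ := fun a => if a ∈ A then δ (rankIn A a) + 1 else 0
  have hrows : rowsOf β A := by
    intro r
    dsimp only [β]
    split_ifs with h <;> simp [h]
  have hβ : WeakComp β := by
    refine weakComp_of_bound (N := A.sup id + 1) ?_ fun i hi => ?_
    · exact if_neg fun h => by have := hApos 0 h; omega
    · refine if_neg fun h => ?_
      have := Finset.le_sup (f := id) h
      simp only [id] at this
      omega
  refine ⟨β, hβ, hrows, fun n hn => ?_⟩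
  rw [genF_rankIn hg hn, hb n hn]
  refine (hkey.mul_oneC hδ).unique (flaggedKeyPoly_isKey_of_strictMono hβ hrows
    (rankIn_strictMonoOn A) (fun a ha => rankIn_pos ha) (fun a ha => ?_) fun v hv => ?_)
  · dsimp only [β]
    rw [if_pos ha, oneC, if_pos ⟨rankIn_pos ha, rankIn_le_card A a⟩]
  · dsimp only [oneC]
    split_ifs with h
    · obtain ⟨a, ha, hav⟩ := exists_rankIn_eq h.1 h.2
      exact absurd hav (hv a ha)
    · by_cases h0 : v = 0
      · rw [h0, hδ0]
      · rw [hδ v (by omega)]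

/-! ### Runs and their rows -/

theorem runFact_flatten (ρ : List ℕ) : (runFact ρ).flatten = ρ := by
  induction ρ with
  | nil => rfl
  | cons a ρ ih =>
    rw [runFact]
    split
    · next h => rw [h] at ih; simp at ih; simp [← ih]
    · next r rs h => rw [h] at ih; split_ifs <;> simpa using ih

theorem runFact_ne_nil (ρ : List ℕ) : ∀ b ∈ runFact ρ, b ≠ [] := by
  induction ρ with
  | nil => simp [runFact]
  | cons a ρ ih =>
    rw [runFact]
    split
    · simp
    · next r rs h =>
      rw [h] at ih
      split_ifs
      · simp only [List.mem_cons, forall_eq_or_imp] at ih ⊢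
        exact ⟨by simp, ih.2⟩
      · simp only [List.mem_cons, forall_eq_or_imp] at ih ⊢
        exact ⟨by simp, ih⟩

theorem runFact_increasing (ρ : List ℕ) : ∀ b ∈ runFact ρ, b.Pairwise (· < ·) := by
  induction ρ with
  | nil => simp [runFact]
  | cons a ρ ih =>
    have hne := runFact_ne_nil ρ
    rw [runFact]
    split
    · simp
    · next r rs h =>
      rw [h] at ih hne
      split_ifs with hlt
      · simp only [List.mem_cons, forall_eq_or_imp] at ih hne ⊢
        refine ⟨?_, ih.2⟩
        obtain ⟨b, r', rfl⟩ := List.exists_cons_of_ne_nil hne.1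
        simp only [List.headI] at hlt
        refine List.pairwise_cons.mpr ⟨fun x hx => ?_, ih.1⟩
        rcases List.mem_cons.mp hx with rfl | hx
        · exact hlt
        · exact hlt.trans (List.rel_of_pairwise_cons ih.1 hx)
      · simp only [List.mem_cons, forall_eq_or_imp] at ih ⊢
        exact ⟨by simp, ih⟩

theorem runFact_append {u : List ℕ} (hu : u.Pairwise (· < ·)) (hne : u ≠ []) (ρ : List ℕ) :
    (∃ r rs, runFact ρ = r :: rs ∧ runFact (u ++ ρ) = (u ++ r) :: rs) ∨
      runFact (u ++ ρ) = u :: runFact ρ := by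
  induction u with
  | nil => exact absurd rfl hne
  | cons a u ih =>
    rcases u with - | ⟨b, u⟩
    · rw [List.singleton_append, runFact]
      split
      · next h => right; rw [h]
      · next r rs h =>
        split_ifs
        · exact Or.inl ⟨r, rs, h, rfl⟩
        · right; rw [h]
    · have hab : a < b := List.rel_of_pairwise_cons hu (by simp)
      rcases ih (List.Pairwise.of_cons hu) (by simp) with ⟨r, rs, h1, h2⟩ | h
      · refine Or.inl ⟨r, rs, h1, ?_⟩
        rw [List.cons_append, runFact, h2]
        simp [hab]
      · right
        rw [List.cons_append, runFact, h]
        simp [hab]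

/-- The runs of a run factorization paired with their rows, where the first run lies strictly
below the row `p`. -/
def rowRuns : ℤ → List (List ℕ) → List (ℤ × List ℕ)
  | _, [] => []
  | p, b :: bs => (min (p - 1) (b.headI : ℤ), b) :: rowRuns (min (p - 1) (b.headI : ℤ)) bs

theorem map_fst_rowRuns (p : ℤ) (bs : List (List ℕ)) :
    (rowRuns p bs).map Prod.fst = wdtRowsAux p bs := by
  induction bs generalizing p with
  | nil => rfl
  | cons b bs ih => simp [rowRuns, wdtRowsAux, ih]

theorem map_snd_rowRuns (p : ℤ) (bs : List (List ℕ)) : (rowRuns p bs).map Prod.snd = bs := by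
  induction bs generalizing p with
  | nil => rfl
  | cons b bs ih => simp [rowRuns, ih]

theorem zip_wdtRowsAux (p : ℤ) (bs : List (List ℕ)) :
    (wdtRowsAux p bs).zip bs = rowRuns p bs := by
  induction bs generalizing p with
  | nil => rfl
  | cons b bs ih => simp [rowRuns, wdtRowsAux, ih]

theorem headI_lt {ρ : List ℕ} {p : ℤ} (hp : ∀ x ∈ ρ, (x : ℤ) < p) {b : List ℕ}
    {bs : List (List ℕ)} (h : runFact ρ = b :: bs) : (b.headI : ℤ) < p := by
  have h1 := runFact_ne_nil ρ b (by simp [h])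
  obtain ⟨x, b', rfl⟩ := List.exists_cons_of_ne_nil h1
  refine hp x ?_
  rw [← runFact_flatten ρ, h]
  simp

theorem wdtRows_eq {ρ : List ℕ} {p : ℤ} (hp : ∀ x ∈ ρ, (x : ℤ) < p) :
    wdtRows (runFact ρ) = wdtRowsAux p (runFact ρ) := by
  cases h : runFact ρ with
  | nil => rfl
  | cons b bs =>
    have := headI_lt hp h
    rw [wdtRows, wdtRowsAux, min_eq_right (by omega)]

theorem rowRuns_lt (p : ℤ) (bs : List (List ℕ)) : ∀ z ∈ rowRuns p bs, z.1 < p := by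
  induction bs generalizing p with
  | nil => simp [rowRuns]
  | cons b bs ih =>
    intro z hz
    rcases List.mem_cons.mp hz with rfl | hz
    · dsimp only; omega
    · have := ih _ z hz; omega

theorem rowRuns_pairwise (p : ℤ) (bs : List (List ℕ)) :
    (rowRuns p bs).Pairwise fun y z => z.1 < y.1 := by
  induction bs generalizing p with
  | nil => simp [rowRuns]
  | cons b bs ih => exact List.pairwise_cons.mpr ⟨rowRuns_lt _ bs, ih _⟩

theorem rowRuns_le_headI (p : ℤ) (bs : List (List ℕ)) :
    ∀ z ∈ rowRuns p bs, z.1 ≤ (z.2.headI : ℤ) := by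
  induction bs generalizing p with
  | nil => simp [rowRuns]
  | cons b bs ih =>
    intro z hz
    rcases List.mem_cons.mp hz with rfl | hz
    · exact min_le_right _ _
    · exact ih _ z hz

/-- The run placed in row `r`, if any. -/
def rowAt (Z : List (ℤ × List ℕ)) (r : ℤ) : List ℕ :=
  match Z.find? (fun p => decide (p.1 = r)) with
  | some p => p.2
  | none => []

theorem rowAt_cons_self (r : ℤ) (b : List ℕ) (Z : List (ℤ × List ℕ)) :
    rowAt ((r, b) :: Z) r = b := by
  simp [rowAt]

theorem rowAt_cons_of_ne {r s : ℤ} (h : r ≠ s) (b : List ℕ) (Z : List (ℤ × List ℕ)) :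
    rowAt ((r, b) :: Z) s = rowAt Z s := by
  simp [rowAt, h]

theorem rowAt_mem {Z : List (ℤ × List ℕ)} {r : ℤ} (h : rowAt Z r ≠ []) : (r, rowAt Z r) ∈ Z := by
  unfold rowAt at h ⊢
  split at h
  · next p hp =>
    have h1 := List.mem_of_find?_eq_some hp
    have h2 := List.find?_some hp
    simp only [decide_eq_true_eq] at h2
    rw [← h2]
    exact h1
  · exact absurd rfl h

theorem blk_rowAt {Z : List (ℤ × List ℕ)} (hZ : Z.Pairwise fun y z => z.1 < y.1)
    (h1 : ∀ z ∈ Z, 1 ≤ z.1) (k : ℕ) :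
    blk (fun i => rowAt Z i) 0 k =
      ((Z.filter fun z => decide (z.1 ≤ (k : ℤ))).map Prod.snd).flatten := by
  induction Z generalizing k with
  | nil =>
    have : ∀ i : ℕ, 0 < i → (fun j : ℕ => rowAt [] j) i = [] := fun i _ => rfl
    rw [blk_eq_of_empty (Nat.zero_le k) this]; rfl
  | cons z Z ih =>
    obtain ⟨r, b⟩ := z
    have hr : 1 ≤ r := h1 (r, b) (by simp)
    have hlt := (List.pairwise_cons.mp hZ).1
    have ih := ih (List.Pairwise.of_cons hZ) fun z hz => h1 z (by simp [hz])
    dsimp only at hlt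
    by_cases hk : r ≤ (k : ℤ)
    · obtain ⟨m, rfl⟩ : ∃ m : ℕ, r = ((m + 1 : ℕ) : ℤ) := ⟨(r - 1).toNat, by omega⟩
      rw [List.filter_cons_of_pos (by simpa using hk), List.map_cons, List.flatten_cons,
        blk_eq_of_empty (h := m + 1) (by omega), blk]
      · have h2 : blk (fun i : ℕ => rowAt ((((m + 1 : ℕ) : ℤ), b) :: Z) i) 0 m =
            blk (fun i : ℕ => rowAt Z i) 0 m :=
          blk_congr fun i _ h => rowAt_cons_of_ne (by omega) b Z
        rw [h2, ih m]
        rw [Nat.zero_add, rowAt_cons_self, List.filter_congr (q := fun z => decide (z.1 ≤ (k : ℤ)))]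
        intro z hz
        have := hlt z hz
        rw [decide_eq_true (by omega), decide_eq_true (by omega)]
      · intro i hi
        rw [rowAt_cons_of_ne (by omega)]
        by_contra hne
        have := hlt _ (rowAt_mem hne)
        dsimp only at this
        omega
    · rw [List.filter_cons_of_neg (by simpa using hk), ← ih k]
      exact blk_congr fun i _ h => rowAt_cons_of_ne (by omega) b Z

/-- The number of letters placed in rows of index at most `k`. -/
def rowCount (k p : ℤ) (bs : List (List ℕ)) : ℕ :=
  ((((rowRuns p bs).filter fun z => decide (z.1 ≤ k)).map Prod.snd).flatten).length

theorem rowCount_nil (k p : ℤ) : rowCount k p [] = 0 := rfl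

theorem rowCount_cons (k p : ℤ) (b : List ℕ) (bs : List (List ℕ)) :
    rowCount k p (b :: bs) = (if min (p - 1) (b.headI : ℤ) ≤ k then b.length else 0) +
      rowCount k (min (p - 1) (b.headI : ℤ)) bs := by
  unfold rowCount
  rw [rowRuns]
  by_cases h : min (p - 1) (b.headI : ℤ) ≤ k
  · rw [List.filter_cons_of_pos (by simpa using h), if_pos h]
    simp
  · rw [List.filter_cons_of_neg (by simpa using h), if_neg h, zero_add]

theorem rowCount_anti (k : ℤ) {p q : ℤ} (h : q ≤ p) (bs : List (List ℕ)) :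
    rowCount k p bs ≤ rowCount k q bs := by
  induction bs generalizing p q with
  | nil => rfl
  | cons b bs ih =>
    rw [rowCount_cons, rowCount_cons]
    refine add_le_add ?_ (ih (by omega))
    split_ifs <;> omega

theorem rowCount_le (k p : ℤ) (bs : List (List ℕ)) : rowCount k p bs ≤ bs.flatten.length := by
  induction bs generalizing p with
  | nil => simp [rowCount_nil]
  | cons b bs ih =>
    rw [rowCount_cons, List.flatten_cons, List.length_append]
    refine add_le_add ?_ (ih _)
    split_ifs <;> omega

theorem length_blk_mono (f : ℕ → List ℕ) {k n : ℕ} (h : k ≤ n) :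
    (blk f 0 k).length ≤ (blk f 0 n).length := by
  rw [blk_split f h, List.length_append]; omega

theorem rowCount_runFact_blk {f : ℕ → List ℕ} (hf : ∀ i, (f i).Pairwise (· < ·))
    (hle : ∀ i, ∀ x ∈ f i, i ≤ x) (k n : ℕ) {p : ℤ} (hp : (n : ℤ) < p) :
    rowCount k p (runFact (blk f 0 n)) ≤ (blk f 0 k).length := by
  induction n generalizing p with
  | zero => simp [blk, runFact, rowCount_nil]
  | succ n ih =>
    by_cases hk : n + 1 ≤ k
    · refine (rowCount_le _ _ _).trans ?_
      rw [runFact_flatten]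
      exact length_blk_mono f hk
    rw [blk, zero_add]
    by_cases hne : f (n + 1) = []
    · rw [hne, List.nil_append]
      exact ih (by omega)
    have hhead : ∀ v : List ℕ, n + 1 ≤ (f (n + 1) ++ v).headI := by
      obtain ⟨x, u, hxu⟩ := List.exists_cons_of_ne_nil hne
      intro v
      have := hle (n + 1) x (by simp [hxu])
      rw [hxu]
      exact this
    rcases runFact_append (hf (n + 1)) hne (blk f 0 n) with ⟨r, rs, h1, h2⟩ | h
    · have := hhead r
      have h3 := ih (p := (n + 1 : ℕ)) (by omega)
      rw [h1, rowCount_cons] at h3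
      rw [h2, rowCount_cons, if_neg (by omega), zero_add]
      refine (rowCount_anti _ ?_ rs).trans ((Nat.le_add_left _ _).trans h3)
      omega
    · have := hhead []
      rw [List.append_nil] at this
      rw [h, rowCount_cons, if_neg (by omega), zero_add]
      exact ih (by omega)

theorem rowCount_pos {k p : ℤ} {bs : List (List ℕ)} (hbs : ∀ b ∈ bs, b ≠ []) {z : ℤ × List ℕ}
    (hz : z ∈ rowRuns p bs) (hk : z.1 ≤ k) : 0 < rowCount k p bs := by
  have h1 : z.2 ∈ bs := by
    rw [← map_snd_rowRuns p bs]; exact List.mem_map_of_mem hz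
  obtain ⟨x, hx⟩ := List.exists_mem_of_ne_nil _ (hbs _ h1)
  refine List.length_pos_of_mem (a := x) ?_
  refine List.mem_flatten.mpr ⟨z.2, List.mem_map_of_mem (List.mem_filter.mpr ⟨hz, ?_⟩), hx⟩
  simpa using hk

/-! ### Weak descent compositions and flagged factorizations -/

theorem exists_letter_bound (ρ : List ℕ) : ∃ p : ℤ, ∀ x ∈ ρ, (x : ℤ) < p := by
  induction ρ with
  | nil => exact ⟨0, by simp⟩
  | cons a ρ ih =>
    obtain ⟨p, hp⟩ := ih
    refine ⟨max p (a + 1), fun x hx => ?_⟩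
    rcases List.mem_cons.mp hx with rfl | hx
    · omega
    · have := hp x hx; omega

theorem nonVirtual_iff {ρ : List ℕ} {p : ℤ} (hp : ∀ x ∈ ρ, (x : ℤ) < p) :
    NonVirtual ρ ↔ ∀ z ∈ rowRuns p (runFact ρ), 1 ≤ z.1 := by
  rw [NonVirtual, wdtRows_eq hp, ← map_fst_rowRuns]
  simp

theorem weakDesTab_eq {ρ : List ℕ} {p : ℤ} (hp : ∀ x ∈ ρ, (x : ℤ) < p) (r : ℤ) (c : ℕ) :
    weakDesTab ρ r c =
      if c = 0 then 0 else (rowAt (rowRuns p (runFact ρ)) r).getD (c - 1) 0 := by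
  unfold weakDesTab rowAt
  rw [wdtRows_eq hp, zip_wdtRowsAux]
  split_ifs with h
  · rfl
  · cases List.find? (fun p => decide (p.1 = r)) (rowRuns p (runFact ρ)) <;> simp

theorem ncard_getD_ne_zero {u : List ℕ} (hu : ∀ x ∈ u, 1 ≤ x) :
    Set.ncard {c : ℕ | (if c = 0 then 0 else u.getD (c - 1) 0) ≠ 0} = u.length := by
  have : {c : ℕ | (if c = 0 then 0 else u.getD (c - 1) 0) ≠ 0} = ↑(Finset.Icc 1 u.length) := by
    ext c
    simp only [Set.mem_setOf_eq, Finset.coe_Icc, Set.mem_Icc]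
    by_cases hc : c = 0
    · simp [hc]
    rw [if_neg hc]
    by_cases hcu : c - 1 < u.length
    · rw [List.getD_eq_getElem _ _ hcu]
      have := hu _ (List.getElem_mem hcu)
      constructor <;> intro <;> omega
    · rw [List.getD_eq_default _ _ (by omega)]
      constructor
      · intro h; exact absurd rfl h
      · intro h; omega
  rw [this, Set.ncard_coe_finset, Nat.card_Icc]
  omega

theorem mem_of_mem_rowAt {ρ : List ℕ} {p r : ℤ} {x : ℕ}
    (hx : x ∈ rowAt (rowRuns p (runFact ρ)) r) : x ∈ ρ := by
  have h1 := rowAt_mem (List.ne_nil_of_mem hx)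
  rw [← runFact_flatten ρ, ← map_snd_rowRuns p (runFact ρ)]
  exact List.mem_flatten.mpr ⟨_, List.mem_map_of_mem h1, hx⟩

theorem desComp_eq {ρ : List ℕ} {p : ℤ} (hp : ∀ x ∈ ρ, (x : ℤ) < p) (h1 : ∀ x ∈ ρ, 1 ≤ x)
    (i : ℕ) : desComp ρ i = (rowAt (rowRuns p (runFact ρ)) i).length := by
  rw [← ncard_getD_ne_zero fun x hx => h1 x (mem_of_mem_rowAt hx)]
  unfold desComp shapeOf
  congr 1
  ext c
  rw [Set.mem_setOf_eq, weakDesTab_eq hp]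
  rfl

theorem length_blk (f : ℕ → List ℕ) (k : ℕ) :
    (blk f 0 k).length = ∑ i ∈ Finset.Icc 1 k, (f i).length := by
  induction k with
  | zero => rfl
  | succ k ih =>
    rw [blk, List.length_append, ih, Finset.sum_Icc_succ_top (by omega), zero_add, add_comm]

/-- The word of a factorization whose `i`-th block has letters at least `i` is non-virtual, and
its weak descent composition is dominated by the lengths of the blocks. -/
theorem nonVirtual_blk {f : ℕ → List ℕ} (hf : ∀ i, (f i).Pairwise (· < ·))
    (hle : ∀ i, ∀ x ∈ f i, i ≤ x) (n : ℕ) :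
    NonVirtual (blk f 0 n) ∧ compLE (desComp (blk f 0 n)) fun i => (f i).length := by
  obtain ⟨p', hp'⟩ := exists_letter_bound (blk f 0 n)
  set p := max p' (n + 1)
  have hp : ∀ x ∈ blk f 0 n, (x : ℤ) < p := fun x hx => by have := hp' x hx; omega
  have hnv : NonVirtual (blk f 0 n) := by
    rw [nonVirtual_iff hp]
    intro z hz
    by_contra hlt
    have h1 := rowCount_pos (k := (0 : ℕ)) (runFact_ne_nil _) hz (by push_cast; omega)
    have h2 := rowCount_runFact_blk hf hle 0 n (p := p) (by omega)
    simp only [blk, List.length_nil] at h2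
    omega
  refine ⟨hnv, fun k => ?_⟩
  have h1 : ∀ x ∈ blk f 0 n, 1 ≤ x := fun x hx => by
    obtain ⟨i, hi, -, hx⟩ := mem_blk.mp hx
    have := hle i x hx
    omega
  rw [← length_blk, Finset.sum_congr rfl fun i _ => desComp_eq hp h1 i,
    ← length_blk fun i : ℕ => rowAt (rowRuns p (runFact (blk f 0 n))) i,
    blk_rowAt (rowRuns_pairwise _ _) ((nonVirtual_iff hp).mp hnv)]
  exact rowCount_runFact_blk hf hle k n (by omega)

theorem exists_factorization_of_nonVirtual {ρ : List ℕ} (hρ : NonVirtual ρ)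
    (h1 : ∀ x ∈ ρ, 1 ≤ x) {n : ℕ} (hn : ∀ x ∈ ρ, x ≤ n) :
    ∃ f : ℕ → List ℕ, (∀ i, i = 0 ∨ n < i → f i = []) ∧ (∀ i, (f i).Pairwise (· < ·)) ∧
      (∀ i, ∀ x ∈ f i, i ≤ x) ∧ blk f 0 n = ρ ∧ ∀ i, (f i).length = desComp ρ i := by
  have hp : ∀ x ∈ ρ, (x : ℤ) < n + 1 := fun x hx => by have := hn x hx; omega
  have hrow := (nonVirtual_iff hp).mp hρ
  refine ⟨fun i => rowAt (rowRuns (n + 1) (runFact ρ)) i, fun i hi => ?_, fun i => ?_,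
    fun i x hx => ?_, ?_, fun i => (desComp_eq hp h1 i).symm⟩
  · by_contra hne
    have h2 := hrow _ (rowAt_mem hne)
    have h3 := rowRuns_lt _ _ _ (rowAt_mem hne)
    dsimp only at h2 h3
    omega
  · dsimp only
    by_cases hne : rowAt (rowRuns (n + 1) (runFact ρ)) i = []
    · rw [hne]; exact List.Pairwise.nil
    · refine runFact_increasing ρ _ ?_
      have := List.mem_map_of_mem (f := Prod.snd) (rowAt_mem hne)
      rwa [map_snd_rowRuns] at this
  · dsimp only at hx
    have hne := List.ne_nil_of_mem hx
    have h2 := rowRuns_le_headI _ _ _ (rowAt_mem hne)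
    have h3 := List.mem_map_of_mem (f := Prod.snd) (rowAt_mem hne)
    rw [map_snd_rowRuns] at h3
    have h4 := runFact_increasing ρ _ h3
    dsimp only at h2 h4
    revert h2 h4 hx
    generalize rowAt (rowRuns (↑n + 1) (runFact ρ)) ↑i = u
    rcases u with - | ⟨y, u⟩
    · simp
    · intro hx h2 h4
      simp only [List.headI] at h2
      rcases List.mem_cons.mp hx with rfl | hx
      · omega
      · have := List.rel_of_pairwise_cons h4 hx; omega
  · rw [blk_rowAt (rowRuns_pairwise _ _) hrow, List.filter_eq_self.mpr, map_snd_rowRuns,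
      runFact_flatten]
    intro z hz
    have := rowRuns_lt _ _ z hz
    simp only [decide_eq_true_eq]
    omega

/-! ### The Yamanouchi word of an equivalence class -/

theorem WeakComp.exists_finsupp {β : ℕ → ℕ} (h : WeakComp β) : ∃ d : ℕ →₀ ℕ, ∀ i, d i = β i :=
  ⟨Finsupp.ofSupportFinite β h.2, fun _ => rfl⟩

theorem coeff_genF (n : ℕ) (φ : ℕ → ℕ) (ρ₀ : List ℕ) (d : ℕ →₀ ℕ) :
    coeff d (genF n φ ρ₀) =
      (((XF_finite n φ ρ₀).toFinset.filter fun f => ∀ i, d i = (f i).length).card : ℤ) := by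
  rw [genF_eq_sum, coeff_sum, Finset.card_filter, Nat.cast_sum]
  refine Finset.sum_congr rfl fun f hf => ?_
  have hw := weakComp_lengths ((Set.Finite.mem_toFinset _).mp hf).1
  obtain ⟨e, he⟩ := hw.exists_finsupp
  rw [xExp_eq_monomial_of_coe hw he, coeff_monomial]
  by_cases h : e = d
  · subst h
    rw [if_pos rfl, if_pos he]
    simp
  · rw [if_neg h, if_neg fun h' => h (by ext i; rw [he, h'])]
    simp

theorem compLE_antisymm {μ ν : ℕ → ℕ} (h0 : μ 0 = ν 0) (h1 : compLE μ ν) (h2 : compLE ν μ) :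
    μ = ν := by
  funext k
  cases k with
  | zero => exact h0
  | succ k =>
    have h3 := le_antisymm (h1 k) (h2 k)
    have h4 := le_antisymm (h1 (k + 1)) (h2 (k + 1))
    rw [Finset.sum_Icc_succ_top (by omega), Finset.sum_Icc_succ_top (by omega)] at h4
    omega

theorem exists_letter_le (ρ : List ℕ) : ∃ n : ℕ, ∀ x ∈ ρ, x ≤ n := by
  obtain ⟨p, hp⟩ := exists_letter_bound ρ
  exact ⟨p.toNat, fun x hx => by have := hp x hx; omega⟩

theorem exists_yamanouchi {ρ₀ : List ℕ} (hρ : IsReducedWord ρ₀) :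
    ∃ σ, Yamanouchi σ ∧ CKEquiv ρ₀ σ ∧ (∀ τ, Yamanouchi τ → CKEquiv ρ₀ τ → τ = σ) ∧
      WeakComp (desComp σ) ∧ rowsOf (desComp σ) (colSet ρ₀) ∧
      ∀ n φ, MonotoneOn φ (colSet ρ₀) → (∀ a ∈ colSet ρ₀, φ a ≤ n) →
        genF n φ ρ₀ = flaggedKeyPoly (desComp σ) φ := by
  have hg := hρ.good
  obtain ⟨β, hβ, hA, hgen⟩ := exists_flaggedKeyPoly ρ₀ hg hρ.1
  obtain ⟨n, hn⟩ := exists_letter_le ρ₀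
  have hnA : ∀ a ∈ colSet ρ₀, a ≤ n := fun a ha => hn a (mem_of_mem_colSet ha)
  have hid : genF n id ρ₀ = flaggedKeyPoly β id :=
    hgen n id (fun _ _ _ _ h => h) hnA
  obtain ⟨htri, hone⟩ := flaggedKeyPoly_triangular (φ := id) hβ hA fun a _ => rfl
  rw [← hid] at htri hone
  have hmem : ∀ f : ℕ → List ℕ, f ∈ XF n id ρ₀ ↔ _ := fun f => mem_XF_iff hg monotone_id
  have hdom : ∀ f ∈ XF n id ρ₀, compLE β fun i => (f i).length := by
    intro f hf
    obtain ⟨d, hd⟩ := (weakComp_lengths hf.1).exists_finsupp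
    have : compLE β d := by
      refine htri d ?_
      rw [coeff_genF, Nat.cast_ne_zero]
      exact Finset.card_ne_zero_of_mem
        (Finset.mem_filter.mpr ⟨(Set.Finite.mem_toFinset _).mpr hf, hd⟩)
    exact (funext hd : (d : ℕ → ℕ) = _) ▸ this
  have hword : ∀ τ, NonVirtual τ → CKEquiv ρ₀ τ →
      ∃ f ∈ XF n id ρ₀, blk f 0 n = τ ∧ (fun i => (f i).length) = desComp τ := by
    intro τ h1 h2
    have h3 := h2.isReducedWord hρ
    obtain ⟨f, a, b, c, d, e⟩ := exists_factorization_of_nonVirtual h1 h3.1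
      (fun x hx => hn x ((h2.mem_iff x).mpr hx))
    exact ⟨f, (hmem f).mpr ⟨a, b, c, d ▸ h2⟩, d, funext e⟩
  obtain ⟨d, hd⟩ := hβ.exists_finsupp
  have hcard := hone d hd
  rw [coeff_genF, Nat.cast_eq_one, Finset.card_eq_one] at hcard
  obtain ⟨f, hf⟩ := hcard
  have huniq : ∀ g, (g ∈ XF n id ρ₀ ∧ (fun i => (g i).length) = β) ↔ g = f := by
    intro g
    rw [show g = f ↔ g ∈ ({f} : Finset _) from Finset.mem_singleton.symm, ← hf, Finset.mem_filter, Set.Finite.mem_toFinset]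
    refine and_congr_right fun _ => ⟨fun h i => ?_, fun h => funext fun i => ?_⟩
    · rw [hd, ← h]
    · rw [← hd, h]
  obtain ⟨hfX, hfβ⟩ := (huniq f).mpr rfl
  have hf' := (hmem f).mp hfX
  obtain ⟨hnv, hle⟩ := nonVirtual_blk hf'.2.1 hf'.2.2.1 n
  rw [hfβ] at hle
  have hdes : ∀ τ, NonVirtual τ → CKEquiv ρ₀ τ → compLE β (desComp τ) := by
    intro τ h1 h2
    obtain ⟨g, hgX, -, h3⟩ := hword τ h1 h2
    exact h3 ▸ hdom g hgX
  have heq : ∀ τ, NonVirtual τ → CKEquiv ρ₀ τ → compLE (desComp τ) β → desComp τ = β := by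
    intro τ h1 h2 h3
    refine compLE_antisymm ?_ h3 (hdes τ h1 h2)
    obtain ⟨g, hgX, -, h4⟩ := hword τ h1 h2
    rw [← h4, hβ.1]
    simp [hgX.1 0 (Or.inl rfl)]
  have hck := hf'.2.2.2
  have hσ : desComp (blk f 0 n) = β := heq _ hnv hck hle
  refine ⟨blk f 0 n, ⟨hck.isReducedWord hρ, hnv, fun τ h1 h2 => ?_⟩, hck, fun τ hτ h2 => ?_, ?_⟩
  · rw [hσ]
    exact hdes τ h1 (hck.trans h2)
  · have h3 : desComp τ = β :=
      heq τ hτ.2.1 h2 (hσ ▸ hτ.2.2 _ hnv (h2.symm.trans hck))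
    obtain ⟨g, hgX, h4, h5⟩ := hword τ hτ.2.1 h2
    rw [← h4, (huniq g).mp ⟨hgX, h5.trans h3⟩]
  · rw [hσ]
    exact ⟨hβ, hA, hgen⟩

/-! ### Letters of reduced words -/

theorem wordPerm_filter_apply {g : ℕ} {σ : List ℕ} (hσ : g ∉ σ) {i : ℕ} (hi : i ≤ g) :
    wordPerm σ i = wordPerm (σ.filter fun x => decide (x < g)) i ∧ wordPerm σ i ≤ g := by
  induction σ with
  | nil => exact ⟨rfl, hi⟩
  | cons x σ ih =>
    obtain ⟨h1, h2⟩ := ih fun h => hσ (List.mem_cons_of_mem _ h)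
    have hx : x ≠ g := fun h => hσ (by simp [h])
    rw [wordPerm_cons, Equiv.Perm.mul_apply]
    by_cases hxg : x < g
    · rw [List.filter_cons_of_pos (by simpa using hxg), wordPerm_cons, Equiv.Perm.mul_apply, ← h1]
      refine ⟨rfl, ?_⟩
      by_cases h3 : wordPerm σ i = x
      · rw [h3, sPerm_left]; omega
      · by_cases h4 : wordPerm σ i = x + 1
        · rw [h4, sPerm_right]; omega
        · rwa [sPerm_of_ne h3 h4]
    · rw [List.filter_cons_of_neg (by simpa using hxg), ← h1, sPerm_of_ne (by omega) (by omega)]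
      exact ⟨rfl, h2⟩

theorem wordPerm_apply_of_lt {g : ℕ} {σ : List ℕ} (hσ : ∀ x ∈ σ, x < g) {i : ℕ} (hi : g < i) :
    wordPerm σ i = i := by
  induction σ with
  | nil => rfl
  | cons x σ ih =>
    have := hσ x (by simp)
    rw [wordPerm_cons, Equiv.Perm.mul_apply, ih fun y hy => hσ y (List.mem_cons_of_mem _ hy),
      sPerm_of_ne (by omega) (by omega)]

theorem IsReducedWord.lt_of_not_mem {σ : List ℕ} (hσ : IsReducedWord σ) {N g : ℕ}
    (hN : ∀ i, N < i → wordPerm σ i = i) (hg : N < g) (hgσ : g ∉ σ) : ∀ x ∈ σ, x < g := by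
  have h1 : wordPerm (σ.filter fun x => decide (x < g)) = wordPerm σ := by
    ext i
    by_cases hi : i ≤ g
    · rw [(wordPerm_filter_apply hgσ hi).1]
    · rw [wordPerm_apply_of_lt (g := g) (fun x hx => ?_) (by omega), hN i (by omega)]
      simpa using (List.mem_filter.mp hx).2
  have h2 := hσ.2 _ (fun x hx => hσ.1 x (List.mem_filter.mp hx).1) h1
  intro x hx
  have h3 := List.length_filter_eq_length_iff.mp (le_antisymm (List.length_filter_le _ _) h2) x hx
  simpa using h3

theorem IsReducedWord.letter_le {σ : List ℕ} (hσ : IsReducedWord σ) {N : ℕ}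
    (hN : ∀ i, N < i → wordPerm σ i = i) {x : ℕ} (hx : x ∈ σ) : x ≤ N + σ.length := by
  by_contra hlt
  have h1 : Finset.Ioc N x ⊆ σ.toFinset := by
    intro g hg
    rw [Finset.mem_Ioc] at hg
    rw [List.mem_toFinset]
    by_contra hgσ
    have := hσ.lt_of_not_mem hN hg.1 hgσ x hx
    omega
  have h2 := Finset.card_le_card h1
  have h3 := List.toFinset_card_le σ
  rw [Nat.card_Ioc] at h2
  omega

theorem FinitaryPerm.exists_bound {w : Equiv.Perm ℕ} (hw : FinitaryPerm w) :
    ∃ N, ∀ i, N < i → w⁻¹ i = i := by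
  obtain ⟨N, hN⟩ := hw.2.bddAbove
  refine ⟨N, fun i hi => ?_⟩
  rw [Equiv.Perm.inv_eq_iff_eq]
  by_contra h
  exact absurd (hN (show i ∈ {i | w i ≠ i} from fun h' => h h'.symm)) (by omega)

theorem exists_letter_bound_of_reduced {v : Equiv.Perm ℕ} {N : ℕ} (hN : ∀ i, N < i → v i = i) :
    ∃ M L, ∀ σ, IsReducedWordFor v σ → (∀ x ∈ σ, x ≤ M) ∧ σ.length = L := by
  by_cases h : ∃ σ, IsReducedWordFor v σ
  · obtain ⟨τ, hτ⟩ := h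
    refine ⟨N + τ.length, τ.length, fun σ hσ => ?_⟩
    have hlen : σ.length = τ.length :=
      le_antisymm (hσ.1.2 τ hτ.1.1 (hτ.2.trans hσ.2.symm)) (hτ.1.2 σ hσ.1.1 (hσ.2.trans hτ.2.symm))
    refine ⟨fun x hx => ?_, hlen⟩
    rw [← hlen]
    exact hσ.1.letter_le (fun i hi => hσ.2.symm ▸ hN i hi) hx
  · exact ⟨0, 0, fun σ hσ => absurd ⟨σ, hσ⟩ h⟩

theorem finite_words (M L : ℕ) : {σ : List ℕ | (∀ x ∈ σ, x ≤ M) ∧ σ.length = L}.Finite := by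
  refine (List.finite_length_eq (Fin (M + 1)) L |>.image (List.map Fin.val)).subset ?_
  rintro σ ⟨h1, h2⟩
  refine ⟨σ.pmap (fun x hx => (⟨x, Nat.lt_succ_of_le hx⟩ : Fin (M + 1))) h1, by simpa using h2, ?_⟩
  rw [List.map_pmap]
  simp

/-! ### The words of factorizations -/

theorem foldr_append_blk (f : ℕ → List ℕ) (m : ℕ) :
    ((((List.range (m + 1)).reverse).filter (fun j => decide (0 ≤ j))).map f).foldr (· ++ ·) [] =
      blk f 0 m ++ f 0 := by
  rw [List.filter_eq_self.mpr (by simp)]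
  induction m with
  | zero => simp [blk]
  | succ m ih =>
    rw [List.range_succ, List.reverse_append, List.reverse_singleton, List.singleton_append,
      List.map_cons, List.foldr_cons, ih, blk, zero_add, List.append_assoc]

theorem factWord_eq_blk {f : ℕ → List ℕ} {n : ℕ} (h : ∀ i, i = 0 ∨ n < i → f i = []) :
    factWord f = blk f 0 n := by
  have hb : BddAbove {i | f i ≠ []} := ⟨n, fun i hi => by
    by_contra hlt; exact hi (h i (Or.inr (by omega)))⟩
  have htop : ∀ i, topIdx f < i → f i = [] := by
    intro i hi
    by_contra hne
    exact absurd (le_csSup hb hne) (by unfold topIdx at hi; omega)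
  unfold factWord factWordGe
  rw [foldr_append_blk, h 0 (Or.inl rfl), List.append_nil]
  rcases le_total (topIdx f) n with h1 | h1
  · rw [blk_eq_of_empty h1 htop]
  · rw [blk_eq_of_empty h1 fun i hi => h i (Or.inr hi)]

theorem IsFlag.monotoneOn {φ : ℕ → ℕ} (hφ : IsFlag φ) {A : Finset ℕ} (hA : ∀ a ∈ A, 1 ≤ a) :
    MonotoneOn φ A := fun a ha b _ h => hφ.1 a b (hA a ha) h

theorem mem_XF_iff_of_isFlag {n : ℕ} {φ : ℕ → ℕ} (hφ : IsFlag φ) {ρ₀ : List ℕ}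
    (hρ : IsReducedWord ρ₀) {f : ℕ → List ℕ} : f ∈ XF n φ ρ₀ ↔
      (∀ i, i = 0 ∨ n < i → f i = []) ∧ IncreasingFact f ∧ FlaggedFact φ f ∧
        CKEquiv ρ₀ (blk f 0 n) := by
  have hc : ∀ a ∈ colSet ρ₀, φ a = φ (max a 1) := fun a ha => by
    rw [max_eq_left (hρ.1 a (mem_of_mem_colSet ha))]
  have hinc : ∀ f : ℕ → List ℕ, IncreasingFact f ↔ ∀ i, (f i).Pairwise (· < ·) := fun f =>
    forall_congr' fun i => List.isChain_iff_pairwise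
  rw [XF_congr hc, mem_XF_iff hρ.good fun a b h => hφ.1 _ _ (by omega) (by omega), hinc]
  refine and_congr_right fun h0 => and_congr_right fun h1 => and_congr_left fun h2 => ?_
  have hpos : ∀ i, ∀ x ∈ f i, 1 ≤ x := fun i x hx =>
    hρ.1 x ((h2.mem_iff x).mpr (mem_of_mem_block h0 hx).2.2)
  refine forall_congr' fun i => ?_
  have hp := hpos i
  have h1' := h1 i
  clear hpos h0 h1 h2
  generalize f i = v at hp h1' ⊢
  rcases v with - | ⟨y, u⟩
  · simp
  · have hy := hp y (by simp)
    simp only [ne_eq, reduceCtorEq, not_false_eq_true, forall_const, List.headI]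
    constructor
    · intro h
      have := h y (by simp)
      rwa [max_eq_left hy] at this
    · intro h x hx
      have hx1 := hp x hx
      rw [max_eq_left hx1]
      refine h.trans (hφ.1 y x hy ?_)
      rcases List.mem_cons.mp hx with rfl | hx
      · exact le_rfl
      · exact (List.rel_of_pairwise_cons h1' hx).le

theorem IsReducedWordFor.rfc_eq_biUnion {v : Equiv.Perm ℕ} {φ : ℕ → ℕ} (hφ : IsFlag φ) {n : ℕ}
    (hn : ∀ σ, IsReducedWordFor v σ → ∀ x ∈ σ, φ x ≤ n) :
    RFCset v φ = ⋃ σ ∈ {σ | IsReducedWordFor v σ ∧ Yamanouchi σ}, XF n φ σ := by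
  ext f
  simp only [Set.mem_iUnion, Set.mem_setOf_eq, exists_prop]
  constructor
  · rintro ⟨h0, hfin, hinc, hflag, hred⟩
    obtain ⟨m, hm⟩ := hfin.bddAbove
    have hm0 : ∀ i, i = 0 ∨ m < i → f i = [] := by
      rintro i (rfl | hi)
      · exact h0
      · by_contra hne
        exact absurd (hm hne) (by omega)
    have hword := factWord_eq_blk hm0
    have hn0 : ∀ i, i = 0 ∨ n < i → f i = [] := by
      rintro i (rfl | hi)
      · exact h0
      · by_contra hne
        have h1 := hflag i hne
        obtain ⟨x, u, hxu⟩ := List.exists_cons_of_ne_nil hne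
        rw [hxu, List.headI] at h1
        have hx := (mem_of_mem_block hm0 (i := i) (x := x) (by simp [hxu])).2.2
        have := hn _ hred x (hword ▸ hx)
        omega
    rw [factWord_eq_blk hn0] at hred
    obtain ⟨σ, hσ, hck, -⟩ := exists_yamanouchi hred.1
    exact ⟨σ, ⟨hck.isReducedWordFor hred, hσ⟩,
      (mem_XF_iff_of_isFlag hφ hσ.1).mpr ⟨hn0, hinc, hflag, hck.symm⟩⟩
  · rintro ⟨σ, ⟨hσ, -⟩, hf⟩
    obtain ⟨hn0, hinc, hflag, hck⟩ := (mem_XF_iff_of_isFlag hφ hσ.1).mp hf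
    refine ⟨hn0 0 (Or.inl rfl), ?_, hinc, hflag, ?_⟩
    · refine (Set.finite_Iic n).subset fun i hi => ?_
      by_contra hlt
      exact hi (hn0 i (Or.inr (by simpa using hlt)))
    · rw [factWord_eq_blk hn0]
      exact hck.isReducedWordFor hσ

theorem Yamanouchi.spec {σ : List ℕ} (hσ : Yamanouchi σ) :
    (∀ τ, Yamanouchi τ → CKEquiv σ τ → τ = σ) ∧ WeakComp (desComp σ) ∧
      rowsOf (desComp σ) (colSet σ) ∧
      ∀ n φ, MonotoneOn φ (colSet σ) → (∀ a ∈ colSet σ, φ a ≤ n) →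
        genF n φ σ = flaggedKeyPoly (desComp σ) φ := by
  obtain ⟨τ, -, -, h1, h2⟩ := exists_yamanouchi hσ.1
  obtain rfl := h1 σ hσ (CKEquiv.refl σ)
  exact ⟨h1, h2⟩

end

/-- final Corollary.
For every `w ∈ S∞` and flag `φ`, the `φ`-flagged Schubert polynomial
`𝔖_{(w,φ)} = Σ_{ρ^• ∈ RFC(w⁻¹,φ)} x^{wt(ρ^•)}` equals `Σ_α κ_{(α,φ)}`, where `α` ranges
over all weak compositions with `YR_α(w⁻¹)` nonempty, counted with multiplicity
`|YR_α(w⁻¹)|` (that is, the sum over all Yamanouchi reduced words `σ` of `w⁻¹` of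
`κ_{(des(σ), φ)}`); moreover each `κ_{(α,φ)}` is itself a key polynomial. -/
theorem flagged_schubert_key_expansion (w : Equiv.Perm ℕ) (hw : FinitaryPerm w)
    (φ : ℕ → ℕ) (hφ : IsFlag φ) :
    (∑ᶠ f ∈ RFCset w⁻¹ φ, xExp (fun i => (f i).length)) =
      (∑ᶠ σ ∈ {σ : List ℕ | IsReducedWordFor w⁻¹ σ ∧ Yamanouchi σ},
        flaggedKeyPoly (desComp σ) φ) ∧
    (∀ α : ℕ → ℕ, WeakComp α →
      {σ : List ℕ | IsReducedWordFor w⁻¹ σ ∧ Yamanouchi σ ∧ desComp σ = α}.Nonempty →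
      ∃ β : ℕ → ℕ, WeakComp β ∧ flaggedKeyPoly α φ = keyPoly β) := by
  have hpos : ∀ σ, Yamanouchi σ → ∀ a ∈ colSet σ, 1 ≤ a := fun σ hσ a ha =>
    hσ.1.1 a (mem_of_mem_colSet ha)
  constructor
  · obtain ⟨N, hN⟩ := hw.exists_bound
    obtain ⟨M, L, hML⟩ := exists_letter_bound_of_reduced hN
    have hn : ∀ σ, IsReducedWordFor w⁻¹ σ → ∀ x ∈ σ, φ x ≤ φ M := fun σ hσ x hx =>
      hφ.1 x M (hσ.1.1 x hx) ((hML σ hσ).1 x hx)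
    rw [IsReducedWordFor.rfc_eq_biUnion hφ hn, finsum_mem_biUnion]
    · refine finsum_mem_congr rfl fun σ hσ => ?_
      exact hσ.2.spec.2.2.2 _ _ (hφ.monotoneOn (hpos σ hσ.2)) fun a ha =>
        hn σ hσ.1 a (mem_of_mem_colSet ha)
    · intro σ hσ τ hτ hne
      refine Set.disjoint_left.mpr fun f hf hf' => hne ?_
      exact hτ.2.spec.1 σ hσ.2 (hf'.2.2.2.trans hf.2.2.2.symm)
    · exact (finite_words M L).subset fun σ hσ => hML σ hσ.1
    · exact fun σ _ => XF_finite _ _ _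
  · rintro α - ⟨σ, -, hσ, rfl⟩
    obtain ⟨-, hα, hA, -⟩ := hσ.spec
    have hmono := hφ.monotoneOn (hpos σ hσ)
    obtain ⟨n, hn⟩ := exists_bound_on (colSet σ) φ
    obtain ⟨δ, -, hδ⟩ := (flaggedKeyPoly_isKey hα hA hmono hn).resolve_left
      (flaggedKeyPoly_ne_zero hα hA fun a ha => hφ.2 a (hpos σ hσ a ha))
    exact ⟨δ, hδ.weakComp, hδ.unique (keyPoly_isKey hδ.weakComp)⟩

end
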